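/- arXiv:1711.04381 — 2 statements merged into one kernel-verified Lean document; each statement's English description precedes it below -/
import Mathlib

section
/- Let n ≥ 3 and let A_ε := {x ∈ ℝⁿ : ε < ‖x‖ < 1} for 0 < ε < 1, and let B₁ be the open unit ball in ℝⁿ. There exists ε₀ ∈ (0,1) such that for all ε ∈ (0, ε₀), σ₁(A_ε) · H^{n−1}(∂A_ε)^{1/(n−1)} > σ₁(B₁) · H^{n−1}(∂B₁)^{1/(n−1)}. -/
open MeasureTheory

/-- The first nonzero Steklov eigenvalue of a domain `Ω ⊆ ℝⁿ`, defined variationally. -/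
noncomputable def stekSigma1 {n : ℕ} (Ω : Set (EuclideanSpace ℝ (Fin n))) : ℝ :=
  sInf { q : ℝ | ∃ f : EuclideanSpace ℝ (Fin n) → ℝ, ContDiff ℝ (⊤ : ℕ∞) f ∧
    (∫ x in frontier Ω, f x ∂(μH[(n : ℝ) - 1])) = 0 ∧
    (0 < ∫ x in frontier Ω, (f x) ^ 2 ∂(μH[(n : ℝ) - 1])) ∧
    q = (∫ x in Ω, ‖gradient f x‖ ^ 2) /
        (∫ x in frontier Ω, (f x) ^ 2 ∂(μH[(n : ℝ) - 1])) }

open scoped Pointwise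

section RotationInvariant

variable {E : Type*} [NormedAddCommGroup E] [InnerProductSpace ℝ E]
  [MeasurableSpace E] [BorelSpace E]

/-- A rotation invariant measure gives the same mass to all balls of a given radius centred on
the unit sphere. -/
lemma measureReal_ball_eq_of_invariant {μ : Measure E}
    (hμ : ∀ e : E ≃ₗᵢ[ℝ] E, μ.map e = μ) {x y : E} (hx : ‖x‖ = 1) (hy : ‖y‖ = 1) (r : ℝ) :
    μ.real (Metric.ball x r) = μ.real (Metric.ball y r) := by
  set e := (ℝ ∙ (x - y))ᗮ.reflection with he
  have hexy : e x = y := Submodule.reflection_sub (hx.trans hy.symm)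
  have h1 : e ⁻¹' Metric.ball y r = Metric.ball x r := by
    rw [← hexy]; exact e.isometry.preimage_ball x r
  rw [← h1, ← map_measureReal_apply e.continuous.measurable measurableSet_ball, hμ]

variable [FiniteDimensional ℝ E]

lemma integrable_of_continuous_of_sphere {μ : Measure E} [IsFiniteMeasure μ]
    (hS : ∀ᵐ x ∂μ, ‖x‖ = 1) {g : E → ℝ} (hg : Continuous g) : Integrable g μ := by
  have h1 : μ.restrict (Metric.sphere (0 : E) 1) = μ :=
    Measure.restrict_eq_self_of_ae_mem (by simpa using hS)
  rw [← h1]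
  exact hg.continuousOn.integrableOn_compact (isCompact_sphere 0 1)

/-- Two rotation invariant finite measures on the unit sphere are proportional. -/
theorem integral_mul_eq_of_invariant {μ ν : Measure E} [IsFiniteMeasure μ] [IsFiniteMeasure ν]
    (hμ : ∀ e : E ≃ₗᵢ[ℝ] E, μ.map e = μ) (hν : ∀ e : E ≃ₗᵢ[ℝ] E, ν.map e = ν)
    (hμS : ∀ᵐ x ∂μ, ‖x‖ = 1) (hνS : ∀ᵐ x ∂ν, ‖x‖ = 1) {g : E → ℝ} (hg : Continuous g) :
    ν.real Set.univ * ∫ x, g x ∂μ = μ.real Set.univ * ∫ x, g x ∂ν := by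
  classical
  rcases (Metric.sphere (0 : E) 1).eq_empty_or_nonempty with hemp | ⟨z, hz⟩
  · have h0 : ∀ x : E, ¬ ‖x‖ = 1 := fun x hx => by
      have : x ∈ Metric.sphere (0 : E) 1 := by simpa using hx
      simp [hemp] at this
    simp only [h0, Filter.eventually_false_iff_eq_bot, ae_eq_bot] at hμS hνS
    simp [hμS, hνS]
  have hz1 : ‖z‖ = 1 := by simpa using hz
  set M := μ.real Set.univ with hM
  set N := ν.real Set.univ with hN
  have key : ∀ ω > 0, |N * ∫ x, g x ∂μ - M * ∫ x, g x ∂ν| ≤ ω * (M * N) := by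
    intro ω hω
    obtain ⟨r, hr, hgr⟩ := Metric.uniformContinuousOn_iff.1
      ((isCompact_sphere (0 : E) 1).uniformContinuousOn_of_continuous hg.continuousOn) ω hω
    set D : Set (E × E) := {p | dist p.1 p.2 < r} with hD
    have hDm : MeasurableSet D := (isOpen_lt (by fun_prop) continuous_const).measurableSet
    set a := μ.real (Metric.ball z r) with ha
    set b := ν.real (Metric.ball z r) with hb
    have hI : ∀ f : E → ℝ, Continuous f →
        ∫ p, D.indicator (fun p => f p.1) p ∂(μ.prod ν) = b * ∫ x, f x ∂μ := by
      intro f hf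
      rw [integral_prod _ (((integrable_of_continuous_of_sphere hμS hf).comp_fst ν).indicator hDm),
        ← integral_const_mul]
      refine integral_congr_ae ?_
      filter_upwards [hμS] with x hx
      have : (fun y => D.indicator (fun p => f p.1) (x, y))
          = (Metric.ball x r).indicator (fun _ => f x) := by
        ext y
        simp only [Set.indicator, hD, Set.mem_ofPred_eq, Metric.mem_ball, dist_comm x y]
      rw [this, integral_indicator_const _ measurableSet_ball,
        measureReal_ball_eq_of_invariant hν hx hz1, smul_eq_mul]
    have hJ : ∀ f : E → ℝ, Continuous f →
        ∫ p, D.indicator (fun p => f p.2) p ∂(μ.prod ν) = a * ∫ x, f x ∂ν := by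
      intro f hf
      rw [integral_prod_symm _
        (((integrable_of_continuous_of_sphere hνS hf).comp_snd μ).indicator hDm),
        ← integral_const_mul]
      refine integral_congr_ae ?_
      filter_upwards [hνS] with x hx
      have : (fun y => D.indicator (fun p => f p.2) (y, x))
          = (Metric.ball x r).indicator (fun _ => f x) := by
        ext y
        simp only [Set.indicator, hD, Set.mem_ofPred_eq, Metric.mem_ball]
      rw [this, integral_indicator_const _ measurableSet_ball,
        measureReal_ball_eq_of_invariant hμ hx hz1, smul_eq_mul]
    have h1 : b * M = a * N := by
      have e1 := hI (fun _ => 1) continuous_const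
      have e2 := hJ (fun _ => 1) continuous_const
      simp only [integral_const, smul_eq_mul, mul_one] at e1 e2
      rw [hM, hN, ← e1, ← e2]
    have h2 : |b * ∫ x, g x ∂μ - a * ∫ x, g x ∂ν| ≤ ω * (b * M) := by
      have i1 := ((integrable_of_continuous_of_sphere hμS hg).comp_fst ν).indicator hDm
      have i2 := ((integrable_of_continuous_of_sphere hνS hg).comp_snd μ).indicator hDm
      have i3 : Integrable (D.indicator (fun p : E × E => (fun _ => ω) p.1)) (μ.prod ν) :=
        (integrable_const ω).indicator hDm
      have e1 := hI (fun _ => ω) continuous_const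
      rw [← hI g hg, ← hJ g hg, ← integral_sub i1 i2]
      have : ω * (b * M) = ∫ p, D.indicator (fun p : E × E => (fun _ => ω) p.1) p ∂(μ.prod ν) := by
        rw [e1]; simp [hM]; ring
      rw [this]
      refine (abs_integral_le_integral_abs).trans (integral_mono_ae (i1.sub i2).abs i3 ?_)
      have q1 : ∀ᵐ p ∂(μ.prod ν), ‖p.1‖ = 1 := Measure.quasiMeasurePreserving_fst.ae hμS
      have q2 : ∀ᵐ p ∂(μ.prod ν), ‖p.2‖ = 1 := Measure.quasiMeasurePreserving_snd.ae hνS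
      filter_upwards [q1, q2] with p h1 h2
      by_cases hp : p ∈ D
      · simp only [Set.indicator, hp, if_true]
        have := hgr p.1 (by simpa using h1) p.2 (by simpa using h2) hp
        rw [Real.dist_eq] at this
        exact this.le
      · simp [Set.indicator, hp]
    have hbn : 0 ≤ b := measureReal_nonneg
    rcases eq_or_lt_of_le hbn with hb0 | hbpos
    · have hν0 : ν = 0 := by
        have hc : ν (Metric.sphere (0 : E) 1) = 0 := by
          refine (isCompact_sphere (0 : E) 1).measure_zero_of_nhdsWithin fun x hx => ?_
          refine ⟨Metric.ball x r, mem_nhdsWithin_of_mem_nhds (Metric.ball_mem_nhds x hr), ?_⟩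
          have := measureReal_ball_eq_of_invariant hν (x := x) (by simpa using hx) hz1 r
          rw [← hb, ← hb0, measureReal_eq_zero_iff] at this
          exact this
        rw [← Measure.measure_univ_eq_zero, ← Set.union_compl_self (Metric.sphere (0 : E) 1)]
        refine measure_union_null hc ?_
        have : ∀ᵐ x ∂ν, x ∈ Metric.sphere (0 : E) 1 := by simpa using hνS
        exact this
      simp [hN, hν0]
    · have e1 : b * (N * ∫ x, g x ∂μ - M * ∫ x, g x ∂ν)
          = N * (b * ∫ x, g x ∂μ - a * ∫ x, g x ∂ν) := by
        linear_combination (-∫ x, g x ∂ν) * h1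
      have hN0 : 0 ≤ N := measureReal_nonneg
      have e2 : b * |N * ∫ x, g x ∂μ - M * ∫ x, g x ∂ν| ≤ b * (ω * (M * N)) := by
        have e3 := congrArg abs e1
        rw [abs_mul, abs_mul, abs_of_pos hbpos, abs_of_nonneg hN0] at e3
        rw [e3]
        nlinarith [mul_le_mul_of_nonneg_left h2 hN0]
      exact le_of_mul_le_mul_left e2 hbpos
  have h0 : |N * ∫ x, g x ∂μ - M * ∫ x, g x ∂ν| ≤ 0 := by
    refine le_of_forall_pos_le_add fun δ hδ => ?_
    have hMN : 0 ≤ M * N := mul_nonneg measureReal_nonneg measureReal_nonneg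
    refine (key (δ / (M * N + 1)) (by positivity)).trans ?_
    rw [zero_add, div_mul_eq_mul_div, div_le_iff₀ (by positivity)]
    nlinarith
  exact sub_eq_zero.1 (abs_nonpos_iff.1 h0)

end RotationInvariant

lemma lipschitzOnWith_normalize {E : Type*} [NormedAddCommGroup E] [NormedSpace ℝ E] :
    LipschitzOnWith 2 (fun x : E => ‖x‖⁻¹ • x) {x | 1 ≤ ‖x‖} := by
  refine LipschitzOnWith.of_dist_le_mul fun x (hx : 1 ≤ ‖x‖) y (hy : 1 ≤ ‖y‖) => ?_
  have hx0 : 0 < ‖x‖ := by linarith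
  have hy0 : 0 < ‖y‖ := by linarith
  have e : ‖x‖⁻¹ • x - ‖y‖⁻¹ • y = ‖x‖⁻¹ • (x - y) + (‖x‖⁻¹ * ((‖y‖ - ‖x‖) * ‖y‖⁻¹)) • y := by
    rw [smul_sub, sub_add, ← sub_smul]
    congr 2
    field_simp
    ring
  have hd : |‖y‖ - ‖x‖| ≤ ‖x - y‖ := by
    rw [abs_sub_comm]; exact abs_norm_sub_norm_le x y
  rw [dist_eq_norm, dist_eq_norm, e]
  refine (norm_add_le _ _).trans ?_
  rw [norm_smul, norm_smul]
  simp only [norm_inv, norm_mul, Real.norm_eq_abs, abs_norm]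
  have h1 : ‖x‖⁻¹ ≤ 1 := inv_le_one_of_one_le₀ hx
  have h2 : ‖x‖⁻¹ * (|‖y‖ - ‖x‖| * ‖y‖⁻¹) * ‖y‖ = ‖x‖⁻¹ * |‖y‖ - ‖x‖| := by field_simp
  have h3 : 0 ≤ ‖x‖⁻¹ := by positivity
  have h4 := norm_nonneg (x - y)
  push_cast
  rw [h2]
  nlinarith [mul_le_mul h1 hd (abs_nonneg _) zero_le_one, mul_le_mul_of_nonneg_right h1 h4]

section Hausdorff

variable {n : ℕ}

lemma hausdorffMeasure_sphere_lt_top (hn : 1 ≤ n) :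
    μH[(n : ℝ) - 1] (Metric.sphere (0 : EuclideanSpace ℝ (Fin n)) 1) < ⊤ := by
  obtain ⟨m, rfl⟩ : ∃ m, n = m + 1 := ⟨n - 1, by omega⟩
  have hm : (((m + 1 : ℕ) : ℝ) - 1) = (Fintype.card (Fin m) : ℝ) := by simp
  rw [hm]
  set ins : Fin (m + 1) → ℝ → (Fin m → ℝ) → EuclideanSpace ℝ (Fin (m + 1)) :=
    fun i s v => WithLp.toLp 2 (i.insertNth s v) with hins
  set K : Set (Fin m → ℝ) := Set.Icc (fun _ => -1) (fun _ => 1) with hK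
  have hcover : Metric.sphere (0 : EuclideanSpace ℝ (Fin (m + 1))) 1 ⊆
      ⋃ i : Fin (m + 1), (((fun x => ‖x‖⁻¹ • x) ∘ ins i 1) '' K) ∪
        (((fun x => ‖x‖⁻¹ • x) ∘ ins i (-1)) '' K) := by
    intro x hx
    have hx1 : ‖x‖ = 1 := by simpa using hx
    obtain ⟨i, hi⟩ := Finite.exists_max (fun i => |x i|)
    have hxi : 0 < |x i| := by
      by_contra! h
      have : x = 0 := by
        ext j
        exact abs_nonpos_iff.1 ((hi j).trans h)
      simp [this] at hx1
    have hxi0 : x i ≠ 0 := abs_pos.1 hxi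
    have hkey : ∀ s : ℝ, x i = s * |x i| →
        x = ((fun x => ‖x‖⁻¹ • x) ∘ ins i s) (fun j => |x i|⁻¹ * x (i.succAbove j)) := by
      intro s hs
      have e : ins i s (fun j => |x i|⁻¹ * x (i.succAbove j)) = |x i|⁻¹ • x := by
        ext j
        simp only [hins, PiLp.smul_apply, smul_eq_mul]
        refine Fin.succAboveCases i ?_ (fun j => ?_) j
        · simp only [Fin.insertNth_apply_same]
          rw [eq_inv_mul_iff_mul_eq₀ hxi.ne']
          linarith
        · simp
      simp only [Function.comp, e, norm_smul, hx1, norm_inv, Real.norm_eq_abs, abs_abs, mul_one,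
        inv_inv]
      rw [smul_smul, mul_inv_cancel₀ hxi.ne', one_smul]
    have hmem : (fun j => |x i|⁻¹ * x (i.succAbove j)) ∈ K := by
      have : ∀ j, |(|x i|⁻¹ * x (i.succAbove j))| ≤ 1 := fun j => by
        rw [abs_mul, abs_inv, abs_abs, inv_mul_le_iff₀ hxi, mul_one]
        exact hi _
      exact ⟨fun j => (abs_le.1 (this j)).1, fun j => (abs_le.1 (this j)).2⟩
    refine Set.mem_iUnion.2 ⟨i, ?_⟩
    rcases lt_or_gt_of_ne hxi0 with h | h
    · right
      exact ⟨_, hmem, (hkey (-1) (by rw [abs_of_neg h]; ring)).symm⟩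
    · left
      exact ⟨_, hmem, (hkey 1 (by rw [abs_of_pos h]; ring)).symm⟩
  have hpiece : ∀ i : Fin (m + 1), ∀ s : ℝ, |s| = 1 →
      μH[(Fintype.card (Fin m) : ℝ)] (((fun x => ‖x‖⁻¹ • x) ∘ ins i s) '' K) < ⊤ := by
    intro i s hs
    have hl1 : LipschitzWith 1 (fun v : Fin m → ℝ => (i.insertNth s v : Fin (m + 1) → ℝ)) := by
      refine LipschitzWith.of_dist_le_mul fun v w => ?_
      rw [NNReal.coe_one, one_mul, dist_pi_le_iff dist_nonneg]
      intro j
      refine Fin.succAboveCases i ?_ (fun j => ?_) j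
      · simp
      · simpa using dist_le_pi_dist v w j
    have hl2 : LipschitzWith _ (ins i s) :=
      (PiLp.lipschitzWith_toLp 2 (fun _ : Fin (m + 1) => ℝ)).comp hl1
    have hl3 : LipschitzOnWith _ ((fun x => ‖x‖⁻¹ • x) ∘ ins i s) K :=
      (lipschitzOnWith_normalize).comp hl2.lipschitzOnWith fun v _ => by
        have := PiLp.norm_apply_le (ins i s v) i
        simpa [hins, hs] using this
    refine (hl3.hausdorffMeasure_image_le (Nat.cast_nonneg _)).trans_lt ?_
    rw [hausdorffMeasure_pi_real]
    refine ENNReal.mul_lt_top ?_ ?_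
    · exact ENNReal.rpow_lt_top_of_nonneg (Nat.cast_nonneg _) ENNReal.coe_ne_top
    · exact isCompact_Icc.measure_lt_top
  refine (measure_mono hcover).trans_lt ((measure_iUnion_le _).trans_lt ?_)
  rw [tsum_fintype]
  exact ENNReal.sum_lt_top.2 fun i _ => (measure_union_le _ _).trans_lt
    (ENNReal.add_lt_top.2 ⟨hpiece i 1 (by simp), hpiece i (-1) (by simp)⟩)

lemma hausdorffMeasure_sphere_pos (hn : 1 ≤ n) :
    0 < μH[(n : ℝ) - 1] (Metric.sphere (0 : EuclideanSpace ℝ (Fin n)) 1) := by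
  obtain ⟨m, rfl⟩ : ∃ m, n = m + 1 := ⟨n - 1, by omega⟩
  have hm : (((m + 1 : ℕ) : ℝ) - 1) = (Fintype.card (Fin m) : ℝ) := by simp
  rw [hm]
  set pr : EuclideanSpace ℝ (Fin (m + 1)) → (Fin m → ℝ) := fun x j => x j.succ with hpr
  have hl : LipschitzWith 1 pr := by
    refine LipschitzWith.of_dist_le_mul fun v w => ?_
    rw [NNReal.coe_one, one_mul, dist_pi_le_iff dist_nonneg]
    intro j
    have := PiLp.norm_apply_le (v - w) j.succ
    simpa [dist_eq_norm] using this
  set U : Set (Fin m → ℝ) := {v | ∑ j, v j ^ 2 < 1} with hU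
  have hUo : IsOpen U := isOpen_lt (by fun_prop) continuous_const
  have hsub : U ⊆ pr '' Metric.sphere (0 : EuclideanSpace ℝ (Fin (m + 1))) 1 := by
    intro v hv
    have hv' : ∑ j, v j ^ 2 < 1 := hv
    refine ⟨WithLp.toLp 2 (Fin.cons √(1 - ∑ j, v j ^ 2) v), ?_, ?_⟩
    · rw [mem_sphere_zero_iff_norm, EuclideanSpace.norm_eq]
      simp only [Fin.sum_univ_succ, Fin.cons_zero, Fin.cons_succ, Real.norm_eq_abs, sq_abs]
      rw [Real.sq_sqrt (by linarith)]
      simp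
    · ext j
      simp [hpr]
  have h1 := hl.hausdorffMeasure_image_le (d := Fintype.card (Fin m)) (Nat.cast_nonneg _)
    (Metric.sphere (0 : EuclideanSpace ℝ (Fin (m + 1))) 1)
  rw [hausdorffMeasure_pi_real] at h1
  simp only [ENNReal.coe_one, ENNReal.one_rpow, one_mul] at h1
  exact (hUo.measure_pos volume ⟨0, by simp [hU]⟩).trans_le ((measure_mono hsub).trans h1)

lemma map_hausdorffMeasure_restrict_sphere (e : EuclideanSpace ℝ (Fin n) ≃ₗᵢ[ℝ]
    EuclideanSpace ℝ (Fin n)) (d : ℝ) :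
    (μH[d].restrict (Metric.sphere (0 : EuclideanSpace ℝ (Fin n)) 1)).map e =
      μH[d].restrict (Metric.sphere (0 : EuclideanSpace ℝ (Fin n)) 1) := by
  have h1 : e ⁻¹' Metric.sphere (0 : EuclideanSpace ℝ (Fin n)) 1 = Metric.sphere 0 1 := by
    ext x; simp
  have h2 := (e.toIsometryEquiv.measurePreserving_hausdorffMeasure d).restrict_preimage
    (Metric.isClosed_sphere (x := (0 : EuclideanSpace ℝ (Fin n))) (ε := 1)).measurableSet
  have h3 := h2.map_eq
  simp only [LinearIsometryEquiv.coe_toIsometryEquiv, h1] at h3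
  exact h3

/-- Integration over a sphere of radius `ε`, pulled back to the unit sphere. -/
lemma setIntegral_sphere_hausdorffMeasure {ε : ℝ} (hε : 0 < ε) (hn : 1 ≤ n)
    (g : EuclideanSpace ℝ (Fin n) → ℝ) :
    ∫ x in Metric.sphere 0 ε, g x ∂μH[(n : ℝ) - 1] =
      ε ^ (n - 1) * ∫ x in Metric.sphere 0 1, g (ε • x) ∂μH[(n : ℝ) - 1] := by
  have hd : (0 : ℝ) ≤ (n : ℝ) - 1 := by
    have : (1 : ℝ) ≤ n := by exact_mod_cast hn
    linarith
  have hemb : MeasurableEmbedding (fun x : EuclideanSpace ℝ (Fin n) => ε • x) :=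
    (Homeomorph.smulOfNeZero ε hε.ne').measurableEmbedding
  have hpre : (fun x : EuclideanSpace ℝ (Fin n) => ε • x) ⁻¹' Metric.sphere 0 ε
      = Metric.sphere 0 1 := by
    ext x
    simp [norm_smul, abs_of_pos hε, hε.ne']
  have hmap : (μH[(n : ℝ) - 1] : Measure (EuclideanSpace ℝ (Fin n))) =
      ENNReal.ofReal (ε ^ (n - 1)) • (μH[(n : ℝ) - 1]).map (fun x => ε • x) := by
    ext s hs
    rw [Measure.smul_apply, Measure.map_apply hemb.measurable hs, smul_eq_mul]
    have : s = ε • ((fun x : EuclideanSpace ℝ (Fin n) => ε • x) ⁻¹' s) := by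
      ext x
      simp [Set.mem_smul_set_iff_inv_smul_mem₀ hε.ne', smul_smul, hε.ne']
    conv_lhs => rw [this, Measure.hausdorffMeasure_smul₀ hd hε.ne']
    rw [ENNReal.smul_def, smul_eq_mul]
    congr 1
    rw [← ENNReal.ofReal_coe_nnreal]
    congr 1
    rw [NNReal.coe_rpow, coe_nnnorm, Real.norm_eq_abs, abs_of_pos hε, ← Real.rpow_natCast,
      Nat.cast_sub hn, Nat.cast_one]
  conv_lhs => rw [hmap, Measure.restrict_smul, integral_smul_measure,
    hemb.restrict_map, hemb.integral_map, hpre, ENNReal.toReal_ofReal (by positivity), smul_eq_mul]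

lemma hausdorffMeasure_sphere_radius {ε : ℝ} (hε : 0 < ε) (hn : 1 ≤ n) :
    (μH[(n : ℝ) - 1] (Metric.sphere (0 : EuclideanSpace ℝ (Fin n)) ε)).toReal =
      ε ^ (n - 1) * (μH[(n : ℝ) - 1] (Metric.sphere (0 : EuclideanSpace ℝ (Fin n)) 1)).toReal := by
  have h := setIntegral_sphere_hausdorffMeasure hε hn (fun _ => 1)
  simpa [Measure.real] using h

end Hausdorff

open ProbabilityTheory in
lemma setIntegral_Ioi_id_gaussianReal (t : ℝ) :
    ∫ x in Set.Ioi t, x ∂(gaussianReal 0 1) = gaussianPDFReal 0 1 t := by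
  have hder : ∀ x : ℝ, HasDerivAt (fun x => -gaussianPDFReal 0 1 x)
      (gaussianPDFReal 0 1 x * x) x := by
    intro x
    simp only [gaussianPDFReal_def]
    have h1 : HasDerivAt (fun x : ℝ => -(x - 0) ^ 2 / (2 * ((1 : NNReal) : ℝ))) (-x) x := by
      have := (((hasDerivAt_id x).sub_const 0).pow 2).neg.div_const (2 * ((1 : NNReal) : ℝ))
      refine this.congr_deriv ?_
      simp only [id_eq, NNReal.coe_one]
      ring
    have h2 := (h1.exp.const_mul (√(2 * Real.pi * ((1 : NNReal) : ℝ)))⁻¹).neg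
    refine h2.congr_deriv ?_
    ring
  have hgint : Integrable (fun x : ℝ => gaussianPDFReal 0 1 x * x) := by
    have h := IsGaussian.integrable_id (μ := gaussianReal 0 1)
    rw [gaussianReal_of_var_ne_zero _ one_ne_zero, integrable_withDensity_iff_integrable_smul'
      (measurable_gaussianPDF _ _) (by simp [gaussianPDF_lt_top])] at h
    simpa [toReal_gaussianPDF] using h
  have hlim : Filter.Tendsto (fun x => -gaussianPDFReal 0 1 x) Filter.atTop (nhds 0) := by
    rw [← neg_zero]
    refine Filter.Tendsto.neg ?_
    simp only [gaussianPDFReal_def]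
    rw [← mul_zero ((√(2 * Real.pi * ((1 : NNReal) : ℝ)))⁻¹)]
    refine Filter.Tendsto.const_mul _ (Real.tendsto_exp_atBot.comp ?_)
    have : Filter.Tendsto (fun x : ℝ => x ^ 2 / 2) Filter.atTop Filter.atTop :=
      (Filter.tendsto_pow_atTop two_ne_zero).atTop_div_const two_pos
    refine (Filter.tendsto_neg_atTop_atBot.comp this).congr fun x => ?_
    simp [neg_div]
  have h := integral_Ioi_of_hasDerivAt_of_tendsto' (a := t) (fun x _ => hder x)
    hgint.integrableOn hlim
  rw [gaussianReal_of_var_ne_zero _ one_ne_zero, restrict_withDensity measurableSet_Ioi,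
    integral_withDensity_eq_integral_toReal_smul (measurable_gaussianPDF _ _)
      (by simp [gaussianPDF_lt_top])]
  simpa [toReal_gaussianPDF] using h

open ProbabilityTheory in
lemma setIntegral_prod_sub_gaussianReal (t : ℝ) :
    ∫ p in Set.Ioi t ×ˢ Set.Iic t, (p.1 - p.2) ∂((gaussianReal 0 1).prod (gaussianReal 0 1)) =
      gaussianPDFReal 0 1 t := by
  have hid : Integrable (fun x : ℝ => x) (gaussianReal 0 1) := IsGaussian.integrable_id
  have hIic : ∫ x in Set.Iic t, x ∂(gaussianReal 0 1) = -gaussianPDFReal 0 1 t := by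
    have h := integral_add_compl (measurableSet_Ioi (a := t)) hid
    rw [setIntegral_Ioi_id_gaussianReal, integral_id_gaussianReal, Set.compl_Ioi] at h
    linarith
  have hone : (gaussianReal 0 1).real (Set.Ioi t) + (gaussianReal 0 1).real (Set.Iic t) = 1 := by
    rw [← Set.compl_Ioi, ← probReal_add_probReal_compl (μ := gaussianReal 0 1)
      (measurableSet_Ioi (a := t))]
  rw [← Measure.prod_restrict, integral_sub (hid.restrict.comp_fst _) (hid.restrict.comp_snd _)]
  rw [integral_fun_fst (fun x => x), integral_fun_snd (fun x => x), hIic,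
    setIntegral_Ioi_id_gaussianReal]
  simp only [measureReal_restrict_apply_univ, smul_eq_mul]
  linear_combination (gaussianPDFReal 0 1 t) * hone

lemma sq_sub_le_mul_intervalIntegral {g g' : ℝ → ℝ} (hg : ∀ t, HasDerivAt g (g' t) t)
    (hg' : Continuous g') {x y : ℝ} (h : y ≤ x) :
    (g x - g y) ^ 2 ≤ (x - y) * ∫ t in y..x, g' t ^ 2 := by
  rcases h.eq_or_lt with rfl | h
  · simp
  have hI : ∫ t in y..x, g' t = g x - g y :=
    intervalIntegral.integral_eq_sub_of_hasDerivAt (fun t _ => hg t) (hg'.intervalIntegrable _ _)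
  set I := g x - g y
  set J := ∫ t in y..x, g' t ^ 2
  have h0 : 0 ≤ ∫ t in y..x, ((x - y) * g' t - I) ^ 2 :=
    intervalIntegral.integral_nonneg h.le fun t _ => sq_nonneg _
  have h1 : ∫ t in y..x, ((x - y) * g' t - I) ^ 2 =
      (x - y) ^ 2 * J - 2 * (x - y) * I * I + (x - y) * I ^ 2 := by
    have : ∀ t, ((x - y) * g' t - I) ^ 2 =
        (x - y) ^ 2 * g' t ^ 2 - 2 * (x - y) * I * g' t + I ^ 2 := fun t => by ring
    simp only [this]
    rw [intervalIntegral.integral_add, intervalIntegral.integral_sub,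
      intervalIntegral.integral_const_mul, intervalIntegral.integral_const_mul, hI,
      intervalIntegral.integral_const, smul_eq_mul]
    all_goals exact Continuous.intervalIntegrable (by fun_prop) _ _
  rw [h1] at h0
  have h2 : 0 ≤ (x - y) * ((x - y) * J - I ^ 2) := by nlinarith
  have h3 := nonneg_of_mul_nonneg_right h2 (sub_pos.2 h)
  linarith

open ProbabilityTheory in
/-- The Poincaré inequality for the standard Gaussian measure on the line. -/
theorem lintegral_sq_sub_gaussianReal_le {g g' : ℝ → ℝ} (hg : ∀ t, HasDerivAt g (g' t) t)
    (hg' : Continuous g') :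
    ∫⁻ x, ∫⁻ y, ENNReal.ofReal ((g x - g y) ^ 2) ∂(gaussianReal 0 1) ∂(gaussianReal 0 1) ≤
      2 * ∫⁻ t, ENNReal.ofReal (g' t ^ 2) ∂(gaussianReal 0 1) := by
  set γ := gaussianReal 0 1 with hγ
  set R : ℝ × ℝ → Set ℝ := fun p => Set.Ico p.2 p.1
  set H : ℝ × ℝ → ENNReal := fun p => ∫⁻ t, (Set.Ioi t ×ˢ Set.Iic t).indicator
    (fun p : ℝ × ℝ => ENNReal.ofReal (p.1 - p.2)) p * ENNReal.ofReal (g' t ^ 2) with hH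
  have hmeas : Measurable (fun q : (ℝ × ℝ) × ℝ => (Set.Ioi q.2 ×ˢ Set.Iic q.2).indicator
      (fun p : ℝ × ℝ => ENNReal.ofReal (p.1 - p.2)) q.1 * ENNReal.ofReal (g' q.2 ^ 2)) := by
    refine Measurable.mul ?_ (by fun_prop)
    have : (fun q : (ℝ × ℝ) × ℝ => (Set.Ioi q.2 ×ˢ Set.Iic q.2).indicator
      (fun p : ℝ × ℝ => ENNReal.ofReal (p.1 - p.2)) q.1) =
      Set.indicator {q : (ℝ × ℝ) × ℝ | q.2 < q.1.1 ∧ q.1.2 ≤ q.2}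
        (fun q => ENNReal.ofReal (q.1.1 - q.1.2)) := by
      ext q; simp [Set.indicator]
    rw [this]
    refine Measurable.indicator (by fun_prop) ?_
    exact (measurableSet_lt measurable_snd measurable_fst.fst).inter
      (measurableSet_le measurable_fst.snd measurable_snd)
  have hHm : Measurable H := hmeas.lintegral_prod_right'
  have hHint : ∫⁻ p, H p ∂(γ.prod γ) ≤ ∫⁻ t, ENNReal.ofReal (g' t ^ 2) ∂γ := by
    rw [hH, lintegral_lintegral_swap hmeas.aemeasurable]
    have e1 : ∀ t : ℝ, ∫⁻ p, (Set.Ioi t ×ˢ Set.Iic t).indicator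
        (fun p : ℝ × ℝ => ENNReal.ofReal (p.1 - p.2)) p * ENNReal.ofReal (g' t ^ 2) ∂(γ.prod γ) =
        gaussianPDF 0 1 t * ENNReal.ofReal (g' t ^ 2) := by
      intro t
      have hm : MeasurableSet (Set.Ioi t ×ˢ Set.Iic t) := measurableSet_Ioi.prod measurableSet_Iic
      have hid : Integrable (fun x : ℝ => x) γ := IsGaussian.integrable_id
      rw [lintegral_mul_const _ (by fun_prop (disch := exact hm)), lintegral_indicator hm,
        gaussianPDF, ← setIntegral_prod_sub_gaussianReal, ofReal_integral_eq_lintegral_ofReal]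
      · exact ((hid.comp_fst γ).sub (hid.comp_snd γ)).restrict
      · refine (ae_restrict_iff' hm).2 (Filter.Eventually.of_forall fun p hp => ?_)
        have h1 : t < p.1 := hp.1
        have h2 : p.2 ≤ t := hp.2
        simp only [Pi.zero_apply]; linarith
    simp only [e1]
    rw [hγ, gaussianReal_of_var_ne_zero _ one_ne_zero,
      lintegral_withDensity_eq_lintegral_mul _ (measurable_gaussianPDF _ _) (by fun_prop)]
    rfl
  have hle : ∀ x y, y ≤ x → ENNReal.ofReal ((g x - g y) ^ 2) ≤ H (x, y) := by
    intro x y hxy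
    have e : H (x, y) = ENNReal.ofReal (x - y) *
        ∫⁻ t in Set.Ico y x, ENNReal.ofReal (g' t ^ 2) := by
      rw [← lintegral_indicator measurableSet_Ico, ← lintegral_const_mul _
        (Measurable.indicator (by fun_prop) measurableSet_Ico)]
      refine lintegral_congr fun t => ?_
      by_cases ht : t < x <;> by_cases ht' : y ≤ t <;> simp [Set.indicator, ht, ht']
    rw [e, restrict_Ico_eq_restrict_Ioc, ← ofReal_integral_eq_lintegral_ofReal,
      ← ENNReal.ofReal_mul (sub_nonneg.2 hxy), ← intervalIntegral.integral_of_le hxy]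
    · exact ENNReal.ofReal_le_ofReal (sq_sub_le_mul_intervalIntegral hg hg' hxy)
    · exact ((by fun_prop : Continuous fun t => g' t ^ 2).integrableOn_Icc).mono_set
        Set.Ioc_subset_Icc_self
    · exact Filter.Eventually.of_forall fun t => sq_nonneg _
  have hle' : ∀ x y, ENNReal.ofReal ((g x - g y) ^ 2) ≤ H (x, y) + H (y, x) := by
    intro x y
    rcases le_total y x with h | h
    · exact (hle x y h).trans le_self_add
    · have := hle y x h
      rw [sub_sq_comm] at this
      exact this.trans le_add_self
  calc _ ≤ ∫⁻ x, ∫⁻ y, (H (x, y) + H (y, x)) ∂γ ∂γ :=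
        lintegral_mono fun x => lintegral_mono fun y => hle' x y
    _ = ∫⁻ x, ((∫⁻ y, H (x, y) ∂γ) + ∫⁻ y, H (y, x) ∂γ) ∂γ :=
        lintegral_congr fun x => lintegral_add_left (by fun_prop) _
    _ = (∫⁻ p, H p ∂(γ.prod γ)) + ∫⁻ p, H p ∂(γ.prod γ) := by
        rw [lintegral_add_left hHm.lintegral_prod_right', lintegral_prod _ hHm.aemeasurable,
          lintegral_lintegral_swap (f := fun x y => H (y, x)) (by fun_prop)]
    _ ≤ _ := by
        rw [← two_mul]; gcongr

section EfronStein

variable {X Y Ω : Type*} [MeasurableSpace X] [MeasurableSpace Y] [MeasurableSpace Ω]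

lemma lintegral_lintegral_prod_interchange {μ : Measure X} {ν : Measure Y} [SFinite μ] [SFinite ν]
    {f : X → Y → X → Y → ENNReal}
    (hf : Measurable fun q : X × Y × X × Y => f q.1 q.2.1 q.2.2.1 q.2.2.2) :
    ∫⁻ x, ∫⁻ y, ∫⁻ x', ∫⁻ y', f x y' x' y ∂ν ∂μ ∂ν ∂μ =
      ∫⁻ x, ∫⁻ y, ∫⁻ x', ∫⁻ y', f x y x' y' ∂ν ∂μ ∂ν ∂μ := by
  have hc : ∀ {Z : Type _} [MeasurableSpace Z] {a c : Z → X} {b d : Z → Y}, Measurable a →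
      Measurable b → Measurable c → Measurable d → Measurable fun z => f (a z) (b z) (c z) (d z) :=
    fun ha hb hc hd => hf.comp (ha.prodMk (hb.prodMk (hc.prodMk hd)))
  refine lintegral_congr fun x => ?_
  calc ∫⁻ y, ∫⁻ x', ∫⁻ y', f x y' x' y ∂ν ∂μ ∂ν
      = ∫⁻ x', ∫⁻ y, ∫⁻ y', f x y' x' y ∂ν ∂ν ∂μ :=
        lintegral_lintegral_swap (Measurable.lintegral_prod_right'
          (f := fun q : (Y × X) × Y => f x q.2 q.1.2 q.1.1)
          (hc (by fun_prop) (by fun_prop) (by fun_prop) (by fun_prop))).aemeasurable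
    _ = ∫⁻ x', ∫⁻ y, ∫⁻ y', f x y x' y' ∂ν ∂ν ∂μ :=
        lintegral_congr fun x' => lintegral_lintegral_swap (Measurable.aemeasurable
          (hf.comp (measurable_const.prodMk (measurable_snd.prodMk
            (measurable_const.prodMk measurable_fst)))))
    _ = ∫⁻ y, ∫⁻ x', ∫⁻ y', f x y x' y' ∂ν ∂μ ∂ν :=
        (lintegral_lintegral_swap (Measurable.lintegral_prod_right'
          (f := fun q : (Y × X) × Y => f x q.1.1 q.1.2 q.2)
          (hc (by fun_prop) (by fun_prop) (by fun_prop) (by fun_prop))).aemeasurable).symm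

lemma lintegral_sq_sub_prod_le {μ : Measure X} {ν : Measure Y} [IsProbabilityMeasure μ]
    [IsProbabilityMeasure ν] {F : X → Y → ℝ} (hF : Measurable fun p : X × Y => F p.1 p.2) :
    ∫⁻ x, ∫⁻ y, ∫⁻ x', ∫⁻ y', ENNReal.ofReal ((F x y - F x' y') ^ 2) ∂ν ∂μ ∂ν ∂μ ≤
      (∫⁻ x, ∫⁻ y, ∫⁻ y', ENNReal.ofReal ((F x y - F x y') ^ 2) ∂ν ∂ν ∂μ) +
      ∫⁻ x, ∫⁻ y, ∫⁻ x', ENNReal.ofReal ((F x y - F x' y) ^ 2) ∂μ ∂ν ∂μ := by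
  set I : (X → Y → X → Y → ENNReal) → ENNReal :=
    fun f => ∫⁻ x, ∫⁻ y, ∫⁻ x', ∫⁻ y', f x y x' y' ∂ν ∂μ ∂ν ∂μ with hI
  set Q : ℝ → ENNReal := fun a => ENNReal.ofReal (a ^ 2) with hQ
  have hQm : Measurable Q := by fun_prop
  have hFc : ∀ {Z : Type _} [MeasurableSpace Z] {a c : Z → X} {b d : Z → Y}, Measurable a →
      Measurable b → Measurable c → Measurable d →
      Measurable fun z => Q (F (a z) (b z) - F (c z) (d z)) :=
    fun ha hb hc hd => hQm.comp ((hF.comp (ha.prodMk hb)).sub (hF.comp (hc.prodMk hd)))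
  have hI4 : ∀ f : (X × Y) × (X × Y) → ENNReal, Measurable f →
      I (fun x y x' y' => f ((x, y), (x', y'))) =
        ∫⁻ q, f q ∂((μ.prod ν).prod (μ.prod ν)) := by
    intro f hf
    rw [lintegral_prod _ hf.aemeasurable, lintegral_prod _ hf.lintegral_prod_right'.aemeasurable]
    refine lintegral_congr fun x => lintegral_congr fun y => ?_
    rw [lintegral_prod _ (by fun_prop)]
  have hab : Measurable fun q : (X × Y) × (X × Y) => Q (F q.1.1 q.1.2 - F q.2.1 q.2.2) :=
    hFc (by fun_prop) (by fun_prop) (by fun_prop) (by fun_prop)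
  have hcd : Measurable fun q : (X × Y) × (X × Y) => Q (F q.1.1 q.2.2 - F q.2.1 q.1.2) :=
    hFc (by fun_prop) (by fun_prop) (by fun_prop) (by fun_prop)
  have hac : Measurable fun q : (X × Y) × (X × Y) => Q (F q.1.1 q.1.2 - F q.1.1 q.2.2) :=
    hFc (by fun_prop) (by fun_prop) (by fun_prop) (by fun_prop)
  have had : Measurable fun q : (X × Y) × (X × Y) => Q (F q.1.1 q.1.2 - F q.2.1 q.1.2) :=
    hFc (by fun_prop) (by fun_prop) (by fun_prop) (by fun_prop)
  have hswap : ∀ f : (X × Y) × (X × Y) → ENNReal, Measurable f →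
      ∫⁻ q, f q.swap ∂((μ.prod ν).prod (μ.prod ν)) =
      ∫⁻ q, f q ∂((μ.prod ν).prod (μ.prod ν)) := fun f hf => by
    exact Measure.measurePreserving_swap.lintegral_comp hf
  have e_ab : I (fun x y x' y' => Q (F x y - F x' y')) =
      ∫⁻ q, Q (F q.1.1 q.1.2 - F q.2.1 q.2.2) ∂((μ.prod ν).prod (μ.prod ν)) := hI4 _ hab
  have e_cd : I (fun x y x' y' => Q (F x y - F x' y')) =
      ∫⁻ q, Q (F q.1.1 q.2.2 - F q.2.1 q.1.2) ∂((μ.prod ν).prod (μ.prod ν)) := by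
    rw [← hI4 _ hcd]
    exact (lintegral_lintegral_prod_interchange (f := fun x y x' y' => Q (F x y - F x' y'))
      (hFc (by fun_prop) (by fun_prop) (by fun_prop) (by fun_prop))).symm
  have e_ac : (∫⁻ x, ∫⁻ y, ∫⁻ y', Q (F x y - F x y') ∂ν ∂ν ∂μ) =
      ∫⁻ q, Q (F q.1.1 q.1.2 - F q.1.1 q.2.2) ∂((μ.prod ν).prod (μ.prod ν)) := by
    rw [← hI4 _ hac]
    simp [hI]
  have e_ad : (∫⁻ x, ∫⁻ y, ∫⁻ x', Q (F x y - F x' y) ∂μ ∂ν ∂μ) =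
      ∫⁻ q, Q (F q.1.1 q.1.2 - F q.2.1 q.1.2) ∂((μ.prod ν).prod (μ.prod ν)) := by
    rw [← hI4 _ had]
    simp [hI]
  have e_bd := hswap _ hac
  have e_bc := hswap _ had
  simp only [Prod.fst_swap, Prod.snd_swap] at e_bd e_bc
  change I (fun x y x' y' => Q (F x y - F x' y')) ≤
    (∫⁻ x, ∫⁻ y, ∫⁻ y', Q (F x y - F x y') ∂ν ∂ν ∂μ) +
      ∫⁻ x, ∫⁻ y, ∫⁻ x', Q (F x y - F x' y) ∂μ ∂ν ∂μ
  have h2 : I (fun x y x' y' => Q (F x y - F x' y')) + I (fun x y x' y' => Q (F x y - F x' y')) ≤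
      ((∫⁻ x, ∫⁻ y, ∫⁻ y', Q (F x y - F x y') ∂ν ∂ν ∂μ) +
      ∫⁻ x, ∫⁻ y, ∫⁻ x', Q (F x y - F x' y) ∂μ ∂ν ∂μ) +
      ((∫⁻ x, ∫⁻ y, ∫⁻ y', Q (F x y - F x y') ∂ν ∂ν ∂μ) +
      ∫⁻ x, ∫⁻ y, ∫⁻ x', Q (F x y - F x' y) ∂μ ∂ν ∂μ) := by
    conv_lhs => rw [e_cd]
    conv_lhs => enter [1]; rw [← e_cd, e_ab]
    rw [e_ac, e_ad]
    conv_rhs => enter [2]; rw [← e_bd, ← e_bc]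
    have hacd : Measurable fun q : (X × Y) × (X × Y) =>
        Q (F q.1.1 q.1.2 - F q.1.1 q.2.2) + Q (F q.1.1 q.1.2 - F q.2.1 q.1.2) := hac.add had
    rw [← lintegral_add_left hab, ← lintegral_add_left hac, ← lintegral_add_left,
      ← lintegral_add_left hacd]
    · refine lintegral_mono fun q => ?_
      simp only [hQ]
      rw [← ENNReal.ofReal_add (sq_nonneg _) (sq_nonneg _),
        ← ENNReal.ofReal_add (sq_nonneg _) (sq_nonneg _),
        ← ENNReal.ofReal_add (sq_nonneg _) (sq_nonneg _),
        ← ENNReal.ofReal_add (by positivity) (by positivity)]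
      refine ENNReal.ofReal_le_ofReal ?_
      nlinarith [sq_nonneg (F q.1.1 q.1.2 + F q.2.1 q.2.2 - F q.1.1 q.2.2 - F q.2.1 q.1.2)]
    · exact hFc (by fun_prop) (by fun_prop) (by fun_prop) (by fun_prop)
  rw [← two_mul, ← two_mul] at h2
  exact (ENNReal.mul_le_mul_iff_right two_ne_zero ENNReal.ofNat_ne_top).1 h2

/-- The Efron–Stein inequality. -/
theorem lintegral_sq_sub_pi_le {ν : Measure Ω} [IsProbabilityMeasure ν] {n : ℕ}
    {F : (Fin n → Ω) → ℝ} (hF : Measurable F) :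
    ∫⁻ x, ∫⁻ y, ENNReal.ofReal ((F x - F y) ^ 2)
        ∂(Measure.pi fun _ => ν) ∂(Measure.pi fun _ => ν) ≤
      ∑ i, ∫⁻ x, ∫⁻ t, ENNReal.ofReal ((F x - F (Function.update x i t)) ^ 2)
        ∂ν ∂(Measure.pi fun _ => ν) := by
  induction n with
  | zero =>
    have : ∀ x y : Fin 0 → Ω, x = y := fun x y => Subsingleton.elim x y
    simp only [Finset.univ_eq_empty, Finset.sum_empty, nonpos_iff_eq_zero]
    have h : ∀ x y : Fin 0 → Ω, ENNReal.ofReal ((F x - F y) ^ 2) = 0 := fun x y => by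
      rw [this x y]; simp
    simp [h]
  | succ n ih =>
    have hmp := (measurePreserving_piFinSuccAbove (fun _ : Fin (n + 1) => ν) 0).symm
    have hcons : ∀ f : (Fin (n + 1) → Ω) → ENNReal, Measurable f →
        ∫⁻ x, f x ∂(Measure.pi fun _ => ν) =
          ∫⁻ a, ∫⁻ v, f (Fin.cons a v) ∂(Measure.pi fun _ => ν) ∂ν := by
      intro f hf
      rw [← hmp.lintegral_comp hf, lintegral_prod
        (fun p => f ((MeasurableEquiv.piFinSuccAbove (fun _ => Ω) 0).symm p))
        (hf.comp (MeasurableEquiv.measurable _)).aemeasurable]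
      simp [MeasurableEquiv.piFinSuccAbove, Fin.insertNthEquiv]
    have hcm : Measurable fun p : Ω × (Fin n → Ω) => (Fin.cons p.1 p.2 : Fin (n + 1) → Ω) := by
      refine measurable_pi_iff.2 fun i => ?_
      refine Fin.cases ?_ (fun i => ?_) i
      · simpa using measurable_fst
      · simp only [Fin.cons_succ]; fun_prop
    set G : Ω → (Fin n → Ω) → ℝ := fun a v => F (Fin.cons a v) with hG
    have hGm : Measurable fun p : Ω × (Fin n → Ω) => G p.1 p.2 := hF.comp hcm
    have hGv : ∀ a, Measurable (G a) := fun a => hGm.comp measurable_prodMk_left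
    have hupd : ∀ i : Fin (n + 1), Measurable fun q : (Fin (n + 1) → Ω) × Ω =>
        Function.update q.1 i q.2 := by
      intro i
      refine measurable_pi_iff.2 fun j => ?_
      by_cases h : j = i
      · subst h; simpa using measurable_snd
      · simp only [Function.update_of_ne h]; fun_prop
    have hL : ∫⁻ x, ∫⁻ y, ENNReal.ofReal ((F x - F y) ^ 2)
        ∂(Measure.pi fun _ => ν) ∂(Measure.pi fun _ => ν) =
        ∫⁻ a, ∫⁻ v, ∫⁻ a', ∫⁻ v', ENNReal.ofReal ((G a v - G a' v') ^ 2)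
          ∂(Measure.pi fun _ => ν) ∂ν ∂(Measure.pi fun _ => ν) ∂ν := by
      rw [hcons _ (Measurable.lintegral_prod_right'
        (f := fun q : (Fin (n + 1) → Ω) × (Fin (n + 1) → Ω) =>
          ENNReal.ofReal ((F q.1 - F q.2) ^ 2)) (by fun_prop))]
      refine lintegral_congr fun a => lintegral_congr fun v => ?_
      rw [hcons _ (by fun_prop)]
    have hR : ∀ i : Fin (n + 1), ∫⁻ x, ∫⁻ t, ENNReal.ofReal ((F x - F (Function.update x i t)) ^ 2)
        ∂ν ∂(Measure.pi fun _ => ν) = ∫⁻ a, ∫⁻ v, ∫⁻ t,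
          ENNReal.ofReal ((G a v - F (Function.update (Fin.cons a v : Fin (n + 1) → Ω) i t)) ^ 2)
          ∂ν ∂(Measure.pi fun _ => ν) ∂ν := by
      intro i
      have := hupd i
      rw [hcons _ (Measurable.lintegral_prod_right'
        (f := fun q : (Fin (n + 1) → Ω) × Ω =>
          ENNReal.ofReal ((F q.1 - F (Function.update q.1 i q.2)) ^ 2)) (by fun_prop))]
    rw [hL, Fin.sum_univ_succ]
    simp only [hR, Fin.update_cons_zero, ← Fin.cons_update]
    refine (lintegral_sq_sub_prod_le hGm).trans ?_
    rw [add_comm]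
    refine add_le_add le_rfl ?_
    rw [← lintegral_finsetSum]
    · exact lintegral_mono fun a => ih (hGv a)
    · intro i _
      have hu : Measurable fun q : (Ω × (Fin n → Ω)) × Ω => Function.update q.1.2 i q.2 := by
        refine measurable_pi_iff.2 fun j => ?_
        by_cases h : j = i
        · subst h; simpa using measurable_snd
        · simp only [Function.update_of_ne h]; fun_prop
      have h1 : Measurable fun q : (Ω × (Fin n → Ω)) × Ω =>
          ENNReal.ofReal ((G q.1.1 q.1.2 - G q.1.1 (Function.update q.1.2 i q.2)) ^ 2) := by
        have h2 : Measurable fun q : (Ω × (Fin n → Ω)) × Ω => G q.1.1 q.1.2 :=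
          hGm.comp measurable_fst
        have h3 : Measurable fun q : (Ω × (Fin n → Ω)) × Ω =>
            G q.1.1 (Function.update q.1.2 i q.2) := hGm.comp (measurable_fst.fst.prodMk hu)
        fun_prop
      exact h1.lintegral_prod_right'.lintegral_prod_right'

end EfronStein

section GaussianPoincare

open ProbabilityTheory

lemma measurePreserving_update_pi {Ω ι : Type*} [Fintype ι] [DecidableEq ι] [MeasurableSpace Ω]
    (ν : Measure Ω) [IsProbabilityMeasure ν] (i : ι) :
    MeasurePreserving (fun q : (ι → Ω) × Ω => Function.update q.1 i q.2)
      ((Measure.pi fun _ => ν).prod ν) (Measure.pi fun _ => ν) := by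
  have hm : Measurable fun q : (ι → Ω) × Ω => Function.update q.1 i q.2 := by
    refine measurable_pi_iff.2 fun j => ?_
    by_cases h : j = i
    · subst h; simpa using measurable_snd
    · simp only [Function.update_of_ne h]; fun_prop
  refine ⟨hm, (Measure.pi_eq fun s hs => ?_).symm⟩
  rw [Measure.map_apply hm (MeasurableSet.univ_pi hs)]
  have h1 : (fun q : (ι → Ω) × Ω => Function.update q.1 i q.2) ⁻¹' (Set.univ.pi s) =
      (Set.univ.pi (Function.update s i Set.univ)) ×ˢ s i := by
    ext ⟨x, t⟩
    simp only [Set.mem_preimage, Set.mem_univ_pi, Set.mem_prod]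
    constructor
    · intro h
      refine ⟨fun j => ?_, by simpa using h i⟩
      by_cases hj : j = i
      · subst hj; simp
      · simpa [hj] using h j
    · rintro ⟨h, ht⟩ j
      by_cases hj : j = i
      · subst hj; simpa using ht
      · simpa [hj] using h j
  rw [h1, Measure.prod_prod, Measure.pi_pi, ← Finset.mul_prod_erase _ _ (Finset.mem_univ i),
    ← Finset.mul_prod_erase (Finset.univ : Finset ι) (fun j => ν (s j)) (Finset.mem_univ i)]
  simp only [Function.update_self, measure_univ, one_mul]
  rw [mul_comm]
  congr 1
  refine Finset.prod_congr rfl fun j hj => ?_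
  rw [Function.update_of_ne (Finset.ne_of_mem_erase hj)]

/-- The Gaussian Poincaré inequality, for functions which are `C¹` along almost every line parallel
to a coordinate axis. -/
theorem lintegral_sq_sub_pi_gaussianReal_le {n : ℕ} {F : (Fin n → ℝ) → ℝ}
    {F' : Fin n → (Fin n → ℝ) → ℝ} (hF : Measurable F) (hF' : ∀ i, Measurable (F' i))
    (hd : ∀ i, ∀ᵐ x ∂(Measure.pi fun _ : Fin n => gaussianReal 0 1),
      (∀ s, HasDerivAt (fun s => F (Function.update x i s)) (F' i (Function.update x i s)) s) ∧
        Continuous fun s => F' i (Function.update x i s)) :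
    ∫⁻ x, ∫⁻ y, ENNReal.ofReal ((F x - F y) ^ 2)
        ∂(Measure.pi fun _ => gaussianReal 0 1) ∂(Measure.pi fun _ => gaussianReal 0 1) ≤
      2 * ∑ i, ∫⁻ x, ENNReal.ofReal (F' i x ^ 2) ∂(Measure.pi fun _ => gaussianReal 0 1) := by
  refine (lintegral_sq_sub_pi_le hF).trans ?_
  rw [Finset.mul_sum]
  refine Finset.sum_le_sum fun i _ => ?_
  have hmp := measurePreserving_update_pi (gaussianReal 0 1) i
  have hum := hmp.measurable
  have hm1 : Measurable fun q : (Fin n → ℝ) × ℝ =>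
      ENNReal.ofReal ((F q.1 - F (Function.update q.1 i q.2)) ^ 2) := by fun_prop
  have hm2 : Measurable fun x => ENNReal.ofReal (F' i x ^ 2) := by
    have := hF' i; fun_prop
  have hpull : ∀ h : (Fin n → ℝ) → ENNReal, Measurable h →
      ∫⁻ x, h x ∂(Measure.pi fun _ => gaussianReal 0 1) =
        ∫⁻ x, ∫⁻ s, h (Function.update x i s) ∂(gaussianReal 0 1)
          ∂(Measure.pi fun _ => gaussianReal 0 1) := fun h hh => by
    rw [← hmp.lintegral_comp hh, lintegral_prod (fun q => h (Function.update q.1 i q.2))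
      (hh.comp hum).aemeasurable]
  have hm3 : Measurable fun x : Fin n → ℝ =>
      ∫⁻ s, ENNReal.ofReal (F' i (Function.update x i s) ^ 2) ∂(gaussianReal 0 1) :=
    (hm2.comp hum).lintegral_prod_right'
  rw [hpull _ hm1.lintegral_prod_right', hpull _ hm2, ← lintegral_const_mul _ hm3]
  refine lintegral_mono_ae ?_
  filter_upwards [hd i] with x hx
  simpa only [Function.update_idem] using lintegral_sq_sub_gaussianReal_le hx.1 hx.2

end GaussianPoincare

section RadialAverage

variable {E : Type*} [NormedAddCommGroup E] [InnerProductSpace ℝ E] [FiniteDimensional ℝ E]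
  [MeasurableSpace E] [BorelSpace E]

/-- Integration in polar coordinates against a rotation invariant measure. -/
theorem integral_norm_pow_mul_normalize {γ μ : Measure E} [IsFiniteMeasure μ]
    (hμ : ∀ e : E ≃ₗᵢ[ℝ] E, μ.map e = μ) (hμS : ∀ᵐ x ∂μ, ‖x‖ = 1)
    (hγ : ∀ e : E ≃ₗᵢ[ℝ] E, γ.map e = γ) (hγ0 : ∀ᵐ x ∂γ, x ≠ 0) {k : ℕ}
    (hk : Integrable (fun x : E => ‖x‖ ^ k) γ) {g : E → ℝ} (hg : Continuous g) :
    μ.real Set.univ * ∫ x, ‖x‖ ^ k * g (‖x‖⁻¹ • x) ∂γ = (∫ x, ‖x‖ ^ k ∂γ) * ∫ x, g x ∂μ := by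
  set w : E → NNReal := fun x => ‖x‖₊ ^ k with hw
  have hwm : Measurable w := by fun_prop
  have hpm : Measurable fun x : E => ‖x‖⁻¹ • x := by fun_prop
  set κ : Measure E := γ.withDensity (fun x => (w x : ENNReal)) with hκ
  set ν : Measure E := κ.map (fun x => ‖x‖⁻¹ • x) with hν
  have hgint : ∀ h : E → ℝ, ∫ x, h x ∂κ = ∫ x, ‖x‖ ^ k * h x ∂γ := fun h => by
    rw [hκ, integral_withDensity_eq_integral_smul hwm]
    simp [hw, NNReal.smul_def]
  have hfin : IsFiniteMeasure κ := by
    refine isFiniteMeasure_withDensity ?_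
    have := hk.lintegral_lt_top
    refine ne_of_lt ?_
    convert! this using 3 with x
    simp only [hw]
    rw [ENNReal.ofReal_pow (norm_nonneg _), ofReal_norm]
    simp [enorm]
  have hν1 : IsFiniteMeasure ν := inferInstance
  have hκ0 : ∀ᵐ x ∂κ, x ≠ 0 := (withDensity_absolutelyContinuous γ _).ae_le hγ0
  have hκe : ∀ e : E ≃ₗᵢ[ℝ] E, κ.map e = κ := fun e => by
    ext s hs
    have hem := e.continuous.measurable
    rw [Measure.map_apply hem hs, hκ, withDensity_apply _ (hem hs), withDensity_apply _ hs]
    conv_rhs => rw [← hγ e]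
    rw [setLIntegral_map hs (by fun_prop) hem]
    simp [hw]
  have hνS : ∀ᵐ x ∂ν, ‖x‖ = 1 := by
    rw [hν, ae_map_iff hpm.aemeasurable (measurableSet_eq_fun (by fun_prop) (by fun_prop))]
    filter_upwards [hκ0] with x hx
    rw [norm_smul, norm_inv, norm_norm, inv_mul_cancel₀ (norm_ne_zero_iff.2 hx)]
  have hνe : ∀ e : E ≃ₗᵢ[ℝ] E, ν.map e = ν := fun e => by
    have hem := e.continuous.measurable
    rw [hν, Measure.map_map hem hpm]
    conv_rhs => rw [← hκe e]
    rw [Measure.map_map hpm hem]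
    congr 1
    ext x
    simp
  have key := integral_mul_eq_of_invariant hμ hνe hμS hνS hg
  have h1 : ν.real Set.univ = ∫ x, ‖x‖ ^ k ∂γ := by
    have : ν.real Set.univ = ∫ x, (1 : ℝ) ∂ν := by simp
    rw [this, hν, integral_map hpm.aemeasurable (by fun_prop), hgint]
    simp
  have h2 : ∫ x, g x ∂ν = ∫ x, ‖x‖ ^ k * g (‖x‖⁻¹ • x) ∂γ := by
    rw [hν, integral_map hpm.aemeasurable hg.aestronglyMeasurable, hgint]
  rw [h1, h2] at key
  exact key.symm

end RadialAverage

section HomogeneousExtension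

variable {E : Type*} [NormedAddCommGroup E] [InnerProductSpace ℝ E]

open scoped InnerProductSpace

lemma hasFDerivAt_norm_of_ne_zero {x : E} (hx : x ≠ 0) :
    HasFDerivAt (fun y : E => ‖y‖) (‖x‖⁻¹ • innerSL ℝ x) x := by
  have hx' : ‖x‖ ≠ 0 := norm_ne_zero_iff.2 hx
  have h := (hasStrictFDerivAt_norm_sq x).hasFDerivAt.sqrt (pow_ne_zero 2 hx')
  simp only [Real.sqrt_sq (norm_nonneg _)] at h
  refine h.congr_fderiv ?_
  ext v
  simp
  field_simp

variable [CompleteSpace E]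

/-- The gradient at a point `θ` of the unit sphere of the `1`-homogeneous extension of the
restriction of `φ` to the sphere. -/
noncomputable def homogeneousGradient (φ : E → ℝ) (θ : E) : E :=
  φ θ • θ + (gradient φ θ - ⟪gradient φ θ, θ⟫_ℝ • θ)

lemma hasFDerivAt_norm_mul_normalize {φ : E → ℝ} (hφ : Differentiable ℝ φ) {x : E} (hx : x ≠ 0) :
    HasFDerivAt (fun y : E => ‖y‖ * φ (‖y‖⁻¹ • y))
      (innerSL ℝ (homogeneousGradient φ (‖x‖⁻¹ • x))) x := by
  have hx' : ‖x‖ ≠ 0 := norm_ne_zero_iff.2 hx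
  have hn := hasFDerivAt_norm_of_ne_zero hx
  have hi := (hasDerivAt_inv hx').comp_hasFDerivAt x hn
  have hs := hi.smul (hasFDerivAt_id x)
  have hg : HasFDerivAt φ (innerSL ℝ (gradient φ (‖x‖⁻¹ • x))) (‖x‖⁻¹ • x) :=
    (hφ (‖x‖⁻¹ • x)).hasGradientAt.hasFDerivAt
  have hc := hg.comp x (f := fun y : E => ‖y‖⁻¹ • y) hs
  refine (hn.mul hc).congr_fderiv ?_
  ext v
  simp [homogeneousGradient, inner_smul_right]
  field_simp
  ring

lemma norm_homogeneousGradient_sq (φ : E → ℝ) {θ : E} (hθ : ‖θ‖ = 1) :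
    ‖homogeneousGradient φ θ‖ ^ 2 =
      φ θ ^ 2 + (‖gradient φ θ‖ ^ 2 - ⟪gradient φ θ, θ⟫_ℝ ^ 2) := by
  have h1 : ⟪θ, θ⟫_ℝ = 1 := by rw [real_inner_self_eq_norm_sq, hθ, one_pow]
  rw [← real_inner_self_eq_norm_sq, ← real_inner_self_eq_norm_sq, homogeneousGradient]
  simp only [inner_add_left, inner_sub_left, inner_smul_left, inner_add_right, inner_sub_right,
    inner_smul_right, h1, real_inner_comm θ (gradient φ θ), RCLike.conj_to_real]
  ring

lemma ContDiff.continuous_gradient {φ : E → ℝ} (hφ : ContDiff ℝ 1 φ) :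
    Continuous (gradient φ) :=
  (InnerProductSpace.toDual ℝ E).symm.continuous.comp (hφ.continuous_fderiv one_ne_zero)

lemma ContDiff.continuous_homogeneousGradient {φ : E → ℝ} (hφ : ContDiff ℝ 1 φ) :
    Continuous (homogeneousGradient φ) := by
  have h1 := hφ.continuous_gradient
  have h2 := hφ.continuous
  unfold homogeneousGradient
  fun_prop

end HomogeneousExtension

section Gaussian
open ProbabilityTheory

lemma integral_norm_sq_stdGaussian (n : ℕ) :
    Integrable (fun x => ‖x‖ ^ 2) (stdGaussian (EuclideanSpace ℝ (Fin n))) ∧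
    ∫ x, ‖x‖ ^ 2 ∂(stdGaussian (EuclideanSpace ℝ (Fin n))) = n := by
  rw [← map_pi_eq_stdGaussian]
  have hm : AEMeasurable (WithLp.toLp 2 : (Fin n → ℝ) → EuclideanSpace ℝ (Fin n))
    (Measure.pi fun _ => gaussianReal 0 1) := by fun_prop
  have hi1 : Integrable (fun t : ℝ => t ^ 2) (gaussianReal 0 1) := 
    (memLp_id_gaussianReal 2).integrable_sq
  have hi : ∀ i : Fin n, Integrable (fun x : Fin n → ℝ => x i ^ 2)
      (Measure.pi fun _ => gaussianReal 0 1) := fun i =>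
    integrable_comp_eval (μ := fun _ : Fin n => gaussianReal 0 1) (f := fun t => t ^ 2) hi1
  rw [integrable_map_measure (by fun_prop) hm, integral_map hm (by fun_prop)]
  simp only [Function.comp_def, EuclideanSpace.norm_sq_eq, Real.norm_eq_abs, sq_abs]
  refine ⟨integrable_finsetSum _ fun i _ => hi i, ?_⟩
  rw [integral_finsetSum _ fun i _ => hi i]
  have h1 : ∫ t : ℝ, t ^ 2 ∂(gaussianReal 0 1) = 1 := by
    have := variance_id_gaussianReal (μ := 0) (v := 1)
    rw [variance_eq_integral (by fun_prop)] at this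
    simpa using this
  have h2 : ∀ i : Fin n, ∫ x : Fin n → ℝ, x i ^ 2 ∂(Measure.pi fun _ => gaussianReal 0 1) = 1 :=
    fun i => by
      rw [integral_comp_eval (μ := fun _ : Fin n => gaussianReal 0 1) (f := fun t => t ^ 2)
        (by fun_prop), h1]
  simp [h2]

end Gaussian

section SpherePoincare

open ProbabilityTheory
open scoped InnerProductSpace

variable {n : ℕ}

/-- The Gaussian Poincaré inequality for `1`-homogeneous functions. -/
lemma lintegral_sq_sub_norm_mul_normalize_le (hn : 2 ≤ n) {φ : EuclideanSpace ℝ (Fin n) → ℝ}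
    (hφ : ContDiff ℝ 1 φ) :
    ∫⁻ x, ∫⁻ y, ENNReal.ofReal ((‖x‖ * φ (‖x‖⁻¹ • x) - ‖y‖ * φ (‖y‖⁻¹ • y)) ^ 2)
        ∂(stdGaussian (EuclideanSpace ℝ (Fin n))) ∂(stdGaussian (EuclideanSpace ℝ (Fin n))) ≤
      2 * ∫⁻ x, ENNReal.ofReal (‖homogeneousGradient φ (‖x‖⁻¹ • x)‖ ^ 2)
        ∂(stdGaussian (EuclideanSpace ℝ (Fin n))) := by
  have hVc : Continuous (homogeneousGradient φ) := hφ.continuous_homogeneousGradient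
  have hφc := hφ.continuous
  have hto : Measurable (WithLp.toLp 2 : (Fin n → ℝ) → EuclideanSpace ℝ (Fin n)) := by fun_prop
  have hFm : Measurable fun y : EuclideanSpace ℝ (Fin n) => ‖y‖ * φ (‖y‖⁻¹ • y) :=
    measurable_norm.mul (hφc.measurable.comp (by fun_prop))
  have hVm : Measurable fun y : EuclideanSpace ℝ (Fin n) =>
      homogeneousGradient φ (‖y‖⁻¹ • y) := hVc.measurable.comp (by fun_prop)
  have hne : ∀ i : Fin n, ∀ᵐ x ∂(Measure.pi fun _ : Fin n => gaussianReal 0 1), ∀ s,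
      (WithLp.toLp 2 (Function.update x i s) : EuclideanSpace ℝ (Fin n)) ≠ 0 := by
    intro i
    obtain ⟨j, hj⟩ : ∃ j : Fin n, j ≠ i := by
      have : Nontrivial (Fin n) := Fin.nontrivial_iff_two_le.2 hn
      exact exists_ne i
    have := nullSingletonClass_gaussianReal (μ := 0) (v := 1) one_ne_zero
    filter_upwards [Measure.ae_eval_ne (fun _ : Fin n => gaussianReal 0 1) j 0] with x hx s h
    apply hx
    have := congrArg (fun y : EuclideanSpace ℝ (Fin n) => y j) h
    simpa [hj] using this
  have hES := lintegral_sq_sub_pi_gaussianReal_le (n := n)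
    (F := fun x => ‖(WithLp.toLp 2 x : EuclideanSpace ℝ (Fin n))‖ *
      φ (‖(WithLp.toLp 2 x : EuclideanSpace ℝ (Fin n))‖⁻¹ • WithLp.toLp 2 x))
    (F' := fun i x => homogeneousGradient φ
      (‖(WithLp.toLp 2 x : EuclideanSpace ℝ (Fin n))‖⁻¹ • WithLp.toLp 2 x) i)
    (hFm.comp hto) (fun i => (EuclideanSpace.proj i).continuous.measurable.comp (hVm.comp hto))
    (fun i => by
      filter_upwards [hne i] with x hx
      have hd : ∀ s, HasDerivAt
          (fun s => (WithLp.toLp 2 (Function.update x i s) : EuclideanSpace ℝ (Fin n)))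
          (EuclideanSpace.single i 1) s := fun s =>
        (PiLp.hasFDerivAt_toLp 2 _).comp_hasDerivAt s (hasDerivAt_update x i s)
      refine ⟨fun s => ?_, ?_⟩
      · refine ((hasFDerivAt_norm_mul_normalize (hφ.differentiable one_ne_zero)
          (hx s)).comp_hasDerivAt s (hd s)).congr_deriv ?_
        simp [EuclideanSpace.inner_single_right]
      · have hc : Continuous fun s =>
            (WithLp.toLp 2 (Function.update x i s) : EuclideanSpace ℝ (Fin n)) :=
          continuous_iff_continuousAt.2 fun s => (hd s).continuousAt
        exact (EuclideanSpace.proj i).continuous.comp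
          (hVc.comp ((hc.norm.inv₀ fun s => norm_ne_zero_iff.2 (hx s)).smul hc)))
  rw [← lintegral_finsetSum _ fun i _ => by
    exact ((EuclideanSpace.proj i).continuous.measurable.comp (hVm.comp hto)).pow_const 2
      |>.ennreal_ofReal] at hES
  rw [← map_pi_eq_stdGaussian]
  have hm2 : Measurable fun q : EuclideanSpace ℝ (Fin n) × EuclideanSpace ℝ (Fin n) =>
      ENNReal.ofReal ((‖q.1‖ * φ (‖q.1‖⁻¹ • q.1) - ‖q.2‖ * φ (‖q.2‖⁻¹ • q.2)) ^ 2) :=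
    (((hFm.comp measurable_fst).sub (hFm.comp measurable_snd)).pow_const 2).ennreal_ofReal
  have : IsProbabilityMeasure ((Measure.pi fun _ : Fin n => gaussianReal 0 1).map
      (WithLp.toLp 2 : (Fin n → ℝ) → EuclideanSpace ℝ (Fin n))) :=
    Measure.isProbabilityMeasure_map hto.aemeasurable
  rw [lintegral_map hm2.lintegral_prod_right' hto,
    lintegral_map (hVm.norm.pow_const 2).ennreal_ofReal hto]
  convert hES using 2
  · ext x
    exact lintegral_map (hm2.comp measurable_prodMk_left) hto
  · congr 1
    ext x
    rw [EuclideanSpace.norm_sq_eq, ENNReal.ofReal_sum_of_nonneg fun i _ => sq_nonneg _]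
    simp [sq_abs]

theorem sphere_poincare (hn : 2 ≤ n) {μ : Measure (EuclideanSpace ℝ (Fin n))} [IsFiniteMeasure μ]
    (hμ : ∀ e : EuclideanSpace ℝ (Fin n) ≃ₗᵢ[ℝ] EuclideanSpace ℝ (Fin n), μ.map e = μ)
    (hμS : ∀ᵐ x ∂μ, ‖x‖ = 1) {φ : EuclideanSpace ℝ (Fin n) → ℝ} (hφ : ContDiff ℝ 1 φ)
    (h0 : ∫ x, φ x ∂μ = 0) :
    (n - 1) * ∫ x, φ x ^ 2 ∂μ ≤ ∫ x, (‖gradient φ x‖ ^ 2 - ⟪gradient φ x, x⟫_ℝ ^ 2) ∂μ := by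
  rcases eq_or_ne μ 0 with rfl | hμ0
  · simp
  have hpos : 0 < μ.real Set.univ := by
    rw [measureReal_def]
    exact ENNReal.toReal_pos (by simpa using hμ0) (measure_ne_top _ _)
  set γ : Measure (EuclideanSpace ℝ (Fin n)) := stdGaussian (EuclideanSpace ℝ (Fin n)) with hγ
  have hVc : Continuous (homogeneousGradient φ) := hφ.continuous_homogeneousGradient
  have hφc := hφ.continuous
  set F : EuclideanSpace ℝ (Fin n) → ℝ := fun y => ‖y‖ * φ (‖y‖⁻¹ • y) with hF
  have hFm : Measurable F := measurable_norm.mul (hφc.measurable.comp (by fun_prop))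
  have hVm : Measurable fun y : EuclideanSpace ℝ (Fin n) =>
      homogeneousGradient φ (‖y‖⁻¹ • y) := hVc.measurable.comp (by fun_prop)
  have hγe : ∀ e : EuclideanSpace ℝ (Fin n) ≃ₗᵢ[ℝ] EuclideanSpace ℝ (Fin n), γ.map e = γ :=
    fun e => stdGaussian_map e
  have hγ0 : ∀ᵐ x ∂γ, x ≠ 0 := by
    have hto : Measurable (WithLp.toLp 2 : (Fin n → ℝ) → EuclideanSpace ℝ (Fin n)) := by fun_prop
    have hms : MeasurableSet {x : EuclideanSpace ℝ (Fin n) | x ≠ 0} :=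
      (measurableSet_singleton _).compl
    rw [hγ, ← map_pi_eq_stdGaussian, ae_map_iff hto.aemeasurable hms]
    have := nullSingletonClass_gaussianReal (μ := 0) (v := 1) one_ne_zero
    filter_upwards [Measure.ae_eval_ne (fun _ : Fin n => gaussianReal 0 1) ⟨0, by omega⟩ 0]
      with x hx h
    exact hx (by simpa using congrArg (fun y : EuclideanSpace ℝ (Fin n) => y ⟨0, by omega⟩) h)
  obtain ⟨hi2, he2⟩ := integral_norm_sq_stdGaussian n
  have hL2 : MemLp (fun x => ‖x‖) 2 γ :=
    (memLp_two_iff_integrable_sq (by fun_prop)).2 hi2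
  have hi1 : Integrable (fun x => ‖x‖ ^ 1) γ := by simpa using hL2.integrable one_le_two
  have hi0 : Integrable (fun x => ‖x‖ ^ 0) γ := by simp
  have hcpt := isCompact_closedBall (0 : EuclideanSpace ℝ (Fin n)) 1
  obtain ⟨C, hC⟩ := hcpt.exists_bound_of_continuousOn hφc.continuousOn
  obtain ⟨D, hD⟩ := hcpt.exists_bound_of_continuousOn hVc.continuousOn
  have hball : ∀ x : EuclideanSpace ℝ (Fin n),
      ‖x‖⁻¹ • x ∈ Metric.closedBall (0 : EuclideanSpace ℝ (Fin n)) 1 := fun x => by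
    rw [mem_closedBall_zero_iff, norm_smul, norm_inv, norm_norm]
    exact inv_mul_le_one
  have hFL2 : MemLp F 2 γ := by
    refine MemLp.of_le_mul (c := C) hL2 hFm.aestronglyMeasurable (ae_of_all _ fun x => ?_)
    rw [hF, norm_mul, mul_comm]
    exact mul_le_mul_of_nonneg_right (hC _ (hball x)) (norm_nonneg _)
  have hVi : Integrable (fun x => ‖homogeneousGradient φ (‖x‖⁻¹ • x)‖ ^ 2) γ := by
    refine Integrable.of_bound (hVm.norm.pow_const 2).aestronglyMeasurable (D ^ 2)
      (ae_of_all _ fun x => ?_)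
    rw [norm_pow, norm_norm]
    exact pow_le_pow_left₀ (norm_nonneg _) (hD _ (hball x)) 2
  have hES := lintegral_sq_sub_norm_mul_normalize_le hn hφ
  have hprod : Integrable (fun q : EuclideanSpace ℝ (Fin n) × EuclideanSpace ℝ (Fin n) =>
      (F q.1 - F q.2) ^ 2) (γ.prod γ) :=
    ((hFL2.comp_fst γ).sub (hFL2.comp_snd γ)).integrable_sq
  have hlhs : ∫⁻ x, ∫⁻ y, ENNReal.ofReal ((F x - F y) ^ 2) ∂γ ∂γ =
      ENNReal.ofReal (∫ q, (F q.1 - F q.2) ^ 2 ∂(γ.prod γ)) := by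
    rw [ofReal_integral_eq_lintegral_ofReal hprod (ae_of_all _ fun _ => sq_nonneg _),
      lintegral_prod]
    exact ((hFm.comp measurable_fst).sub (hFm.comp measurable_snd)).pow_const 2
      |>.ennreal_ofReal.aemeasurable
  have h2 : ∫ q, (F q.1 - F q.2) ^ 2 ∂(γ.prod γ) ≤
      2 * ∫ x, ‖homogeneousGradient φ (‖x‖⁻¹ • x)‖ ^ 2 ∂γ := by
    rw [← ENNReal.ofReal_le_ofReal_iff (by positivity), ← hlhs,
      ENNReal.ofReal_mul zero_le_two, ENNReal.ofReal_ofNat,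
      ofReal_integral_eq_lintegral_ofReal hVi (ae_of_all _ fun _ => sq_nonneg _)]
    exact hES
  have e1 := integral_norm_pow_mul_normalize hμ hμS hγe hγ0 hi1 hφc
  have e2 := integral_norm_pow_mul_normalize hμ hμS hγe hγ0 hi2 (hφc.pow 2)
  have e0 := integral_norm_pow_mul_normalize hμ hμS hγe hγ0 hi0 (hVc.norm.pow 2)
  simp only [pow_one, pow_zero, one_mul, integral_const, probReal_univ, smul_eq_mul] at e1 e2 e0
  rw [h0, mul_zero] at e1
  have hF0 : ∫ x, F x ∂γ = 0 := by
    simpa [hpos.ne'] using e1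
  have hF2 : ∫ q, (F q.1 - F q.2) ^ 2 ∂(γ.prod γ) = 2 * ∫ x, F x ^ 2 ∂γ := by
    have hFi := hFL2.integrable one_le_two
    have hFs := hFL2.integrable_sq
    have hadd : Integrable (fun q : EuclideanSpace ℝ (Fin n) × EuclideanSpace ℝ (Fin n) =>
        F q.1 ^ 2 + F q.2 ^ 2) (γ.prod γ) := (hFs.comp_fst γ).add (hFs.comp_snd γ)
    have : ∀ q : EuclideanSpace ℝ (Fin n) × EuclideanSpace ℝ (Fin n),
        (F q.1 - F q.2) ^ 2 = (F q.1 ^ 2 + F q.2 ^ 2) - 2 * (F q.1 * F q.2) := fun q => by ring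
    simp_rw [this]
    rw [integral_sub hadd ((hFi.mul_prod hFi).const_mul 2),
      integral_add (hFs.comp_fst γ) (hFs.comp_snd γ), integral_const_mul, integral_prod_mul, hF0,
      integral_fun_fst (fun x => F x ^ 2), integral_fun_snd (fun x => F x ^ 2)]
    simp
    ring
  rw [hF2] at h2
  have e2' : μ.real Set.univ * ∫ x, F x ^ 2 ∂γ = n * ∫ x, φ x ^ 2 ∂μ := by
    rw [he2] at e2
    simp only [hF, mul_pow]
    exact e2
  have e3 : ∫ x, ‖homogeneousGradient φ x‖ ^ 2 ∂μ = ∫ x, φ x ^ 2 ∂μ +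
      ∫ x, (‖gradient φ x‖ ^ 2 - ⟪gradient φ x, x⟫_ℝ ^ 2) ∂μ := by
    have hgc := hφ.continuous_gradient
    rw [← integral_add (integrable_of_continuous_of_sphere hμS (by fun_prop))
      (integrable_of_continuous_of_sphere hμS (by fun_prop))]
    refine integral_congr_ae ?_
    filter_upwards [hμS] with x hx using norm_homogeneousGradient_sq φ hx
  have h3 := mul_le_mul_of_nonneg_left h2 hpos.le
  have e0' : μ.real Set.univ * ∫ x, ‖homogeneousGradient φ (‖x‖⁻¹ • x)‖ ^ 2 ∂γ =
      ∫ x, ‖homogeneousGradient φ x‖ ^ 2 ∂μ := e0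
  linarith

end SpherePoincare

section SphereIntegral

open scoped InnerProductSpace

variable {E : Type*} [NormedAddCommGroup E] [InnerProductSpace ℝ E] [FiniteDimensional ℝ E]
  [MeasurableSpace E] [BorelSpace E] {μ : Measure E} [IsFiniteMeasure μ]

lemma continuous_integral_of_sphere (hS : ∀ᵐ x ∂μ, ‖x‖ = 1) {k : ℝ → E → ℝ}
    (hk : Continuous (Function.uncurry k)) : Continuous fun r => ∫ x, k r x ∂μ := by
  have h1 : μ.restrict (Metric.sphere (0 : E) 1) = μ :=
    Measure.restrict_eq_self_of_ae_mem (by simpa using hS)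
  rw [← h1]
  exact continuous_parametric_integral_of_continuous hk (isCompact_sphere 0 1)

lemma hasDerivAt_integral_smul_of_sphere (hS : ∀ᵐ x ∂μ, ‖x‖ = 1) {h : E → ℝ}
    (hh : ContDiff ℝ 1 h) (r : ℝ) :
    HasDerivAt (fun r : ℝ => ∫ x, h (r • x) ∂μ) (∫ x, ⟪gradient h (r • x), x⟫_ℝ ∂μ) r := by
  have hc := hh.continuous
  have hg := hh.continuous_gradient
  have hk : Continuous fun q : ℝ × E => ⟪gradient h (q.1 • q.2), q.2⟫_ℝ := by fun_prop
  obtain ⟨C, hC⟩ := ((isCompact_closedBall r 1).prod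
    (isCompact_sphere (0 : E) 1)).exists_bound_of_continuousOn hk.continuousOn
  refine (hasDerivAt_integral_of_dominated_loc_of_deriv_le (μ := μ)
    (F := fun (r : ℝ) x => h (r • x)) (F' := fun (r : ℝ) x => ⟪gradient h (r • x), x⟫_ℝ)
    (x₀ := r) (s := Metric.closedBall r 1) (bound := fun _ => C)
    (Metric.closedBall_mem_nhds r one_pos) (Filter.Eventually.of_forall fun s => ?_) ?_ ?_ ?_
    (integrable_const C) ?_).2
  · exact Continuous.aestronglyMeasurable (by fun_prop)
  · exact integrable_of_continuous_of_sphere hS (by fun_prop)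
  · exact Continuous.aestronglyMeasurable (by fun_prop)
  · filter_upwards [hS] with x hx s hs
    exact hC (s, x) ⟨hs, by simpa using hx⟩
  · refine ae_of_all _ fun x s _ => ?_
    have h1 : HasFDerivAt h (innerSL ℝ (gradient h (s • x))) (s • x) :=
      (hh.differentiable one_ne_zero (s • x)).hasGradientAt.hasFDerivAt
    have h2 := h1.comp_hasDerivAt s ((hasDerivAt_id s).smul_const x)
    exact h2.congr_deriv (by simp)

end SphereIntegral

section Riccati

/-- The solution of the Riccati equation attached to the spherical harmonics of degree `1` on an
annulus with inner radius `b ^ (1 / (k + 3))`. -/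
noncomputable def riccatiWeight (k : ℕ) (b r : ℝ) : ℝ :=
  r ^ (k + 1) * (r ^ (k + 3) - (k + 2) * b) / (r ^ (k + 3) + b)

lemma hasDerivAt_riccatiWeight (k : ℕ) {b r : ℝ} (hb : 0 < b) (hr : 0 < r) :
    HasDerivAt (riccatiWeight k b)
      ((k + 2) * r ^ k - riccatiWeight k b r ^ 2 / r ^ (k + 2)) r := by
  have hpos : r ^ (k + 3) + b ≠ 0 := by positivity
  have h1 := ((hasDerivAt_pow (k + 1) r).mul ((hasDerivAt_pow (k + 3) r).sub_const
    ((k + 2) * b))).div ((hasDerivAt_pow (k + 3) r).add_const b) hpos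
  refine h1.congr_deriv ?_
  simp only [riccatiWeight, Pi.mul_apply]
  have : r ^ (k + 2) ≠ 0 := by positivity
  field_simp
  push_cast
  simp only [pow_add]
  ring

lemma riccatiWeight_self (k : ℕ) {ε : ℝ} (hε : 0 < ε) :
    riccatiWeight k (ε ^ (k + 3)) ε = -((k + 1) / 2 * ε ^ (k + 1)) := by
  rw [riccatiWeight]
  have : ε ^ (k + 3) ≠ 0 := by positivity
  field_simp
  ring

lemma le_riccatiWeight_one (k : ℕ) {b : ℝ} (hb : 0 < b) :
    1 - (k + 3) * b ≤ riccatiWeight k b 1 := by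
  rw [riccatiWeight, le_div_iff₀ (by positivity)]
  simp only [one_pow]
  nlinarith [sq_nonneg b, (k.cast_nonneg : (0 : ℝ) ≤ k)]

end Riccati

section AnnulusInequality

open scoped InnerProductSpace

section

variable {E : Type*} [NormedAddCommGroup E] [InnerProductSpace ℝ E] [FiniteDimensional ℝ E]
  [MeasurableSpace E] [BorelSpace E] {μ : Measure E} [IsFiniteMeasure μ]

lemma integral_sub_average_sq (hS : ∀ᵐ x ∂μ, ‖x‖ = 1) (hμ : μ.real Set.univ ≠ 0) {z : E → ℝ}
    (hz : Continuous z) : ∫ x, (z x - (∫ y, z y ∂μ) / μ.real Set.univ) ^ 2 ∂μ =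
      ∫ x, z x ^ 2 ∂μ - (∫ x, z x ∂μ) ^ 2 / μ.real Set.univ := by
  set c := (∫ y, z y ∂μ) / μ.real Set.univ with hc
  have h1 : ∀ x, (z x - c) ^ 2 = z x ^ 2 - (2 * c * z x - c ^ 2) := fun x => by ring
  simp_rw [h1]
  rw [integral_sub (integrable_of_continuous_of_sphere hS (by fun_prop))
    (integrable_of_continuous_of_sphere hS (by fun_prop)),
    integral_sub (integrable_of_continuous_of_sphere hS (by fun_prop)) (integrable_const _),
    integral_const_mul, integral_const, smul_eq_mul, hc]
  field_simp
  ring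

lemma integral_covariance_nonneg (hS : ∀ᵐ x ∂μ, ‖x‖ = 1) (hμ : μ.real Set.univ ≠ 0)
    {u v : E → ℝ} (hu : Continuous u) (hv : Continuous v) (s w : ℝ) :
    0 ≤ s ^ 2 * (∫ x, v x ^ 2 ∂μ - (∫ x, v x ∂μ) ^ 2 / μ.real Set.univ) -
      2 * s * w * (∫ x, u x * v x ∂μ - (∫ x, u x ∂μ) * (∫ x, v x ∂μ) / μ.real Set.univ) +
      w ^ 2 * (∫ x, u x ^ 2 ∂μ - (∫ x, u x ∂μ) ^ 2 / μ.real Set.univ) := by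
  have h := integral_sub_average_sq hS hμ (z := fun x => s * v x - w * u x) (by fun_prop)
  have h0 : 0 ≤ ∫ x, (s * v x - w * u x -
      (∫ y, (s * v y - w * u y) ∂μ) / μ.real Set.univ) ^ 2 ∂μ :=
    integral_nonneg fun x => sq_nonneg _
  rw [h] at h0
  have h1 : ∀ x, (s * v x - w * u x) ^ 2 =
      s ^ 2 * v x ^ 2 - 2 * s * w * (u x * v x) + w ^ 2 * u x ^ 2 := fun x => by ring
  simp_rw [h1] at h0
  rw [integral_add (integrable_of_continuous_of_sphere hS (by fun_prop))
    (integrable_of_continuous_of_sphere hS (by fun_prop)),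
    integral_sub (integrable_of_continuous_of_sphere hS (by fun_prop))
    (integrable_of_continuous_of_sphere hS (by fun_prop)),
    integral_sub (integrable_of_continuous_of_sphere hS (by fun_prop))
    (integrable_of_continuous_of_sphere hS (by fun_prop))] at h0
  simp only [integral_const_mul] at h0
  refine h0.trans_eq ?_
  field_simp
  ring

end

variable {k : ℕ} {μ : Measure (EuclideanSpace ℝ (Fin (k + 3)))} [IsFiniteMeasure μ]

lemma sphere_poincare_smul
    (hμ : ∀ e : EuclideanSpace ℝ (Fin (k + 3)) ≃ₗᵢ[ℝ] EuclideanSpace ℝ (Fin (k + 3)), μ.map e = μ)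
    (hS : ∀ᵐ x ∂μ, ‖x‖ = 1) (hμ0 : μ.real Set.univ ≠ 0)
    {f : EuclideanSpace ℝ (Fin (k + 3)) → ℝ} (hf : ContDiff ℝ 1 f) (r : ℝ) :
    (k + 2) * (∫ x, f (r • x) ^ 2 ∂μ - (∫ x, f (r • x) ∂μ) ^ 2 / μ.real Set.univ) ≤
      r ^ 2 * (∫ x, ‖gradient f (r • x)‖ ^ 2 ∂μ - ∫ x, ⟪gradient f (r • x), x⟫_ℝ ^ 2 ∂μ) := by
  have hfc := hf.continuous
  have hg := hf.continuous_gradient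
  set c := (∫ x, f (r • x) ∂μ) / μ.real Set.univ with hc
  have hφ : ContDiff ℝ 1 fun x : EuclideanSpace ℝ (Fin (k + 3)) => f (r • x) - c :=
    (hf.comp (contDiff_const_smul r)).sub contDiff_const
  have hgrad : ∀ x, gradient (fun x => f (r • x) - c) x = r • gradient f (r • x) := fun x => by
    refine HasGradientAt.gradient ?_
    have h1 : HasFDerivAt f (innerSL ℝ (gradient f (r • x))) (r • x) :=
      (hf.differentiable one_ne_zero (r • x)).hasGradientAt.hasFDerivAt
    have h2 := (h1.comp x ((hasFDerivAt_id x).const_smul r)).sub_const c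
    refine (h2.congr_fderiv ?_ : HasFDerivAt _ _ _)
    ext v
    simp
  have h0 : ∫ x, (f (r • x) - c) ∂μ = 0 := by
    rw [integral_sub (integrable_of_continuous_of_sphere hS (by fun_prop)) (integrable_const _),
      integral_const, smul_eq_mul, hc]
    field_simp
    ring
  have key := sphere_poincare (by omega) hμ hS hφ h0
  rw [integral_sub_average_sq hS hμ0 (z := fun x => f (r • x)) (by fun_prop)] at key
  simp only [hgrad, norm_smul, inner_smul_left, mul_pow, Real.norm_eq_abs, sq_abs,
    RCLike.conj_to_real, ← mul_sub, integral_const_mul] at key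
  rw [integral_sub (integrable_of_continuous_of_sphere hS (by fun_prop))
    (integrable_of_continuous_of_sphere hS (by fun_prop))] at key
  push_cast at key
  convert key using 2
  ring

/-- The Steklov inequality on the annulus `ε < ‖x‖ < 1`, written in polar coordinates. -/
theorem annulus_steklov_le
    (hμ : ∀ e : EuclideanSpace ℝ (Fin (k + 3)) ≃ₗᵢ[ℝ] EuclideanSpace ℝ (Fin (k + 3)), μ.map e = μ)
    (hS : ∀ᵐ x ∂μ, ‖x‖ = 1) {f : EuclideanSpace ℝ (Fin (k + 3)) → ℝ} (hf : ContDiff ℝ 1 f)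
    {ε : ℝ} (hε : 0 < ε) (hε2 : ε ≤ 1 / 2)
    (h0 : ∫ x, f x ∂μ + ε ^ (k + 2) * ∫ x, f (ε • x) ∂μ = 0) :
    (1 - (k + 3) * ε ^ (k + 3)) * (∫ x, f x ^ 2 ∂μ + ε ^ (k + 2) * ∫ x, f (ε • x) ^ 2 ∂μ) ≤
      ∫ r in ε..1, r ^ (k + 2) * ∫ x, ‖gradient f (r • x)‖ ^ 2 ∂μ := by
  rcases eq_or_ne μ 0 with rfl | hμ0
  · simp
  set N := μ.real Set.univ with hN
  have hNpos : 0 < N := by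
    rw [hN, measureReal_def]
    exact ENNReal.toReal_pos (by simpa using hμ0) (measure_ne_top _ _)
  have hfc := hf.continuous
  have hg := hf.continuous_gradient
  set b := ε ^ (k + 3) with hb
  have hbpos : 0 < b := by positivity
  set w := riccatiWeight k b with hw
  set H : ℝ → ℝ := fun r => ∫ x, f (r • x) ^ 2 ∂μ with hH
  set S : ℝ → ℝ := fun r => ∫ x, f (r • x) ∂μ with hSdef
  set p : ℝ → ℝ := fun r => ∫ x, ⟪gradient f (r • x), x⟫_ℝ ∂μ with hp
  set P : ℝ → ℝ := fun r => ∫ x, ⟪gradient f (r • x), x⟫_ℝ ^ 2 ∂μ with hP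
  set B : ℝ → ℝ := fun r => ∫ x, f (r • x) * ⟪gradient f (r • x), x⟫_ℝ ∂μ with hB
  set Q : ℝ → ℝ := fun r => ∫ x, ‖gradient f (r • x)‖ ^ 2 ∂μ with hQ
  have hSd : ∀ r, HasDerivAt S (p r) r := fun r => hasDerivAt_integral_smul_of_sphere hS hf r
  have hHd : ∀ r, HasDerivAt H (2 * B r) r := fun r => by
    refine (hasDerivAt_integral_smul_of_sphere hS (hf.pow 2) r).congr_deriv ?_
    rw [hB, ← integral_const_mul]
    refine integral_congr_ae (ae_of_all _ fun x => ?_)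
    have h1 : HasGradientAt (fun x => f x ^ 2) ((2 * f (r • x)) • gradient f (r • x)) (r • x) := by
      have := (hf.differentiable one_ne_zero (r • x)).hasGradientAt.hasFDerivAt.pow 2
      refine (this.congr_fderiv ?_ : HasFDerivAt _ _ _)
      ext v
      simp
    simp only [h1.gradient, inner_smul_left, RCLike.conj_to_real]
    ring
  have hQc : Continuous Q := continuous_integral_of_sphere hS (by fun_prop)
  set D : ℝ → ℝ := fun r => H r - S r ^ 2 / N with hD
  have hDd : ∀ r, HasDerivAt D (2 * (B r - S r * p r / N)) r := fun r =>
    ((hHd r).sub (((hSd r).pow 2).div_const N)).congr_deriv (by push_cast; ring)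
  have hD0 : ∀ r, 0 ≤ D r := fun r => by
    have := integral_sub_average_sq hS hNpos.ne' (z := fun x => f (r • x)) (by fun_prop)
    rw [hD]
    simp only
    rw [hH, hSdef, ← this]
    exact integral_nonneg fun x => sq_nonneg _
  set c := (S 1 - S ε) / N * ε ^ (k + 1) with hc
  set G : ℝ → ℝ := fun r => w r * D r + (2 * c * S r + N * c ^ 2 * (r ^ (k + 1))⁻¹) with hG
  have hGd : ∀ r, 0 < r → HasDerivAt G
      ((((k + 2) * r ^ k - w r ^ 2 / r ^ (k + 2)) * D r + w r * (2 * (B r - S r * p r / N))) +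
        (2 * c * p r + N * c ^ 2 * (-((k + 1) * r ^ k) / (r ^ (k + 1)) ^ 2))) r := fun r hr => by
    refine ((hasDerivAt_riccatiWeight k hbpos hr).mul (hDd r)).add
      (((hSd r).const_mul (2 * c)).add (HasDerivAt.const_mul (N * c ^ 2) ?_))
    exact ((hasDerivAt_pow (k + 1) r).inv (by positivity)).congr_deriv (by simp)
  have hle : ∀ r, 0 < r →
      (((k + 2) * r ^ k - w r ^ 2 / r ^ (k + 2)) * D r + w r * (2 * (B r - S r * p r / N))) +
        (2 * c * p r + N * c ^ 2 * (-((k + 1) * r ^ k) / (r ^ (k + 1)) ^ 2)) ≤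
      r ^ (k + 2) * Q r := fun r hr => by
    have h1 : (k + 2) * D r ≤ r ^ 2 * (Q r - P r) := sphere_poincare_smul hμ hS hNpos.ne' hf r
    have h2 : 0 ≤ (r ^ (k + 2)) ^ 2 * (P r - p r ^ 2 / N) -
        2 * r ^ (k + 2) * w r * (B r - S r * p r / N) + w r ^ 2 * D r :=
      integral_covariance_nonneg hS hNpos.ne' (u := fun x => f (r • x))
        (v := fun x => ⟪gradient f (r • x), x⟫_ℝ) (by fun_prop) (by fun_prop) _ _
    have hs : 0 < r ^ (k + 2) := by positivity
    have h3 : w r * (2 * (B r - S r * p r / N)) ≤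
        r ^ (k + 2) * (P r - p r ^ 2 / N) + w r ^ 2 / r ^ (k + 2) * D r := by
      rw [← sub_nonneg]
      have : r ^ (k + 2) * (P r - p r ^ 2 / N) + w r ^ 2 / r ^ (k + 2) * D r -
          w r * (2 * (B r - S r * p r / N)) = ((r ^ (k + 2)) ^ 2 * (P r - p r ^ 2 / N) -
        2 * r ^ (k + 2) * w r * (B r - S r * p r / N) + w r ^ 2 * D r) / r ^ (k + 2) := by
        field_simp
        ring
      rw [this]
      positivity
    have h4 := mul_le_mul_of_nonneg_left h1 (pow_nonneg hr.le k)
    have h5 : r ^ k * (r ^ 2 * (Q r - P r)) = r ^ (k + 2) * (Q r - P r) := by ring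
    have h6 : -((k + 1) * r ^ k) / (r ^ (k + 1)) ^ 2 ≤ - (1 / r ^ (k + 2)) := by
      rw [neg_div, neg_le_neg_iff, div_le_div_iff₀ hs (by positivity)]
      have : (1 : ℝ) * (r ^ (k + 1)) ^ 2 = r ^ k * r ^ (k + 2) := by ring
      rw [this]
      have h7 : 0 ≤ (k : ℝ) * (r ^ k * r ^ (k + 2)) := by positivity
      nlinarith
    have h7 := mul_le_mul_of_nonneg_left h6 (by positivity : 0 ≤ N * c ^ 2)
    have h8 : 2 * c * p r + N * c ^ 2 * (-(1 / r ^ (k + 2))) ≤ r ^ (k + 2) * (p r ^ 2 / N) := by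
      rw [← sub_nonneg]
      have : r ^ (k + 2) * (p r ^ 2 / N) - (2 * c * p r + N * c ^ 2 * (-(1 / r ^ (k + 2)))) =
          (r ^ (k + 2) * p r - N * c) ^ 2 / (N * r ^ (k + 2)) := by
        field_simp
        ring
      rw [this]
      positivity
    linarith
  have hε1 : ε ≤ 1 := by linarith
  have hgint : G 1 - G ε ≤ ∫ r in ε..1, r ^ (k + 2) * Q r := by
    refine intervalIntegral.sub_le_integral_of_hasDeriv_right_of_le hε1
      (fun r hr => (hGd r (hε.trans_le hr.1)).continuousAt.continuousWithinAt)
      (fun r hr => (hGd r (hε.trans hr.1)).hasDerivWithinAt)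
      (Continuous.integrableOn_Icc (by fun_prop)) (fun r hr => hle r (hε.trans hr.1))
  refine le_trans ?_ hgint
  have hw1 : 1 - (k + 3) * b ≤ w 1 := le_riccatiWeight_one k hbpos
  have hwε : w ε = -((k + 1) / 2 * ε ^ (k + 1)) := riccatiWeight_self k hε
  have hH1 : ∫ x, f x ^ 2 ∂μ = H 1 := by simp [hH]
  have hS1 : ∫ x, f x ∂μ = S 1 := by simp [hSdef]
  have hHε : ∫ x, f (ε • x) ^ 2 ∂μ = H ε := rfl
  rw [hH1, hHε]
  have h0' : S 1 = -(ε ^ (k + 2) * S ε) := by rw [← hS1]; linarith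
  have hD1 := hD0 1
  have hDε := hD0 ε
  have hHD : ∀ r, H r = D r + S r ^ 2 / N := fun r => by simp [hD]
  set t := ε ^ (k + 1) with ht
  have htpos : 0 < t := by positivity
  have hεt : ε ^ (k + 2) = ε * t := by rw [ht]; ring
  rw [hεt] at h0' ⊢
  set a := 1 - (k + 3) * b with ha
  have ha1 : a ≤ 1 := by
    have : 0 ≤ (k + 3) * b := by positivity
    linarith
  have hG1 : a * D 1 + (2 * c * S 1 + N * c ^ 2) ≤ G 1 := by
    have := mul_le_mul_of_nonneg_right hw1 hD1
    simp only [hG, one_pow, inv_one, mul_one]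
    linarith
  have hGε : G ε = -((k + 1) / 2 * t) * D ε + (2 * c * S ε + N * c ^ 2 * t⁻¹) := by
    simp only [hG, hwε, ht]
  have h1 : a * (ε * t * D ε) ≤ (k + 1) / 2 * t * D ε := by
    have e1 : a * (ε * t * D ε) ≤ 1 * (ε * t * D ε) :=
      mul_le_mul_of_nonneg_right ha1 (by positivity)
    have e2 : ε * (t * D ε) ≤ 1 / 2 * (t * D ε) :=
      mul_le_mul_of_nonneg_right hε2 (by positivity)
    have e3 : 0 ≤ (k : ℝ) * (t * D ε) := by positivity
    linarith
  have h2 : (S 1 - S ε) ^ 2 * t / N ≤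
      2 * c * S 1 + N * c ^ 2 - (2 * c * S ε + N * c ^ 2 * t⁻¹) := by
    have e1 : 2 * c * S 1 + N * c ^ 2 - (2 * c * S ε + N * c ^ 2 * t⁻¹) =
        (S 1 - S ε) ^ 2 * t / N + N * c ^ 2 := by
      rw [hc]
      field_simp
      ring
    rw [e1]
    have : 0 ≤ N * c ^ 2 := by positivity
    linarith
  have h3 : a * (S 1 ^ 2 / N + ε * t * (S ε ^ 2 / N)) ≤ (S 1 - S ε) ^ 2 * t / N := by
    have e1 : a * (S 1 ^ 2 / N + ε * t * (S ε ^ 2 / N)) ≤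
        1 * (S 1 ^ 2 / N + ε * t * (S ε ^ 2 / N)) :=
      mul_le_mul_of_nonneg_right ha1 (by positivity)
    have e2 : (S 1 - S ε) ^ 2 * t / N - 1 * (S 1 ^ 2 / N + ε * t * (S ε ^ 2 / N)) =
        S ε ^ 2 / N * t * (1 + ε * t) * ((1 - ε) + ε * t) := by
      rw [h0']
      ring
    have e3 : 0 ≤ S ε ^ 2 / N * t * (1 + ε * t) * ((1 - ε) + ε * t) := by
      have : 0 ≤ 1 - ε := by linarith
      positivity
    linarith
  rw [hHD 1, hHD ε]
  linarith

end AnnulusInequality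

section Polar

variable {E : Type*} [NormedAddCommGroup E] [InnerProductSpace ℝ E] [FiniteDimensional ℝ E]
  [MeasurableSpace E] [BorelSpace E]

/-- Polar coordinates on an annulus. -/
lemma setIntegral_annulus_eq_toSphere {g : E → ℝ} (hg : Continuous g) {ε : ℝ} (hε : 0 < ε)
    (hε1 : ε ≤ 1) :
    ∫ x in {x : E | ε < ‖x‖ ∧ ‖x‖ < 1}, g x =
      ∫ r in ε..1, r ^ (Module.finrank ℝ E - 1) *
        ∫ θ, g (r • (θ : E)) ∂(volume : Measure E).toSphere := by
  set A : Set E := {x : E | ε < ‖x‖ ∧ ‖x‖ < 1} with hA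
  have hAm : MeasurableSet A :=
    ((isOpen_lt continuous_const continuous_norm).inter
      (isOpen_lt continuous_norm continuous_const)).measurableSet
  have hgint : Integrable (A.indicator g) := by
    rw [integrable_indicator_iff hAm]
    exact (hg.continuousOn.integrableOn_compact (isCompact_closedBall (0 : E) 1)).mono_set
      fun x hx => by simpa using hx.2.le
  set G : Metric.sphere (0 : E) 1 × Set.Ioi (0 : ℝ) → ℝ :=
    fun p => A.indicator g ((p.2 : ℝ) • (p.1 : E)) with hG
  have hcomp : ∀ x : ({0}ᶜ : Set E), G (homeomorphUnitSphereProd E x) = A.indicator g x := by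
    intro x
    have hx : ‖(x : E)‖ ≠ 0 := norm_ne_zero_iff.2 x.2
    simp [hG, smul_smul, mul_inv_cancel₀ hx]
  have hmp := (volume : Measure E).measurePreserving_homeomorphUnitSphereProd
  have hGint : Integrable G ((volume : Measure E).toSphere.prod
      (Measure.volumeIoiPow (Module.finrank ℝ E - 1))) := by
    rw [← hmp.integrable_comp_emb (Homeomorph.measurableEmbedding _)]
    have : G ∘ homeomorphUnitSphereProd E = A.indicator g ∘ Subtype.val := funext hcomp
    rw [this, ← MeasurableEmbedding.integrable_map_iff
      (MeasurableEmbedding.subtype_coe (measurableSet_singleton _).compl),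
      map_comap_subtype_coe (measurableSet_singleton _).compl]
    exact hgint.restrict
  have hinner : ∀ r : ℝ, 0 < r → ∫ θ, A.indicator g (r • (θ : E)) ∂(volume : Measure E).toSphere =
      (Set.Ioo ε 1).indicator
        (fun r => ∫ θ, g (r • (θ : E)) ∂(volume : Measure E).toSphere) r := by
    intro r hr
    have hn : ∀ θ : Metric.sphere (0 : E) 1, ‖r • (θ : E)‖ = r := fun θ => by
      simp [norm_smul, abs_of_pos hr]
    by_cases h : r ∈ Set.Ioo ε 1
    · rw [Set.indicator_of_mem h]
      refine integral_congr_ae (.of_forall fun θ => Set.indicator_of_mem ?_ _)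
      simpa only [hA, Set.mem_ofPred_eq, hn, Set.mem_Ioo] using h
    · rw [Set.indicator_of_notMem h]
      refine integral_eq_zero_of_ae (.of_forall fun θ => Set.indicator_of_notMem ?_ _)
      simpa only [hA, Set.mem_ofPred_eq, hn, Set.mem_Ioo] using h
  calc ∫ x in A, g x = ∫ x, A.indicator g x := (integral_indicator hAm).symm
    _ = ∫ x : ({0}ᶜ : Set E), A.indicator g x ∂(volume.comap Subtype.val) := by
      cases subsingleton_or_nontrivial E
      · have : A.indicator g = 0 := by
          ext x
          refine Set.indicator_of_notMem (fun hx => ?_) _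
          have : ‖x‖ = 0 := by simp [Subsingleton.elim x 0]
          linarith [hx.1]
        simp [this]
      · rw [integral_subtype_comap (measurableSet_singleton _).compl (A.indicator g),
          restrict_compl_singleton]
    _ = ∫ p, G p ∂((volume : Measure E).toSphere.prod
          (Measure.volumeIoiPow (Module.finrank ℝ E - 1))) := by
      rw [← hmp.integral_comp (Homeomorph.measurableEmbedding _)]
      exact integral_congr_ae (.of_forall fun x => (hcomp x).symm)
    _ = ∫ r : Set.Ioi (0 : ℝ), (Set.Ioo ε 1).indicator
          (fun r => ∫ θ, g (r • (θ : E)) ∂(volume : Measure E).toSphere) r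
          ∂(Measure.volumeIoiPow (Module.finrank ℝ E - 1)) := by
      rw [integral_prod_symm _ hGint]
      exact integral_congr_ae (.of_forall fun r => hinner r r.2)
    _ = ∫ r in Set.Ioi (0 : ℝ), (Set.Ioo ε 1).indicator (fun r => r ^ (Module.finrank ℝ E - 1) *
          ∫ θ, g (r • (θ : E)) ∂(volume : Measure E).toSphere) r := by
      simp only [Measure.volumeIoiPow, ENNReal.ofReal]
      rw [integral_withDensity_eq_integral_smul
        ((measurable_subtype_coe.pow_const _).real_toNNReal),
        integral_subtype_comap measurableSet_Ioi fun a =>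
          Real.toNNReal (a ^ (Module.finrank ℝ E - 1)) • (Set.Ioo ε 1).indicator
          (fun r => ∫ θ, g (r • (θ : E)) ∂(volume : Measure E).toSphere) a]
      refine setIntegral_congr_fun measurableSet_Ioi fun r hr => ?_
      simp only [NNReal.smul_def, Real.coe_toNNReal _ (pow_nonneg (le_of_lt hr) _), smul_eq_mul]
      by_cases h : r ∈ Set.Ioo ε 1 <;> simp [h]
    _ = _ := by
      rw [setIntegral_indicator measurableSet_Ioo, intervalIntegral.integral_of_le hε1,
        integral_Ioc_eq_integral_Ioo, Set.inter_eq_right.2]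
      exact fun r hr => hε.trans hr.1

variable (E) in
lemma map_toSphere_map_linearIsometryEquiv (e : E ≃ₗᵢ[ℝ] E) :
    ((volume : Measure E).toSphere.map Subtype.val).map e =
      (volume : Measure E).toSphere.map Subtype.val := by
  have key : ∀ t : Set E, MeasurableSet t → (volume : Measure E).toSphere.map Subtype.val t =
      Module.finrank ℝ E * volume (Set.Ioo (0 : ℝ) 1 • (t ∩ Metric.sphere 0 1)) := by
    intro t ht
    rw [Measure.map_apply measurable_subtype_coe ht,
      Measure.toSphere_apply' _ (measurable_subtype_coe ht), Subtype.image_preimage_coe,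
      Set.inter_comm]
  ext t ht
  have he : Measurable e := e.continuous.measurable
  rw [Measure.map_apply he ht, key _ (he ht), key _ ht]
  congr 1
  rw [← e.measurePreserving.measure_preimage_emb e.toHomeomorph.measurableEmbedding
    (Set.Ioo (0 : ℝ) 1 • (t ∩ Metric.sphere 0 1))]
  congr 1
  ext x
  simp only [Set.mem_smul, Set.mem_preimage, Set.mem_inter_iff, mem_sphere_zero_iff_norm]
  constructor
  · rintro ⟨r, hr, y, ⟨hy, hy1⟩, rfl⟩
    exact ⟨r, hr, e y, ⟨hy, by simpa using hy1⟩, by simp⟩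
  · rintro ⟨r, hr, y, ⟨hy, hy1⟩, h⟩
    exact ⟨r, hr, e.symm y, ⟨by simpa using hy, by simpa using hy1⟩, e.injective (by simpa using h)⟩

/-- Any rotation invariant measure on the unit sphere may be used for polar coordinates, up to
normalization. -/
lemma setIntegral_annulus_eq {μ : Measure E} [IsFiniteMeasure μ]
    (hμ : ∀ e : E ≃ₗᵢ[ℝ] E, μ.map e = μ) (hS : ∀ᵐ x ∂μ, ‖x‖ = 1) (hμ0 : μ.real Set.univ ≠ 0)
    {g : E → ℝ} (hg : Continuous g) {ε : ℝ} (hε : 0 < ε) (hε1 : ε ≤ 1) :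
    ∫ x in {x : E | ε < ‖x‖ ∧ ‖x‖ < 1}, g x =
      (Module.finrank ℝ E * volume.real (Metric.ball (0 : E) 1) / μ.real Set.univ) *
        ∫ r in ε..1, r ^ (Module.finrank ℝ E - 1) * ∫ x, g (r • x) ∂μ := by
  rw [setIntegral_annulus_eq_toSphere hg hε hε1, ← intervalIntegral.integral_const_mul]
  refine intervalIntegral.integral_congr fun r _ => ?_
  have hfin : IsFiniteMeasure ((volume : Measure E).toSphere.map Subtype.val) := inferInstance
  have hσS : ∀ᵐ x ∂(volume : Measure E).toSphere.map Subtype.val, ‖x‖ = 1 := by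
    rw [ae_map_iff measurable_subtype_coe.aemeasurable
      (measurableSet_eq_fun measurable_norm measurable_const)]
    exact .of_forall fun θ => by simp
  have hgr : Continuous fun x : E => g (r • x) := by fun_prop
  have h := integral_mul_eq_of_invariant hμ (map_toSphere_map_linearIsometryEquiv E) hS hσS hgr
  have hm : ((volume : Measure E).toSphere.map Subtype.val).real Set.univ =
      Module.finrank ℝ E * volume.real (Metric.ball (0 : E) 1) := by
    rw [map_measureReal_apply measurable_subtype_coe .univ, Set.preimage_univ,
      Measure.toSphere_real_apply_univ]
  rw [hm, (MeasurableEmbedding.subtype_coe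
    Metric.isClosed_sphere.measurableSet).integral_map] at h
  field_simp
  linear_combination (-r ^ (Module.finrank ℝ E - 1)) * h

end Polar

section SteklovBounds

variable {n : ℕ}

lemma isFiniteMeasure_restrict_sphere (hn : 1 ≤ n) :
    IsFiniteMeasure ((μH[(n : ℝ) - 1] : Measure (EuclideanSpace ℝ (Fin n))).restrict
      (Metric.sphere 0 1)) :=
  isFiniteMeasure_restrict.2 (hausdorffMeasure_sphere_lt_top hn).ne

lemma ae_restrict_sphere_norm_eq_one :
    ∀ᵐ x ∂((μH[(n : ℝ) - 1] : Measure (EuclideanSpace ℝ (Fin n))).restrict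
      (Metric.sphere 0 1)), ‖x‖ = 1 := by
  filter_upwards [ae_restrict_mem Metric.isClosed_sphere.measurableSet] with x hx
  simpa using hx

lemma measureReal_restrict_sphere_univ :
    ((μH[(n : ℝ) - 1] : Measure (EuclideanSpace ℝ (Fin n))).restrict
      (Metric.sphere 0 1)).real Set.univ =
      (μH[(n : ℝ) - 1] (Metric.sphere (0 : EuclideanSpace ℝ (Fin n)) 1)).toReal := by
  simp [Measure.real]

lemma hausdorffMeasure_sphere_toReal_pos (hn : 1 ≤ n) :
    0 < (μH[(n : ℝ) - 1] (Metric.sphere (0 : EuclideanSpace ℝ (Fin n)) 1)).toReal :=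
  ENNReal.toReal_pos (hausdorffMeasure_sphere_pos hn).ne' (hausdorffMeasure_sphere_lt_top hn).ne

lemma setIntegral_sphere_coord (i : Fin n) :
    ∫ x in Metric.sphere (0 : EuclideanSpace ℝ (Fin n)) 1, x i ∂μH[(n : ℝ) - 1] = 0 := by
  have h := map_hausdorffMeasure_restrict_sphere (n := n) (LinearIsometryEquiv.neg ℝ)
    ((n : ℝ) - 1)
  have h2 : ∫ x in Metric.sphere (0 : EuclideanSpace ℝ (Fin n)) 1, x i ∂μH[(n : ℝ) - 1] =
      ∫ x in Metric.sphere (0 : EuclideanSpace ℝ (Fin n)) 1, (-x) i ∂μH[(n : ℝ) - 1] := by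
    conv_lhs => rw [← h]
    exact (LinearIsometryEquiv.neg ℝ).toHomeomorph.measurableEmbedding.integral_map _
  simp only [PiLp.neg_apply, integral_neg] at h2
  linarith

lemma exists_setIntegral_sphere_coord_sq (hn : 1 ≤ n) : ∃ i : Fin n,
    (μH[(n : ℝ) - 1] (Metric.sphere (0 : EuclideanSpace ℝ (Fin n)) 1)).toReal ≤
      n * ∫ x in Metric.sphere (0 : EuclideanSpace ℝ (Fin n)) 1, x i ^ 2 ∂μH[(n : ℝ) - 1] := by
  have := isFiniteMeasure_restrict_sphere hn
  by_contra! h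
  have : Nonempty (Fin n) := ⟨⟨0, hn⟩⟩
  have h1 := Finset.sum_lt_sum_of_nonempty (Finset.univ_nonempty (α := Fin n)) fun i _ => h i
  rw [← Finset.mul_sum, ← integral_finsetSum _ fun i _ =>
    integrable_of_continuous_of_sphere ae_restrict_sphere_norm_eq_one (by fun_prop)] at h1
  have h2 : ∫ x in Metric.sphere (0 : EuclideanSpace ℝ (Fin n)) 1, ∑ i, x i ^ 2 ∂μH[(n : ℝ) - 1] =
      (μH[(n : ℝ) - 1] (Metric.sphere (0 : EuclideanSpace ℝ (Fin n)) 1)).toReal := by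
    rw [integral_congr_ae (g := fun _ => (1 : ℝ)), integral_const,
      measureReal_restrict_sphere_univ, smul_eq_mul, mul_one]
    filter_upwards [ae_restrict_sphere_norm_eq_one] with x hx
    rw [← EuclideanSpace.real_norm_sq_eq, hx, one_pow]
  simp [h2] at h1

lemma norm_gradient_coord (i : Fin n) (x : EuclideanSpace ℝ (Fin n)) :
    ‖gradient (fun x : EuclideanSpace ℝ (Fin n) => x i) x‖ = 1 := by
  have h : HasGradientAt (fun x : EuclideanSpace ℝ (Fin n) => x i)
      (EuclideanSpace.single i (1 : ℝ)) x := by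
    rw [hasGradientAt_iff_hasFDerivAt]
    refine (EuclideanSpace.proj i : EuclideanSpace ℝ (Fin n) →L[ℝ] ℝ).hasFDerivAt.congr_fderiv ?_
    ext y
    simp [EuclideanSpace.inner_single_left]
  rw [h.gradient]
  simp

lemma stekSigma1_le {Ω : Set (EuclideanSpace ℝ (Fin n))} {f : EuclideanSpace ℝ (Fin n) → ℝ}
    (hf : ContDiff ℝ (⊤ : ℕ∞) f) (h0 : ∫ x in frontier Ω, f x ∂μH[(n : ℝ) - 1] = 0)
    (h1 : 0 < ∫ x in frontier Ω, f x ^ 2 ∂μH[(n : ℝ) - 1]) :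
    stekSigma1 Ω ≤ (∫ x in Ω, ‖gradient f x‖ ^ 2) /
      (∫ x in frontier Ω, f x ^ 2 ∂μH[(n : ℝ) - 1]) := by
  refine csInf_le ⟨0, ?_⟩ ⟨f, hf, h0, h1, rfl⟩
  rintro _ ⟨g, -, -, hg, rfl⟩
  exact div_nonneg (integral_nonneg fun x => sq_nonneg _) hg.le

lemma stekSigma1_ball_le (hn : 1 ≤ n) :
    stekSigma1 (Metric.ball (0 : EuclideanSpace ℝ (Fin n)) 1) ≤
      n * volume.real (Metric.ball (0 : EuclideanSpace ℝ (Fin n)) 1) /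
        (μH[(n : ℝ) - 1] (Metric.sphere (0 : EuclideanSpace ℝ (Fin n)) 1)).toReal := by
  obtain ⟨i, hi⟩ := exists_setIntegral_sphere_coord_sq hn
  have hS := hausdorffMeasure_sphere_toReal_pos hn
  have hn0 : (0 : ℝ) < n := by exact_mod_cast hn
  have hfr : frontier (Metric.ball (0 : EuclideanSpace ℝ (Fin n)) 1) = Metric.sphere 0 1 :=
    frontier_ball _ one_ne_zero
  have hpos : 0 < ∫ x in Metric.sphere (0 : EuclideanSpace ℝ (Fin n)) 1, x i ^ 2
      ∂μH[(n : ℝ) - 1] := pos_of_mul_pos_right (hS.trans_le hi) hn0.le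
  refine (stekSigma1_le (f := fun x => x i) (by fun_prop)
    (by rw [hfr]; exact setIntegral_sphere_coord i) (by rw [hfr]; exact hpos)).trans ?_
  rw [hfr]
  simp only [norm_gradient_coord, one_pow]
  rw [setIntegral_const, smul_eq_mul, mul_one, div_le_div_iff₀ hpos hS]
  have hv : 0 ≤ volume.real (Metric.ball (0 : EuclideanSpace ℝ (Fin n)) 1) := measureReal_nonneg
  nlinarith

lemma frontier_annulus (hn : 1 ≤ n) {ε : ℝ} (hε : 0 < ε) (hε1 : ε < 1) :
    frontier {x : EuclideanSpace ℝ (Fin n) | ε < ‖x‖ ∧ ‖x‖ < 1} =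
      Metric.sphere 0 1 ∪ Metric.sphere 0 ε := by
  have : Nonempty (Fin n) := ⟨⟨0, hn⟩⟩
  have hA : {x : EuclideanSpace ℝ (Fin n) | ε < ‖x‖ ∧ ‖x‖ < 1} =
      Metric.ball 0 1 ∩ (Metric.closedBall 0 ε)ᶜ := by
    ext x; simp [and_comm]
  have hopen : IsOpen {x : EuclideanSpace ℝ (Fin n) | ε < ‖x‖ ∧ ‖x‖ < 1} := by
    rw [hA]
    exact Metric.isOpen_ball.inter Metric.isClosed_closedBall.isOpen_compl
  refine Set.Subset.antisymm ?_ ?_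
  · rw [hA]
    refine (frontier_inter_subset _ _).trans (Set.union_subset_union ?_ ?_)
    · rw [frontier_ball _ one_ne_zero]
      exact Set.inter_subset_left
    · rw [frontier_compl, frontier_closedBall _ hε.ne']
      exact Set.inter_subset_right
  · have key : ∀ x : EuclideanSpace ℝ (Fin n), ∀ s : ℝ, ‖x‖ = s → 0 < s → ε ≤ s → s ≤ 1 →
        x ∈ closure {x : EuclideanSpace ℝ (Fin n) | ε < ‖x‖ ∧ ‖x‖ < 1} := by
      intro x s hx hs h1 h2
      have hc : Continuous fun r : ℝ => (r * s⁻¹) • x := by fun_prop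
      have hcl : s ∈ closure (Set.Ioo ε 1) := by
        rw [closure_Ioo hε1.ne]; exact ⟨h1, h2⟩
      have := map_mem_closure hc hcl (t := {x | ε < ‖x‖ ∧ ‖x‖ < 1}) fun r hr => by
        have hr0 : 0 < r := hε.trans hr.1
        have : ‖(r * s⁻¹) • x‖ = r := by
          rw [norm_smul, hx, Real.norm_eq_abs, abs_of_pos (by positivity)]
          field_simp
        rw [Set.mem_ofPred_eq, this]
        exact hr
      simpa [hs.ne'] using this
    rw [hopen.frontier_eq]
    rintro x (hx | hx) <;> rw [mem_sphere_zero_iff_norm] at hx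
    · exact ⟨key x 1 hx one_pos hε1.le le_rfl, fun h => by linarith [h.2]⟩
    · exact ⟨key x ε hx hε le_rfl hε1.le, fun h => by linarith [h.1]⟩

lemma disjoint_sphere_sphere_of_lt_one {ε : ℝ} (hε1 : ε < 1) :
    Disjoint (Metric.sphere (0 : EuclideanSpace ℝ (Fin n)) 1) (Metric.sphere 0 ε) :=
  Set.disjoint_left.2 fun x hx hx2 => by
    rw [mem_sphere_zero_iff_norm] at hx hx2
    linarith

lemma hausdorffMeasure_sphere_radius_lt_top (hn : 1 ≤ n) {ε : ℝ} (hε : 0 < ε) :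
    μH[(n : ℝ) - 1] (Metric.sphere (0 : EuclideanSpace ℝ (Fin n)) ε) < ⊤ := by
  have h := hausdorffMeasure_sphere_radius hε hn
  have hS := hausdorffMeasure_sphere_toReal_pos hn
  refine lt_top_iff_ne_top.2 fun htop => ?_
  rw [htop, ENNReal.toReal_top] at h
  have := mul_pos (pow_pos hε (n - 1)) hS
  linarith

lemma setIntegral_frontier_annulus (hn : 1 ≤ n) {ε : ℝ} (hε : 0 < ε) (hε1 : ε < 1)
    {g : EuclideanSpace ℝ (Fin n) → ℝ} (hg : Continuous g) :
    ∫ x in frontier {x : EuclideanSpace ℝ (Fin n) | ε < ‖x‖ ∧ ‖x‖ < 1}, g x ∂μH[(n : ℝ) - 1] =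
      ∫ x in Metric.sphere 0 1, g x ∂μH[(n : ℝ) - 1] +
        ε ^ (n - 1) * ∫ x in Metric.sphere 0 1, g (ε • x) ∂μH[(n : ℝ) - 1] := by
  have hgint : ∀ s : ℝ, 0 < s → IntegrableOn g (Metric.sphere 0 s) μH[(n : ℝ) - 1] := by
    intro s hs
    obtain ⟨C, hC⟩ := (isCompact_sphere (0 : EuclideanSpace ℝ (Fin n))
      s).exists_bound_of_continuousOn hg.continuousOn
    exact IntegrableOn.of_bound (hausdorffMeasure_sphere_radius_lt_top hn hs)
      hg.aestronglyMeasurable C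
      ((ae_restrict_iff' Metric.isClosed_sphere.measurableSet).2 (.of_forall hC))
  rw [frontier_annulus hn hε hε1, setIntegral_union (disjoint_sphere_sphere_of_lt_one hε1)
    Metric.isClosed_sphere.measurableSet (hgint 1 one_pos) (hgint ε hε),
    setIntegral_sphere_hausdorffMeasure hε hn]

lemma hausdorffMeasure_frontier_annulus (hn : 1 ≤ n) {ε : ℝ} (hε : 0 < ε) (hε1 : ε < 1) :
    (μH[(n : ℝ) - 1] (frontier {x : EuclideanSpace ℝ (Fin n) | ε < ‖x‖ ∧ ‖x‖ < 1})).toReal =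
      (μH[(n : ℝ) - 1] (Metric.sphere (0 : EuclideanSpace ℝ (Fin n)) 1)).toReal *
        (1 + ε ^ (n - 1)) := by
  rw [frontier_annulus hn hε hε1, measure_union (disjoint_sphere_sphere_of_lt_one hε1)
    Metric.isClosed_sphere.measurableSet, ENNReal.toReal_add
    (hausdorffMeasure_sphere_lt_top hn).ne (hausdorffMeasure_sphere_radius_lt_top hn hε).ne,
    hausdorffMeasure_sphere_radius hε hn]
  ring

lemma le_stekSigma1_annulus (hn : 3 ≤ n) {ε : ℝ} (hε : 0 < ε) (hε2 : ε ≤ 1 / 2) :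
    n * volume.real (Metric.ball (0 : EuclideanSpace ℝ (Fin n)) 1) /
        (μH[(n : ℝ) - 1] (Metric.sphere (0 : EuclideanSpace ℝ (Fin n)) 1)).toReal *
        (1 - n * ε ^ n) ≤
      stekSigma1 {x : EuclideanSpace ℝ (Fin n) | ε < ‖x‖ ∧ ‖x‖ < 1} := by
  have hn1 : 1 ≤ n := by omega
  have hε1 : ε < 1 := by linarith
  have hS := hausdorffMeasure_sphere_toReal_pos hn1
  have := isFiniteMeasure_restrict_sphere hn1
  refine le_csInf ?_ ?_
  · obtain ⟨i, hi⟩ := exists_setIntegral_sphere_coord_sq hn1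
    have hpos : 0 < ∫ x in Metric.sphere (0 : EuclideanSpace ℝ (Fin n)) 1, x i ^ 2
      ∂μH[(n : ℝ) - 1] := pos_of_mul_pos_right (hS.trans_le hi) (Nat.cast_nonneg n)
    refine ⟨_, fun x => x i, by fun_prop, ?_, ?_, rfl⟩
    · rw [setIntegral_frontier_annulus hn1 hε hε1 (by fun_prop)]
      simp [integral_const_mul, setIntegral_sphere_coord]
    · rw [setIntegral_frontier_annulus hn1 hε hε1 (by fun_prop)]
      have : 0 ≤ ∫ x in Metric.sphere (0 : EuclideanSpace ℝ (Fin n)) 1, (ε • x) i ^ 2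
        ∂μH[(n : ℝ) - 1] := integral_nonneg fun x => sq_nonneg _
      positivity
  · rintro _ ⟨f, hf, h0, h1, rfl⟩
    have hf1 : ContDiff ℝ 1 f := hf.of_le (by exact_mod_cast le_top)
    rw [le_div_iff₀ h1]
    rw [setIntegral_frontier_annulus hn1 hε hε1 hf.continuous] at h0
    rw [setIntegral_frontier_annulus hn1 hε hε1 (g := fun x => f x ^ 2) (hf.continuous.pow 2)]
    rw [setIntegral_annulus_eq (fun e => map_hausdorffMeasure_restrict_sphere e ((n : ℝ) - 1))
      ae_restrict_sphere_norm_eq_one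
      (by rw [measureReal_restrict_sphere_univ]; exact hS.ne')
      (g := fun x => ‖gradient f x‖ ^ 2) (hf1.continuous_gradient.norm.pow 2) hε hε1.le,
      measureReal_restrict_sphere_univ, finrank_euclideanSpace_fin, mul_assoc]
    refine mul_le_mul_of_nonneg_left ?_ (by positivity)
    obtain ⟨k, rfl⟩ : ∃ k, n = k + 3 := ⟨n - 3, by omega⟩
    have h := annulus_steklov_le
      (fun e => map_hausdorffMeasure_restrict_sphere e (((k + 3 : ℕ) : ℝ) - 1))
      ae_restrict_sphere_norm_eq_one hf1 hε hε2 h0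
    push_cast at h ⊢
    exact h

lemma one_lt_of_small {m : ℕ} (hm : 1 ≤ m) {ε : ℝ} (hε : 0 < ε)
    (h : 2 * (m * (m + 1)) * ε < 1) :
    1 < (1 - (m + 1) * ε ^ (m + 1)) * (1 + ε ^ m) ^ ((1 : ℝ) / m) := by
  have hm1 : (1 : ℝ) ≤ m := by exact_mod_cast hm
  have hm0 : (m : ℝ) ≠ 0 := by positivity
  have hp : 0 < ε ^ m := by positivity
  have hm2 : (1 : ℝ) ≤ m * (m + 1) := by nlinarith
  have hε1 : ε < 1 := by nlinarith
  have hp1 : ε ^ m ≤ 1 := pow_le_one₀ hε.le hε1.le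
  have hb : m * ((m + 1) * ε ^ (m + 1)) < ε ^ m / 2 := by
    rw [pow_succ]; nlinarith
  have hb1 : (m + 1) * ε ^ (m + 1) ≤ m * ((m + 1) * ε ^ (m + 1)) :=
    le_mul_of_one_le_left (by positivity) hm1
  have hbern := one_add_mul_le_pow (a := -((m + 1) * ε ^ (m + 1))) (by linarith) m
  have hpos : 0 ≤ 1 - (m + 1) * ε ^ (m + 1) := by linarith
  have h1 : 1 < (1 - (m + 1) * ε ^ (m + 1)) ^ m * (1 + ε ^ m) := by
    rw [sub_eq_add_neg]
    refine lt_of_lt_of_le ?_ (mul_le_mul_of_nonneg_right hbern (by positivity))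
    nlinarith
  have h2 := Real.one_lt_rpow h1 (z := (1 : ℝ) / m) (by positivity)
  rwa [Real.mul_rpow (by positivity) (by positivity), one_div,
    Real.pow_rpow_inv_natCast hpos (by omega), ← one_div] at h2

end SteklovBounds

/-- For small `ε`, the boundary-volume-normalized first Steklov eigenvalue of the annulus
`A_ε = {ε < ‖x‖ < 1}` strictly exceeds that of the unit ball. -/
theorem stmt9 {n : ℕ} (hn : 3 ≤ n) :
    ∃ ε₀ ∈ Set.Ioo (0 : ℝ) 1, ∀ ε ∈ Set.Ioo (0 : ℝ) ε₀,
      stekSigma1 (Metric.ball (0 : EuclideanSpace ℝ (Fin n)) 1) *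
          (μH[(n : ℝ) - 1] (frontier (Metric.ball (0 : EuclideanSpace ℝ (Fin n)) 1))).toReal ^
            ((1 : ℝ) / ((n : ℝ) - 1))
        < stekSigma1 {x : EuclideanSpace ℝ (Fin n) | ε < ‖x‖ ∧ ‖x‖ < 1} *
            (μH[(n : ℝ) - 1]
                (frontier {x : EuclideanSpace ℝ (Fin n) | ε < ‖x‖ ∧ ‖x‖ < 1})).toReal ^
              ((1 : ℝ) / ((n : ℝ) - 1)) := by
  have hn3 : (3 : ℝ) ≤ n := by exact_mod_cast hn
  have hn1 : 1 ≤ n := by omega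
  have hD : 12 ≤ 2 * (((n : ℝ) - 1) * n) := by nlinarith
  refine ⟨1 / (2 * (((n : ℝ) - 1) * n)), ⟨by positivity, ?_⟩, fun ε hε => ?_⟩
  · rw [div_lt_one (by linarith)]
    linarith
  have hε0 := hε.1
  have hsmall : 2 * (((n : ℝ) - 1) * n) * ε < 1 := by
    have := (lt_div_iff₀ (by linarith)).1 hε.2
    linarith
  have hε2 : ε ≤ 1 / 2 := by nlinarith
  have hball := stekSigma1_ball_le hn1
  have hann := le_stekSigma1_annulus hn hε0 hε2
  have hS := hausdorffMeasure_sphere_toReal_pos hn1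
  rw [frontier_ball _ one_ne_zero, hausdorffMeasure_frontier_annulus hn1 hε0 (by linarith),
    Real.mul_rpow hS.le (by positivity)]
  set S := (μH[(n : ℝ) - 1] (Metric.sphere (0 : EuclideanSpace ℝ (Fin n)) 1)).toReal
  have hV : 0 < volume.real (Metric.ball (0 : EuclideanSpace ℝ (Fin n)) 1) :=
    ENNReal.toReal_pos (Metric.measure_ball_pos _ _ one_pos).ne' measure_ball_lt_top.ne
  set β := n * volume.real (Metric.ball (0 : EuclideanSpace ℝ (Fin n)) 1) / S
  have hβ : 0 < β := by positivity
  have hkey : 1 < (1 - n * ε ^ n) * (1 + ε ^ (n - 1)) ^ ((1 : ℝ) / ((n : ℝ) - 1)) := by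
    obtain ⟨m, rfl⟩ : ∃ m, n = m + 1 := ⟨n - 1, by omega⟩
    push_cast at hsmall ⊢
    rw [add_sub_cancel_right] at hsmall ⊢
    exact one_lt_of_small (by omega) hε0 hsmall
  calc _ ≤ β * S ^ ((1 : ℝ) / ((n : ℝ) - 1)) := by gcongr
    _ < β * S ^ ((1 : ℝ) / ((n : ℝ) - 1)) *
        ((1 - n * ε ^ n) * (1 + ε ^ (n - 1)) ^ ((1 : ℝ) / ((n : ℝ) - 1))) :=
      lt_mul_of_one_lt_right (by positivity) hkey
    _ = β * (1 - n * ε ^ n) *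
        (S ^ ((1 : ℝ) / ((n : ℝ) - 1)) * (1 + ε ^ (n - 1)) ^ ((1 : ℝ) / ((n : ℝ) - 1))) := by ring
    _ ≤ _ := by gcongr
end

section
/- Let n ≥ 3 and fix 0 < ε < 1. Let γ := {t·e₁ : ε/2 ≤ t ≤ 1} ⊆ ℝⁿ and for δ > 0 let Ω_δ := {x ∈ ℝⁿ : ε < ‖x‖ < 1 and dist(x, γ) > δ} and T_δ := {x ∈ ℝⁿ : ε < ‖x‖ < 1 and dist(x, γ) = δ}. Suppose δ₀ > 0, C > 0, and (u_δ)_{0<δ<δ₀} is a family of C^∞ functions ℝⁿ → ℝ with ∫_{Ω_δ} (u_δ² + ‖∇u_δ‖²) dx ≤ C for all δ ∈ (0, δ₀). Then lim_{δ → 0⁺} ∫_{T_δ} u_δ² dH^{n−1} = 0. -/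
open MeasureTheory Filter

/-- Along a segment, the square of a `C¹` function at the endpoint is controlled by its mean square
and the mean square of its gradient. -/
lemma sq_le_lintegral_ray {E : Type*} [NormedAddCommGroup E] [InnerProductSpace ℝ E]
    [CompleteSpace E] {f : E → ℝ} (hf : ContDiff ℝ 1 f) (x v : E) {a b : ℝ} (ha : 0 ≤ a)
    (hab : a ≤ b) :
    ENNReal.ofReal (b - a) * ENNReal.ofReal (f x ^ 2) ≤
      2 * (∫⁻ t in Set.Ioc a b, ENNReal.ofReal (f (x + t • v) ^ 2)) +
      ENNReal.ofReal (2 * (b - a) * b * ‖v‖ ^ 2) *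
        ∫⁻ t in Set.Ioc 0 b, ENNReal.ofReal (‖gradient f (x + t • v)‖ ^ 2) := by
  have hgc : Continuous (gradient f) :=
    (InnerProductSpace.toDual ℝ E).symm.continuous.comp (hf.continuous_fderiv one_ne_zero)
  have hray : Continuous fun t : ℝ => x + t • v := by fun_prop
  have hc1 : Continuous fun t : ℝ => f (x + t • v) := hf.continuous.comp hray
  have hc2 : Continuous fun t : ℝ => gradient f (x + t • v) := hgc.comp hray
  set φ : ℝ → ℝ := fun t => f (x + t • v) with hφ
  set ψ : ℝ → ℝ := fun t => inner ℝ (gradient f (x + t • v)) v with hψ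
  have hψc : Continuous ψ := hc2.inner continuous_const
  have hψ2 : Continuous fun s => ψ s ^ 2 := hψc.pow 2
  have hφ2 : Continuous fun s => φ s ^ 2 := hc1.pow 2
  have hg2 : Continuous fun s : ℝ => ‖gradient f (x + s • v)‖ ^ 2 := hc2.norm.pow 2
  have h2φ2 : Continuous fun s => 2 * φ s ^ 2 := continuous_const.mul hφ2
  have hd : ∀ t, HasDerivAt φ (ψ t) t := by
    intro t
    have h1 : HasFDerivAt f (fderiv ℝ f (x + t • v)) (x + t • v) :=
      (hf.differentiable one_ne_zero _).hasFDerivAt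
    have h2 : HasDerivAt (fun t : ℝ => x + t • v) v t := by
      simpa using ((hasDerivAt_id t).smul_const v).const_add x
    have h3 := h1.comp_hasDerivAt t h2
    have : ψ t = fderiv ℝ f (x + t • v) v := by
      simp [hψ, gradient]
    rw [this]; exact h3
  set D : ℝ := ∫ t in (0 : ℝ)..b, ‖gradient f (x + t • v)‖ ^ 2 with hD
  have hpt : ∀ t ∈ Set.Icc a b, f x ^ 2 ≤ 2 * φ t ^ 2 + 2 * b * ‖v‖ ^ 2 * D := by
    intro t ht
    have ht0 : 0 ≤ t := ha.trans ht.1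
    have h1 : ∫ s in (0 : ℝ)..t, ψ s = φ t - φ 0 :=
      intervalIntegral.integral_eq_sub_of_hasDerivAt (fun s _ => hd s)
        (hψc.intervalIntegrable _ _)
    set d := φ t - φ 0 with hdd
    have h2 : d ^ 2 ≤ t * ∫ s in (0 : ℝ)..t, ψ s ^ 2 := by
      rcases ht0.eq_or_lt with h0 | h0
      · subst h0; simp [hdd]
      · have h3 : ∫ s in (0 : ℝ)..t, (2 * (d / t)) * ψ s ≤
            ∫ s in (0 : ℝ)..t, (ψ s ^ 2 + (d / t) ^ 2) := by
          refine intervalIntegral.integral_mono_on ht0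
            ((continuous_const.mul hψc).intervalIntegrable _ _)
            ((hψ2.add continuous_const).intervalIntegrable _ _) ?_
          intro s _
          nlinarith [sq_nonneg (ψ s - d / t)]
        rw [intervalIntegral.integral_const_mul, h1,
          intervalIntegral.integral_add (hψ2.intervalIntegrable _ _)
            (continuous_const.intervalIntegrable _ _), intervalIntegral.integral_const] at h3
        have h4 : t * (2 * (d / t) * d) = 2 * d ^ 2 := by field_simp
        have h5 : t * ((t - 0) • (d / t) ^ 2) = d ^ 2 := by
          rw [smul_eq_mul]; field_simp; ring
        have h6 := mul_le_mul_of_nonneg_left h3 ht0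
        rw [h4, mul_add, h5] at h6
        linarith
    have h7 : ∫ s in (0 : ℝ)..t, ψ s ^ 2 ≤ ‖v‖ ^ 2 * D := by
      have h8 : ∫ s in (0 : ℝ)..t, ψ s ^ 2 ≤ ∫ s in (0 : ℝ)..b, ψ s ^ 2 :=
        intervalIntegral.integral_mono_interval le_rfl ht0 ht.2
          (Eventually.of_forall fun s => sq_nonneg _) (hψ2.intervalIntegrable _ _)
      refine h8.trans ?_
      rw [hD, ← intervalIntegral.integral_const_mul]
      refine intervalIntegral.integral_mono_on (ha.trans hab) (hψ2.intervalIntegrable _ _)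
        ((continuous_const.mul hg2).intervalIntegrable _ _) ?_
      intro s _
      have := abs_real_inner_le_norm (gradient f (x + s • v)) v
      calc ψ s ^ 2 = |ψ s| ^ 2 := (sq_abs _).symm
        _ ≤ (‖gradient f (x + s • v)‖ * ‖v‖) ^ 2 := by gcongr
        _ = _ := by ring
    have h9 : 0 ≤ ∫ s in (0 : ℝ)..t, ψ s ^ 2 :=
      intervalIntegral.integral_nonneg ht0 fun s _ => sq_nonneg _
    have h10 : d ^ 2 ≤ b * (‖v‖ ^ 2 * D) :=
      h2.trans (mul_le_mul ht.2 h7 h9 (ha.trans hab))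
    have h11 : f x = φ t - d := by simp [hdd, hφ]
    rw [h11]
    nlinarith [sq_nonneg (φ t + d)]
  have hmean : (b - a) * f x ^ 2 ≤
      2 * (∫ t in a..b, φ t ^ 2) + (2 * (b - a) * b * ‖v‖ ^ 2) * D := by
    have h1 : ∫ t in a..b, f x ^ 2 ≤ ∫ t in a..b, (2 * φ t ^ 2 + 2 * b * ‖v‖ ^ 2 * D) :=
      intervalIntegral.integral_mono_on hab (continuous_const.intervalIntegrable _ _)
        ((h2φ2.add continuous_const).intervalIntegrable _ _) hpt
    rw [intervalIntegral.integral_add (h2φ2.intervalIntegrable _ _)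
      (continuous_const.intervalIntegrable _ _), intervalIntegral.integral_const_mul,
      intervalIntegral.integral_const, intervalIntegral.integral_const, smul_eq_mul,
      smul_eq_mul] at h1
    linarith
  have hconv : ∀ (h : ℝ → ℝ) (c : ℝ), c ≤ b → Continuous h → (∀ t, 0 ≤ h t) →
      ENNReal.ofReal (∫ t in c..b, h t) = ∫⁻ t in Set.Ioc c b, ENNReal.ofReal (h t) := by
    intro h c hcb hh h0
    rw [intervalIntegral.integral_of_le hcb]
    exact ofReal_integral_eq_lintegral_ofReal (hh.integrableOn_Ioc) (Eventually.of_forall h0)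
  rw [← hconv _ a hab hφ2 (fun _ => sq_nonneg _),
    ← hconv _ 0 (ha.trans hab) hg2 (fun _ => sq_nonneg _),
    ← ENNReal.ofReal_mul (sub_nonneg.2 hab)]
  have hI : 0 ≤ ∫ t in a..b, φ t ^ 2 := intervalIntegral.integral_nonneg hab fun _ _ => sq_nonneg _
  have hb : 0 ≤ b := ha.trans hab
  have hba : 0 ≤ b - a := sub_nonneg.2 hab
  have hDn : 0 ≤ D := intervalIntegral.integral_nonneg hb fun _ _ => sq_nonneg _
  have h2 : (2 : ENNReal) = ENNReal.ofReal 2 := by simp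
  rw [h2, ← ENNReal.ofReal_mul (by norm_num), ← ENNReal.ofReal_mul (by positivity),
    ← ENNReal.ofReal_add (by positivity) (by positivity)]
  exact ENNReal.ofReal_le_ofReal hmean

/-- Integrating a function over all lines of direction `w` issued from a set which is thin in
the `j`-th coordinate gains the thickness of the set. -/
lemma lintegral_thin_lines_le {n : ℕ} (j : Fin n) (w : EuclideanSpace ℝ (Fin n)) (hw : w j = 1)
    (δ : ℝ) {A : Set (EuclideanSpace ℝ (Fin n))} (hA : MeasurableSet A)
    (hAj : ∀ x ∈ A, |x j| ≤ δ) {g : EuclideanSpace ℝ (Fin n) → ENNReal} (hg : Measurable g) :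
    ∫⁻ x in A, ∫⁻ t : ℝ, g (x + t • w) ≤ ENNReal.ofReal (2 * δ) * ∫⁻ x, g x := by
  have hm : Measurable fun p : EuclideanSpace ℝ (Fin n) × ℝ => g (p.1 + p.2 • w) :=
    hg.comp (by fun_prop)
  have hm2 : Measurable fun p : EuclideanSpace ℝ (Fin n) × ℝ =>
      A.indicator (fun _ => (1 : ENNReal)) (p.1 - p.2 • w) :=
    (measurable_const.indicator hA).comp (by fun_prop)
  calc ∫⁻ x in A, ∫⁻ t : ℝ, g (x + t • w)
      = ∫⁻ t : ℝ, ∫⁻ x in A, g (x + t • w) := lintegral_lintegral_swap hm.aemeasurable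
    _ = ∫⁻ t : ℝ, ∫⁻ y, A.indicator (fun _ => (1 : ENNReal)) (y - t • w) * g y := by
        refine lintegral_congr fun t => ?_
        rw [← lintegral_add_right_eq_self (μ := volume)
          (fun y => A.indicator (fun _ => (1 : ENNReal)) (y - t • w) * g y) (t • w),
          ← lintegral_indicator hA]
        refine lintegral_congr fun x => ?_
        by_cases hx : x ∈ A <;> simp [hx]
    _ = ∫⁻ y, ∫⁻ t : ℝ, A.indicator (fun _ => (1 : ENNReal)) (y - t • w) * g y :=
        (lintegral_lintegral_swap (hm2.mul (hg.comp measurable_fst)).aemeasurable).symm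
    _ ≤ ∫⁻ y, ENNReal.ofReal (2 * δ) * g y := by
        refine lintegral_mono fun y => ?_
        have hm3 : Measurable fun t : ℝ => A.indicator (fun _ => (1 : ENNReal)) (y - t • w) :=
          hm2.comp (by fun_prop : Measurable fun t : ℝ => (y, t))
        rw [lintegral_mul_const _ hm3]
        gcongr
        calc ∫⁻ t : ℝ, A.indicator (fun _ => (1 : ENNReal)) (y - t • w)
            ≤ ∫⁻ t : ℝ, (Set.Icc (y j - δ) (y j + δ)).indicator (fun _ => 1) t := by
              refine lintegral_mono fun t => ?_
              by_cases h : y - t • w ∈ A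
              · have h1 := abs_le.1 (hAj _ h)
                simp only [PiLp.sub_apply, PiLp.smul_apply, hw, smul_eq_mul, mul_one] at h1
                have h2 : t ∈ Set.Icc (y j - δ) (y j + δ) := ⟨by linarith, by linarith⟩
                simp [h2, h]
              · simp [h]
          _ = ENNReal.ofReal (2 * δ) := by
              rw [lintegral_indicator measurableSet_Icc]
              simp only [lintegral_const, one_mul, Measure.restrict_apply MeasurableSet.univ,
                Set.univ_inter, Real.volume_Icc]
              congr 1; ring
    _ = _ := lintegral_const_mul _ hg

/-- A set which is a Lipschitz graph in the splitting `e` has Hausdorff measure controlled by the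
projection along the line direction, so integrating over all lines issued from it is controlled
by the volume integral. -/
lemma exists_lintegral_graph_lines_le {n : ℕ} {ι : Type*} [Fintype ι]
    (e : ((ι → ℝ) × ℝ) ≃L[ℝ] EuclideanSpace ℝ (Fin n)) (L : NNReal) :
    ∃ K : NNReal, ∀ (S : Set (EuclideanSpace ℝ (Fin n)))
      (g : EuclideanSpace ℝ (Fin n) → ENNReal), Measurable g →
      (∀ x ∈ S, ∀ y ∈ S, dist (e.symm x).2 (e.symm y).2 ≤ L * dist (e.symm x).1 (e.symm y).1) →
      ∫⁻ x in S, (∫⁻ t : ℝ, g (x + t • e (0, 1))) ∂μH[(Fintype.card ι : ℝ)] ≤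
        K * ∫⁻ x, g x := by
  set μ' : Measure (EuclideanSpace ℝ (Fin n)) := Measure.map e (volume.prod volume) with hμ'
  have : μ'.IsAddHaarMeasure := e.isAddHaarMeasure_map _
  have hscale := Measure.isAddLeftInvariant_eq_smul μ'
    (volume : Measure (EuclideanSpace ℝ (Fin n)))
  set c := μ'.addHaarScalarFactor (volume : Measure (EuclideanSpace ℝ (Fin n)))
  set M : NNReal := ‖(e : ((ι → ℝ) × ℝ) →L[ℝ] EuclideanSpace ℝ (Fin n))‖₊ * max 1 L with hM
  refine ⟨M ^ Fintype.card ι * c, fun S g hg hS => ?_⟩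
  have hinj : ∀ x ∈ S, ∀ y ∈ S, (e.symm x).1 = (e.symm y).1 → x = y := by
    intro x hx y hy h
    have h1 := hS x hx y hy
    rw [h, dist_self, mul_zero] at h1
    exact e.symm.injective (Prod.ext h (dist_le_zero.1 h1))
  classical
  let h₀ : (ι → ℝ) → ℝ := fun y =>
    if h : ∃ x ∈ S, (e.symm x).1 = y then (e.symm h.choose).2 else 0
  have hh₀ : ∀ x ∈ S, h₀ (e.symm x).1 = (e.symm x).2 := by
    intro x hx
    have h : ∃ z ∈ S, (e.symm z).1 = (e.symm x).1 := ⟨x, hx, rfl⟩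
    have h2 : h.choose = x := hinj _ h.choose_spec.1 _ hx h.choose_spec.2
    simp only [h₀, dif_pos h, h2]
  have hlip : LipschitzOnWith L h₀ ((fun x => (e.symm x).1) '' S) := by
    refine LipschitzOnWith.of_dist_le_mul ?_
    rintro _ ⟨x, hx, rfl⟩ _ ⟨y, hy, rfl⟩
    simp only [hh₀ x hx, hh₀ y hy]
    exact hS x hx y hy
  obtain ⟨f, hf, hfeq⟩ := hlip.extend_real
  let F : (ι → ℝ) → EuclideanSpace ℝ (Fin n) := fun y => e (y, f y)
  have hF : LipschitzWith M F :=
    (ContinuousLinearMap.lipschitz (e : ((ι → ℝ) × ℝ) →L[ℝ] EuclideanSpace ℝ (Fin n))).comp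
      (LipschitzWith.id.prodMk hf)
  have hFS : ∀ x ∈ S, F (e.symm x).1 = x := by
    intro x hx
    have h1 : f (e.symm x).1 = (e.symm x).2 := by
      rw [← hfeq ⟨x, hx, rfl⟩, hh₀ x hx]
    simp only [F, h1]
    exact e.apply_symm_apply x
  have hle : (μH[(Fintype.card ι : ℝ)]).restrict S ≤
      ((M : ENNReal) ^ Fintype.card ι) • Measure.map F volume := by
    refine Measure.le_iff.2 fun B hB => ?_
    rw [Measure.restrict_apply hB, Measure.smul_apply, smul_eq_mul,
      Measure.map_apply hF.continuous.measurable hB, ← hausdorffMeasure_pi_real]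
    calc μH[(Fintype.card ι : ℝ)] (B ∩ S) ≤ μH[(Fintype.card ι : ℝ)] (F '' (F ⁻¹' B)) := by
          refine measure_mono ?_
          rintro x ⟨hxB, hxS⟩
          exact ⟨(e.symm x).1, by simpa [hFS x hxS] using hxB, hFS x hxS⟩
      _ ≤ _ := by
          have := hF.hausdorffMeasure_image_le (d := (Fintype.card ι : ℝ)) (by positivity) (F ⁻¹' B)
          rwa [ENNReal.rpow_natCast] at this
  have hm : Measurable fun p : EuclideanSpace ℝ (Fin n) × ℝ => g (p.1 + p.2 • e (0, 1)) :=
    hg.comp (by fun_prop)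
  calc ∫⁻ x in S, (∫⁻ t : ℝ, g (x + t • e (0, 1))) ∂μH[(Fintype.card ι : ℝ)]
      ≤ ∫⁻ x, (∫⁻ t : ℝ, g (x + t • e (0, 1))) ∂(((M : ENNReal) ^ Fintype.card ι) •
          Measure.map F volume) := lintegral_mono' hle le_rfl
    _ = (M : ENNReal) ^ Fintype.card ι * ∫⁻ y, ∫⁻ t : ℝ, g (F y + t • e (0, 1)) := by
        rw [lintegral_smul_measure, lintegral_map hm.lintegral_prod_right hF.continuous.measurable,
          smul_eq_mul]
    _ = (M : ENNReal) ^ Fintype.card ι * ∫⁻ y, ∫⁻ t : ℝ, g (e (y, t)) := by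
        congr 1
        refine lintegral_congr fun y => ?_
        rw [← lintegral_add_left_eq_self (fun t => g (e (y, t))) (f y)]
        refine lintegral_congr fun t => ?_
        simp only [F]
        rw [← map_smul, ← map_add]
        simp
    _ = (M : ENNReal) ^ Fintype.card ι * ∫⁻ p : (ι → ℝ) × ℝ, g (e p) := by
        have hge : Measurable fun p : (ι → ℝ) × ℝ => g (e p) := hg.comp e.continuous.measurable
        rw [Measure.volume_eq_prod, lintegral_prod _ hge.aemeasurable]
    _ = (M : ENNReal) ^ Fintype.card ι * ∫⁻ x, g x ∂μ' := by
        rw [hμ', lintegral_map hg e.continuous.measurable, Measure.volume_eq_prod]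
    _ = _ := by
        rw [hscale, lintegral_smul_measure]
        push_cast
        rw [ENNReal.smul_def, smul_eq_mul, mul_assoc]

/-- If integrating over lines of direction `v` issued from `S` is controlled by the volume
integral, then the `L²` mass of a `C¹` function on `S` is controlled by its energy on the
segments of direction `v` issued from `S`. -/
lemma lintegral_sq_le_of_lines {n : ℕ} {ν : Measure (EuclideanSpace ℝ (Fin n))} {K : ENNReal}
    {S B₁ B₂ : Set (EuclideanSpace ℝ (Fin n))} {v : EuclideanSpace ℝ (Fin n)}
    (hS : MeasurableSet S) (hB₁ : MeasurableSet B₁) (hB₂ : MeasurableSet B₂)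
    (hK : ∀ g : EuclideanSpace ℝ (Fin n) → ENNReal, Measurable g →
      ∫⁻ x in S, (∫⁻ t : ℝ, g (x + t • v)) ∂ν ≤ K * ∫⁻ x, g x)
    {a b : ℝ} (ha : 0 ≤ a) (hab : a ≤ b)
    (h₁ : ∀ x ∈ S, ∀ t ∈ Set.Ioc a b, x + t • v ∈ B₁)
    (h₂ : ∀ x ∈ S, ∀ t ∈ Set.Ioc 0 b, x + t • v ∈ B₂)
    {f : EuclideanSpace ℝ (Fin n) → ℝ} (hf : ContDiff ℝ 1 f) :
    ENNReal.ofReal (b - a) * ∫⁻ x in S, ENNReal.ofReal (f x ^ 2) ∂ν ≤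
      2 * (K * ∫⁻ x in B₁, ENNReal.ofReal (f x ^ 2)) +
      ENNReal.ofReal (2 * (b - a) * b * ‖v‖ ^ 2) *
        (K * ∫⁻ x in B₂, ENNReal.ofReal (‖gradient f x‖ ^ 2)) := by
  have hgc : Continuous (gradient f) :=
    (InnerProductSpace.toDual ℝ _).symm.continuous.comp (hf.continuous_fderiv one_ne_zero)
  have hm₁ : Measurable (B₁.indicator fun x => ENNReal.ofReal (f x ^ 2)) :=
    ((hf.continuous.pow 2).measurable.ennreal_ofReal).indicator hB₁
  have hm₂ : Measurable (B₂.indicator fun x => ENNReal.ofReal (‖gradient f x‖ ^ 2)) :=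
    ((hgc.norm.pow 2).measurable.ennreal_ofReal).indicator hB₂
  have key : ∀ (B : Set (EuclideanSpace ℝ (Fin n))) (g : EuclideanSpace ℝ (Fin n) → ENNReal)
      (c : ℝ), (∀ x ∈ S, ∀ t ∈ Set.Ioc c b, x + t • v ∈ B) → ∀ x ∈ S,
      ∫⁻ t in Set.Ioc c b, g (x + t • v) ≤ ∫⁻ t : ℝ, B.indicator g (x + t • v) := by
    intro B g c h x hx
    calc ∫⁻ t in Set.Ioc c b, g (x + t • v)
        = ∫⁻ t in Set.Ioc c b, B.indicator g (x + t • v) := by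
          refine setLIntegral_congr_fun measurableSet_Ioc fun t ht => ?_
          simp [h x hx t ht]
      _ ≤ _ := setLIntegral_le_lintegral _ _
  have hmeas : ∀ g : EuclideanSpace ℝ (Fin n) → ENNReal, Measurable g →
      Measurable fun x => ∫⁻ t : ℝ, g (x + t • v) := by
    intro g hg
    have : Measurable fun p : EuclideanSpace ℝ (Fin n) × ℝ => g (p.1 + p.2 • v) :=
      hg.comp (by fun_prop)
    exact this.lintegral_prod_right
  rw [← lintegral_indicator hB₁, ← lintegral_indicator hB₂,
    ← lintegral_const_mul' _ _ ENNReal.ofReal_ne_top]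
  calc ∫⁻ x in S, ENNReal.ofReal (b - a) * ENNReal.ofReal (f x ^ 2) ∂ν
      ≤ ∫⁻ x in S, (2 * (∫⁻ t : ℝ, B₁.indicator (fun x => ENNReal.ofReal (f x ^ 2)) (x + t • v)) +
          ENNReal.ofReal (2 * (b - a) * b * ‖v‖ ^ 2) *
          ∫⁻ t : ℝ, B₂.indicator (fun x => ENNReal.ofReal (‖gradient f x‖ ^ 2)) (x + t • v)) ∂ν := by
        refine setLIntegral_mono' hS fun x hx => ?_
        refine (sq_le_lintegral_ray hf x v ha hab).trans ?_
        exact add_le_add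
          (mul_le_mul_right (key B₁ (fun x => ENNReal.ofReal (f x ^ 2)) a h₁ x hx) _)
          (mul_le_mul_right
            (key B₂ (fun x => ENNReal.ofReal (‖gradient f x‖ ^ 2)) 0 h₂ x hx) _)
    _ = 2 * (∫⁻ x in S, (∫⁻ t : ℝ,
            B₁.indicator (fun x => ENNReal.ofReal (f x ^ 2)) (x + t • v)) ∂ν) +
          ENNReal.ofReal (2 * (b - a) * b * ‖v‖ ^ 2) * ∫⁻ x in S, (∫⁻ t : ℝ,
            B₂.indicator (fun x => ENNReal.ofReal (‖gradient f x‖ ^ 2)) (x + t • v)) ∂ν := by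
        rw [lintegral_add_left ((hmeas _ hm₁).const_mul _), lintegral_const_mul _ (hmeas _ hm₁),
          lintegral_const_mul _ (hmeas _ hm₂)]
    _ ≤ _ := by
        gcongr
        · exact hK _ hm₁
        · exact hK _ hm₂

/-- The splitting of Euclidean space into the coordinates other than `i` and the line spanned by
a vector `v` transversal to the hyperplane of these coordinates. -/
noncomputable def lineSplitting {n : ℕ} (i : Fin n) (v : EuclideanSpace ℝ (Fin n))
    (hv : v i ≠ 0) : (({k : Fin n // k ≠ i} → ℝ) × ℝ) ≃L[ℝ] EuclideanSpace ℝ (Fin n) :=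
  LinearEquiv.toContinuousLinearEquiv
    { toFun := fun p => WithLp.toLp 2 fun k =>
        (if h : k ≠ i then p.1 ⟨k, h⟩ else 0) + p.2 * v k
      invFun := fun x => (fun k => x k - x i / v i * v k, x i / v i)
      map_add' := by
        intro p q
        ext k
        by_cases h : k = i
        · simp [h]; ring
        · simp [h]; ring
      map_smul' := by
        intro c p
        ext k
        by_cases h : k = i
        · simp [h]; ring
        · simp [h]; ring
      left_inv := by
        rintro ⟨p, t⟩
        ext k
        · have := k.2
          simp [hv, this]
        · simp [hv]
      right_inv := by
        intro x
        ext k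
        by_cases h : k = i
        · subst h; simp [hv]
        · simp [h] }

lemma lineSplitting_symm_fst {n : ℕ} (i : Fin n) (v : EuclideanSpace ℝ (Fin n))
    (hv : v i ≠ 0) (x : EuclideanSpace ℝ (Fin n)) (k : {k : Fin n // k ≠ i}) :
    ((lineSplitting i v hv).symm x).1 k = x k - x i / v i * v k := rfl

lemma lineSplitting_symm_snd {n : ℕ} (i : Fin n) (v : EuclideanSpace ℝ (Fin n))
    (hv : v i ≠ 0) (x : EuclideanSpace ℝ (Fin n)) :
    ((lineSplitting i v hv).symm x).2 = x i / v i := rfl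

lemma lineSplitting_zero_one {n : ℕ} (i : Fin n) (v : EuclideanSpace ℝ (Fin n))
    (hv : v i ≠ 0) : lineSplitting i v hv (0, 1) = v := by
  ext k
  by_cases h : k = i <;> simp [lineSplitting, h]

/-- Quantitative trace inequality on a Lipschitz graph `S` transversal to `v`, such that
translating `S` along `v` lands in a set `A` which is thin in the `j`-th coordinate. -/
lemma exists_lintegral_sq_graph_le {n : ℕ} (i j : Fin n) (v w : EuclideanSpace ℝ (Fin n))
    (hv : v i ≠ 0) (hw : w j = 1) :
    ∃ K : NNReal, ∀ (R δ : ℝ), 0 < R → 0 ≤ δ → ∀ S A Ω : Set (EuclideanSpace ℝ (Fin n)),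
      MeasurableSet S → MeasurableSet A → MeasurableSet Ω →
      (∀ x ∈ S, ∀ y ∈ S, |x i - y i| ≤ ∑ k with v k = 0, |x k - y k|) →
      (∀ x ∈ S, ∀ t ∈ Set.Ioc 0 R, x + t • v ∈ Ω) →
      (∀ x ∈ S, ∀ t ∈ Set.Ioc (R / 2) R, x + t • v ∈ A) →
      (∀ x ∈ A, |x j| ≤ δ) →
      (∀ x ∈ A, ∀ t ∈ Set.Ioc 0 R, x + t • w ∈ Ω) →
      ∀ f : EuclideanSpace ℝ (Fin n) → ℝ, ContDiff ℝ 1 f →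
      ∫⁻ x in S, ENNReal.ofReal (f x ^ 2) ∂μH[(n : ℝ) - 1] ≤
        K * ENNReal.ofReal (16 * δ / R ^ 2 + 16 * δ * ‖w‖ ^ 2 + 2 * R * ‖v‖ ^ 2) *
          ∫⁻ x in Ω, ENNReal.ofReal (f x ^ 2 + ‖gradient f x‖ ^ 2) := by
  obtain ⟨K, hK⟩ := exists_lintegral_graph_lines_le (lineSplitting i v hv)
    ((n : NNReal) * ‖(v i)⁻¹‖₊)
  have hcard : ((Fintype.card {k : Fin n // k ≠ i} : ℕ) : ℝ) = (n : ℝ) - 1 := by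
    have h1 : Fintype.card {k : Fin n // k ≠ i} = n - 1 := by simp
    rw [h1, Nat.cast_sub (by have := i.pos; omega)]; simp
  rw [hcard, lineSplitting_zero_one] at hK
  refine ⟨K, fun R δ hR hδ S A Ω hS hA hΩ hgraph hSΩ hSA hAj hAΩ f hf => ?_⟩
  set I := ∫⁻ x in Ω, ENNReal.ofReal (f x ^ 2 + ‖gradient f x‖ ^ 2) with hI
  have hU : ∫⁻ x in Ω, ENNReal.ofReal (f x ^ 2) ≤ I :=
    lintegral_mono fun x => ENNReal.ofReal_le_ofReal (le_add_of_nonneg_right (sq_nonneg _))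
  have hG : ∫⁻ x in Ω, ENNReal.ofReal (‖gradient f x‖ ^ 2) ≤ I :=
    lintegral_mono fun x => ENNReal.ofReal_le_ofReal (le_add_of_nonneg_left (sq_nonneg _))
  have hdist : ∀ x ∈ S, ∀ y ∈ S,
      dist ((lineSplitting i v hv).symm x).2 ((lineSplitting i v hv).symm y).2 ≤
        ((n : NNReal) * ‖(v i)⁻¹‖₊ : NNReal) *
        dist ((lineSplitting i v hv).symm x).1 ((lineSplitting i v hv).symm y).1 := by
    intro x hx y hy
    set d := dist ((lineSplitting i v hv).symm x).1 ((lineSplitting i v hv).symm y).1 with hd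
    have h1 : ∀ k ∈ Finset.univ.filter (fun k => v k = 0), |x k - y k| ≤ d := by
      intro k hk
      have hk0 : v k = 0 := by simpa using hk
      have hki : k ≠ i := by rintro rfl; exact hv hk0
      have h2 := dist_le_pi_dist ((lineSplitting i v hv).symm x).1
        ((lineSplitting i v hv).symm y).1 ⟨k, hki⟩
      simpa [lineSplitting_symm_fst, hk0, Real.dist_eq, ← hd] using h2
    have h3 : |x i - y i| ≤ n * d := by
      refine (hgraph x hx y hy).trans ((Finset.sum_le_card_nsmul _ _ _ h1).trans ?_)
      rw [nsmul_eq_mul]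
      gcongr
      · exact_mod_cast (Finset.card_le_univ _).trans (by simp)
    have h4 : dist ((lineSplitting i v hv).symm x).2 ((lineSplitting i v hv).symm y).2 =
        |(v i)⁻¹| * |x i - y i| := by
      rw [lineSplitting_symm_snd, lineSplitting_symm_snd, Real.dist_eq, ← abs_mul]
      congr 1; simp only [div_eq_mul_inv]; ring
    rw [h4]
    push_cast
    rw [Real.norm_eq_abs]
    calc |(v i)⁻¹| * |x i - y i| ≤ |(v i)⁻¹| * (n * d) := by gcongr
      _ = _ := by ring
  have hfirst := lintegral_sq_le_of_lines hS hA hΩ (fun g hg => hK S g hg hdist)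
    (by positivity : (0 : ℝ) ≤ R / 2) (by linarith) hSA hSΩ hf
  have hsecond := lintegral_sq_le_of_lines hA hΩ hΩ
    (fun g hg => lintegral_thin_lines_le j w hw δ hA hAj hg) le_rfl hR.le hAΩ hAΩ hf
  have h2 : ∀ y : ENNReal, 2 * y = ENNReal.ofReal 2 * y := by simp
  have hW : ∫⁻ x in A, ENNReal.ofReal (f x ^ 2) ≤
      ENNReal.ofReal ((4 * δ + 4 * R ^ 2 * ‖w‖ ^ 2 * δ) / R) * I := by
    calc ∫⁻ x in A, ENNReal.ofReal (f x ^ 2)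
        = ENNReal.ofReal R⁻¹ *
            (ENNReal.ofReal (R - 0) * ∫⁻ x in A, ENNReal.ofReal (f x ^ 2)) := by
          rw [← mul_assoc, ← ENNReal.ofReal_mul (by positivity)]
          simp [hR.ne']
      _ ≤ ENNReal.ofReal R⁻¹ * (2 * (ENNReal.ofReal (2 * δ) * I) +
            ENNReal.ofReal (2 * (R - 0) * R * ‖w‖ ^ 2) * (ENNReal.ofReal (2 * δ) * I)) := by
          gcongr
          refine hsecond.trans ?_
          gcongr
      _ = _ := by
          rw [h2, ← mul_assoc, ← mul_assoc, ← add_mul, ← mul_assoc, sub_zero,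
            ← ENNReal.ofReal_mul (by positivity), ← ENNReal.ofReal_mul (by positivity),
            ← ENNReal.ofReal_add (by positivity) (by positivity),
            ← ENNReal.ofReal_mul (by positivity)]
          congr 2
          field_simp; ring
  calc ∫⁻ x in S, ENNReal.ofReal (f x ^ 2) ∂μH[(n : ℝ) - 1]
      = ENNReal.ofReal (2 / R) * (ENNReal.ofReal (R - R / 2) *
          ∫⁻ x in S, ENNReal.ofReal (f x ^ 2) ∂μH[(n : ℝ) - 1]) := by
        rw [← mul_assoc, ← ENNReal.ofReal_mul (by positivity)]
        have : 2 / R * (R - R / 2) = 1 := by field_simp; ring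
        rw [this]; simp
    _ ≤ ENNReal.ofReal (2 / R) * (2 * (K *
          (ENNReal.ofReal ((4 * δ + 4 * R ^ 2 * ‖w‖ ^ 2 * δ) / R) * I)) +
          ENNReal.ofReal (2 * (R - R / 2) * R * ‖v‖ ^ 2) * (K * I)) := by
        gcongr
        refine hfirst.trans ?_
        gcongr
    _ = K * (ENNReal.ofReal (2 / R) *
          (ENNReal.ofReal 2 * ENNReal.ofReal ((4 * δ + 4 * R ^ 2 * ‖w‖ ^ 2 * δ) / R) +
          ENNReal.ofReal (2 * (R - R / 2) * R * ‖v‖ ^ 2))) * I := by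
        rw [h2]; ring
    _ = _ := by
        have h3 : 0 ≤ 2 * (R - R / 2) * R * ‖v‖ ^ 2 := by
          have : 2 * (R - R / 2) * R * ‖v‖ ^ 2 = R ^ 2 * ‖v‖ ^ 2 := by ring
          rw [this]; positivity
        rw [← ENNReal.ofReal_mul (by positivity), ← ENNReal.ofReal_add (by positivity) h3,
          ← ENNReal.ofReal_mul (by positivity)]
        congr 3
        field_simp; ring

/-- The part of the cylinder of radius `δ` around the `z`-axis inside `D` where `σ * x i` is the
largest transversal coordinate in absolute value. -/
def cylinderPiece {n : ℕ} (z i : Fin n) (σ δ : ℝ) (D : Set (EuclideanSpace ℝ (Fin n))) :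
    Set (EuclideanSpace ℝ (Fin n)) :=
  {x | x ∈ D ∧ ∑ k ∈ Finset.univ.erase z, x k ^ 2 = δ ^ 2 ∧ 0 < σ * x i ∧
    ∀ k, k ≠ z → |x k| ≤ σ * x i}

lemma measurableSet_cylinderPiece {n : ℕ} (z i : Fin n) (σ δ : ℝ)
    {D : Set (EuclideanSpace ℝ (Fin n))} (hD : MeasurableSet D) :
    MeasurableSet (cylinderPiece z i σ δ D) := by
  have h₁ : IsClosed {x : EuclideanSpace ℝ (Fin n) |
      ∑ k ∈ Finset.univ.erase z, x k ^ 2 = δ ^ 2} :=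
    isClosed_eq (by fun_prop) continuous_const
  have h₂ : IsOpen {x : EuclideanSpace ℝ (Fin n) | 0 < σ * x i} :=
    isOpen_lt continuous_const (by fun_prop)
  have h₃ : IsClosed {x : EuclideanSpace ℝ (Fin n) | ∀ k, k ≠ z → |x k| ≤ σ * x i} := by
    simp only [Set.ofPred_forall]
    exact isClosed_iInter fun k => isClosed_iInter fun _ =>
      isClosed_le (by fun_prop) (by fun_prop)
  exact hD.inter (h₁.measurableSet.inter (h₂.measurableSet.inter h₃.measurableSet))

lemma abs_sub_le_of_mem_cylinderPiece {n : ℕ} {z i : Fin n} (hiz : i ≠ z) {σ δ : ℝ}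
    (hσ : σ ^ 2 = 1) {D : Set (EuclideanSpace ℝ (Fin n))} {x y : EuclideanSpace ℝ (Fin n)}
    (hx : x ∈ cylinderPiece z i σ δ D) (hy : y ∈ cylinderPiece z i σ δ D) :
    |x i - y i| ≤ ∑ k ∈ (Finset.univ.erase z).erase i, |x k - y k| := by
  obtain ⟨-, hx1, hx2, hx3⟩ := hx
  obtain ⟨-, hy1, hy2, hy3⟩ := hy
  have hi : i ∈ Finset.univ.erase z := by simp [hiz]
  rw [← Finset.add_sum_erase _ _ hi] at hx1 hy1
  have hpos : 0 < σ * x i + σ * y i := by positivity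
  have habsσ : |σ| = 1 := by
    rw [← sq_eq_sq₀ (abs_nonneg _) zero_le_one, sq_abs, hσ, one_pow]
  have h1 : (x i - y i) * (x i + y i) =
      -∑ k ∈ (Finset.univ.erase z).erase i, (x k - y k) * (x k + y k) := by
    have : ∑ k ∈ (Finset.univ.erase z).erase i, (x k - y k) * (x k + y k) =
        ∑ k ∈ (Finset.univ.erase z).erase i, x k ^ 2 -
        ∑ k ∈ (Finset.univ.erase z).erase i, y k ^ 2 := by
      rw [← Finset.sum_sub_distrib]
      exact Finset.sum_congr rfl fun k _ => by ring
    rw [this]; linarith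
  have h2 : |x i + y i| = σ * x i + σ * y i := by
    rw [← abs_of_pos hpos, ← mul_add, abs_mul, habsσ, one_mul]
  have h3 : |x i - y i| * (σ * x i + σ * y i) ≤
      (∑ k ∈ (Finset.univ.erase z).erase i, |x k - y k|) * (σ * x i + σ * y i) := by
    rw [← h2, ← abs_mul, h1, abs_neg, h2, Finset.sum_mul]
    refine (Finset.abs_sum_le_sum_abs _ _).trans (Finset.sum_le_sum fun k hk => ?_)
    rw [abs_mul]
    have hkz : k ≠ z := by simp at hk; exact hk.2
    gcongr
    exact (abs_add_le _ _).trans (add_le_add (hx3 k hkz) (hy3 k hkz))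
  exact le_of_mul_le_mul_right h3 hpos

/-- Trace inequality on a cylinder piece, for regions stable under the relevant translations. -/
lemma exists_lintegral_sq_cylinderPiece_le {n : ℕ} {z i j : Fin n} (hiz : i ≠ z) (hjz : j ≠ z)
    (hji : j ≠ i) {σ a : ℝ} (hσ : σ ^ 2 = 1) (ha : a ^ 2 = 1) :
    ∃ K : NNReal, ∀ (R δ : ℝ), 0 < δ → 2 * δ < R → ∀ D₀ D₁ D₂ : Set (EuclideanSpace ℝ (Fin n)),
      MeasurableSet D₀ → MeasurableSet D₁ → MeasurableSet D₂ →
      (∀ x ∈ D₀, |x i| ≤ δ → ∀ t ∈ Set.Ioc 0 R,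
        x + t • (EuclideanSpace.single i σ + EuclideanSpace.single z a) ∈ D₁) →
      (∀ x ∈ D₁, |x j| ≤ δ → ∀ t ∈ Set.Ioc 0 R,
        x + t • (EuclideanSpace.single j 1 + EuclideanSpace.single z a) ∈ D₂) →
      D₁ ⊆ D₂ →
      ∀ f : EuclideanSpace ℝ (Fin n) → ℝ, ContDiff ℝ 1 f →
      ∫⁻ x in cylinderPiece z i σ δ D₀, ENNReal.ofReal (f x ^ 2) ∂μH[(n : ℝ) - 1] ≤
        K * ENNReal.ofReal (16 * δ / R ^ 2 + 64 * δ + 8 * R) *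
          ∫⁻ x in {x | x ∈ D₂ ∧ δ ^ 2 < ∑ k ∈ Finset.univ.erase z, x k ^ 2},
            ENNReal.ofReal (f x ^ 2 + ‖gradient f x‖ ^ 2) := by
  set v : EuclideanSpace ℝ (Fin n) :=
    EuclideanSpace.single i σ + EuclideanSpace.single z a with hv
  set w : EuclideanSpace ℝ (Fin n) :=
    EuclideanSpace.single j 1 + EuclideanSpace.single z a with hw
  have hσ0 : σ ≠ 0 := by rintro rfl; norm_num at hσ
  have ha0 : a ≠ 0 := by rintro rfl; norm_num at ha
  have habs : ∀ s : ℝ, s ^ 2 = 1 → |s| = 1 := fun s hs => by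
    rw [← sq_eq_sq₀ (abs_nonneg _) zero_le_one, sq_abs, hs, one_pow]
  have hvi : v i = σ := by simp [hv, hiz]
  have hvk : ∀ k, k ≠ z → k ≠ i → v k = 0 := fun k h1 h2 => by simp [hv, h1, h2]
  have hvz : v z = a := by simp [hv, hiz.symm]
  have hwj : w j = 1 := by simp [hw, hjz]
  have hwi : w i = 0 := by simp [hw, hiz, hji.symm]
  have hvn : ‖v‖ ^ 2 ≤ 4 := by
    have h1 : ‖v‖ ≤ 2 := by
      refine (norm_add_le _ _).trans ?_
      rw [PiLp.norm_single, PiLp.norm_single, Real.norm_eq_abs,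
        Real.norm_eq_abs, habs σ hσ, habs a ha]
      norm_num
    nlinarith [norm_nonneg v]
  have hwn : ‖w‖ ^ 2 ≤ 4 := by
    have h1 : ‖w‖ ≤ 2 := by
      refine (norm_add_le _ _).trans ?_
      rw [PiLp.norm_single, PiLp.norm_single, Real.norm_eq_abs,
        Real.norm_eq_abs, abs_one, habs a ha]
      norm_num
    nlinarith [norm_nonneg w]
  have hfilter : Finset.univ.filter (fun k => v k = 0) = (Finset.univ.erase z).erase i := by
    ext k
    simp only [Finset.mem_filter, Finset.mem_univ, true_and, Finset.mem_erase, and_true]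
    constructor
    · intro h
      constructor
      · rintro rfl; exact hσ0 (hvi ▸ h)
      · rintro rfl; exact ha0 (hvz ▸ h)
    · rintro ⟨h1, h2⟩; exact hvk k h2 h1
  obtain ⟨K, hK⟩ := exists_lintegral_sq_graph_le i j v w (by rwa [hvi]) hwj
  refine ⟨K, fun R δ hδ hδR D₀ D₁ D₂ hD₀ hD₁ hD₂ h01 h12 hsub f hf => ?_⟩
  have hR : 0 < R := by linarith
  have hle : ∀ x ∈ cylinderPiece z i σ δ D₀, ∀ k, k ≠ z → |x k| ≤ δ := by
    rintro x ⟨-, hN, -, -⟩ k hk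
    refine abs_le_of_sq_le_sq ?_ hδ.le
    rw [← hN]
    exact Finset.single_le_sum (f := fun k => x k ^ 2) (fun _ _ => sq_nonneg _) (by simp [hk])
  have hclosed : IsClosed {x : EuclideanSpace ℝ (Fin n) | |x j| ≤ δ} :=
    isClosed_le (by fun_prop) continuous_const
  have hopen : IsOpen {x : EuclideanSpace ℝ (Fin n) | δ < |x i|} :=
    isOpen_lt continuous_const (by fun_prop)
  have hout : IsOpen {x : EuclideanSpace ℝ (Fin n) |
      δ ^ 2 < ∑ k ∈ Finset.univ.erase z, x k ^ 2} :=
    isOpen_lt continuous_const (by fun_prop)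
  have hmain := hK R δ hR hδ.le (cylinderPiece z i σ δ D₀) {x | x ∈ D₁ ∧ |x j| ≤ δ ∧ δ < |x i|}
    {x | x ∈ D₂ ∧ δ ^ 2 < ∑ k ∈ Finset.univ.erase z, x k ^ 2}
    (measurableSet_cylinderPiece z i σ δ hD₀)
    (hD₁.inter (hclosed.measurableSet.inter hopen.measurableSet))
    (hD₂.inter hout.measurableSet)
    (by
      intro x hx y hy
      rw [hfilter]
      exact abs_sub_le_of_mem_cylinderPiece hiz hσ hx hy)
    (by
      intro x hx t ht
      refine ⟨hsub (h01 x hx.1 (hle x hx i hiz) t ht), ?_⟩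
      rw [← hx.2.1]
      have hcoord : (x i + t * σ) ^ 2 = x i ^ 2 + 2 * t * (σ * x i) + t ^ 2 * σ ^ 2 := by ring
      have hx2 := hx.2.2.1
      have ht0 := ht.1
      have hlt : x i ^ 2 < (x i + t * σ) ^ 2 := by
        rw [hcoord, hσ]; nlinarith [mul_pos ht0 hx2]
      refine Finset.sum_lt_sum (fun k hk => ?_) ⟨i, by simp [hiz], by simpa [hvi] using hlt⟩
      by_cases hki : k = i
      · subst hki; simpa [hvi] using hlt.le
      · simp [hvk k (Finset.ne_of_mem_erase hk) hki])
    (by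
      intro x hx t ht
      have ht0 : t ∈ Set.Ioc 0 R := ⟨by linarith [ht.1], ht.2⟩
      refine ⟨h01 x hx.1 (hle x hx i hiz) t ht0, ?_, ?_⟩
      · simpa [hvk j hjz hji] using hle x hx j hjz
      · have h1 : σ * (x i + t * σ) = σ * x i + t * σ ^ 2 := by ring
        have h2 : |x i + t * σ| = |σ * (x i + t * σ)| := by rw [abs_mul, habs σ hσ, one_mul]
        have h3 := le_abs_self (σ * (x i + t * σ))
        rw [← h2, h1, hσ] at h3
        have h4 : δ < |x i + t * σ| := by linarith [hx.2.2.1, ht.1]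
        simpa [hvi] using h4)
    (fun x hx => hx.2.1)
    (by
      intro x hx t ht
      refine ⟨h12 x hx.1 hx.2.1 t ht, ?_⟩
      have h1 : δ ^ 2 < x i ^ 2 := by
        rw [← sq_abs (x i)]
        exact pow_lt_pow_left₀ hx.2.2 hδ.le two_ne_zero
      have h2 := Finset.single_le_sum (f := fun k => (x + t • w) k ^ 2)
        (s := Finset.univ.erase z) (fun _ _ => sq_nonneg _) (by simp [hiz] : i ∈ _)
      simp only [PiLp.add_apply, PiLp.smul_apply, hwi, smul_zero, add_zero] at h2
      simpa using h1.trans_le h2)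
    f hf
  have hcoef : 16 * δ / R ^ 2 + 16 * δ * ‖w‖ ^ 2 + 2 * R * ‖v‖ ^ 2 ≤
      16 * δ / R ^ 2 + 64 * δ + 8 * R := by
    nlinarith [mul_le_mul_of_nonneg_left hwn hδ.le, mul_le_mul_of_nonneg_left hvn hR.le]
  exact hmain.trans (by gcongr)

/-- The part of the annulus `ε < ‖x‖ < 1` near the outer sphere (`b = true`) or away from it
(`b = false`), on the positive side of the `z`-axis, with a margin `r`. -/
def axialRegion {n : ℕ} (z : Fin n) (ε δ r : ℝ) (b : Bool) : Set (EuclideanSpace ℝ (Fin n)) :=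
  if b then {x | (1 + ε) / 2 - r ≤ x z ∧ ‖x‖ < 1}
  else {x | δ ≤ x z ∧ ε < ‖x‖ ∧ ‖x‖ < (1 + ε) / 2 + r}

lemma measurableSet_axialRegion {n : ℕ} (z : Fin n) (ε δ r : ℝ) (b : Bool) :
    MeasurableSet (axialRegion z ε δ r b) := by
  have h (c : ℝ) : IsClosed {x : EuclideanSpace ℝ (Fin n) | c ≤ x z} :=
    isClosed_le continuous_const (by fun_prop)
  cases b
  · exact (h δ).measurableSet.inter
      ((isOpen_lt continuous_const continuous_norm).measurableSet.inter
        (isOpen_lt continuous_norm continuous_const).measurableSet)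
  · exact (h _).measurableSet.inter
      (isOpen_lt continuous_norm continuous_const).measurableSet

lemma axialRegion_mono {n : ℕ} (z : Fin n) (ε δ : ℝ) {r r' : ℝ} (h : r ≤ r') (b : Bool) :
    axialRegion z ε δ r b ⊆ axialRegion z ε δ r' b := by
  cases b
  · rintro x ⟨h1, h2, h3⟩
    exact ⟨h1, h2, by linarith⟩
  · rintro x ⟨h1, h2⟩
    exact ⟨by linarith, h2⟩

lemma axialRegion_subset_annulus {n : ℕ} (z : Fin n) {ε δ r : ℝ} (h : 2 * r < 1 - ε)
    (b : Bool) : axialRegion z ε δ r b ⊆ {x | ε < ‖x‖ ∧ ‖x‖ < 1} := by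
  cases b
  · rintro x ⟨h1, h2, h3⟩
    exact ⟨h2, by linarith⟩
  · rintro x ⟨h1, h2⟩
    have h3 := (le_abs_self _).trans (PiLp.norm_apply_le x z)
    exact ⟨by linarith, h2⟩

lemma norm_sq_add_smul_single_add_single {n : ℕ} {z k : Fin n} (hkz : k ≠ z) (s a t : ℝ)
    (x : EuclideanSpace ℝ (Fin n)) :
    ‖x + t • (EuclideanSpace.single k s + EuclideanSpace.single z a)‖ ^ 2 =
      ‖x‖ ^ 2 + 2 * t * (s * x k + a * x z) + t ^ 2 * (s ^ 2 + a ^ 2) := by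
  rw [norm_add_sq_real, inner_smul_right, inner_add_right, norm_smul, mul_pow, norm_add_sq_real]
  simp [EuclideanSpace.inner_single_right, hkz]
  ring

lemma add_smul_mem_axialRegion {n : ℕ} {z k : Fin n} (hkz : k ≠ z) {ε δ r R s t : ℝ}
    (hε : 0 < ε) (hδ : 0 < δ) (hδR : 2 * δ < R) (hr : r ≤ 3 * R) (hR : 10 * R < 1 - ε)
    (hs : s ^ 2 = 1) (b : Bool) (ht : t ∈ Set.Ioc 0 R) {x : EuclideanSpace ℝ (Fin n)}
    (hx : x ∈ axialRegion z ε δ r b) (hxk : |x k| ≤ δ) :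
    x + t • (EuclideanSpace.single k s + EuclideanSpace.single z (if b then -1 else 1)) ∈
      axialRegion z ε δ (r + 2 * R) b := by
  obtain ⟨ht0, htR⟩ := ht
  have hs' : |s * x k| ≤ δ := by
    have : |s| = 1 := by rw [← sq_eq_sq₀ (abs_nonneg _) zero_le_one, sq_abs, hs, one_pow]
    rwa [abs_mul, this, one_mul]
  obtain ⟨hs1, hs2⟩ := abs_le.1 hs'
  cases b
  · obtain ⟨h1, h2, h3⟩ := hx
    have hn := norm_sq_add_smul_single_add_single hkz s 1 t x
    rw [hs] at hn
    refine ⟨?_, ?_, ?_⟩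
    · simp [hkz.symm]; linarith
    · simp only [Bool.false_eq_true, if_false]
      refine lt_of_pow_lt_pow_left₀ 2 (norm_nonneg _) ?_
      rw [hn]
      nlinarith [mul_nonneg ht0.le (by linarith : 0 ≤ s * x k + 1 * x z), sq_nonneg t]
    · simp only [Bool.false_eq_true, if_false]
      refine lt_of_pow_lt_pow_left₀ 2 (by linarith [norm_nonneg x]) ?_
      rw [hn]
      have h4 := (le_abs_self _).trans (PiLp.norm_apply_le x z)
      have h5 := (le_abs_self _).trans (PiLp.norm_apply_le x k)
      have h6 : ‖x‖ ^ 2 + 2 * t * (s * x k + 1 * x z) + t ^ 2 * (1 + 1 ^ 2) ≤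
          (‖x‖ + 2 * t) ^ 2 := by
        nlinarith [mul_le_mul_of_nonneg_left (by linarith : s * x k + 1 * x z ≤ 2 * ‖x‖) ht0.le,
          sq_nonneg t]
      refine h6.trans_lt (pow_lt_pow_left₀ (by linarith) (by positivity) two_ne_zero)
  · obtain ⟨h1, h2⟩ := hx
    have hn := norm_sq_add_smul_single_add_single hkz s (-1) t x
    rw [hs] at hn
    refine ⟨?_, ?_⟩
    · simp [hkz.symm]; linarith
    · simp only [if_true]
      refine lt_of_pow_lt_pow_left₀ 2 zero_le_one ?_
      rw [hn]
      have h3 : s * x k + -1 * x z + t ≤ 0 := by linarith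
      nlinarith [mul_nonpos_of_nonneg_of_nonpos ht0.le h3, norm_nonneg x]

/-- Quantitative trace inequality on the tube around the `z`-axis inside the annulus
`ε < ‖x‖ < 1`. -/
lemma exists_lintegral_sq_tube_le {n : ℕ} (hn : 3 ≤ n) (z : Fin n) :
    ∃ K : NNReal, ∀ ε δ R : ℝ, 0 < ε → 0 < δ → 2 * δ < R → 10 * R < 1 - ε →
      ∀ f : EuclideanSpace ℝ (Fin n) → ℝ, ContDiff ℝ 1 f →
      ∫⁻ x in {x | ε < ‖x‖ ∧ ‖x‖ < 1 ∧ ∑ k ∈ Finset.univ.erase z, x k ^ 2 = δ ^ 2 ∧ δ ≤ x z},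
          ENNReal.ofReal (f x ^ 2) ∂μH[(n : ℝ) - 1] ≤
        K * ENNReal.ofReal (16 * δ / R ^ 2 + 64 * δ + 8 * R) *
          ∫⁻ x in {x | ε < ‖x‖ ∧ ‖x‖ < 1 ∧ δ ^ 2 < ∑ k ∈ Finset.univ.erase z, x k ^ 2},
            ENNReal.ofReal (f x ^ 2 + ‖gradient f x‖ ^ 2) := by
  have hsign : ∀ s : Bool, (if s then -1 else 1 : ℝ) ^ 2 = 1 := by
    intro s; cases s <;> norm_num
  have hpiece : ∀ p : {i : Fin n // i ≠ z} × Bool × Bool, ∃ K : NNReal, ∀ ε δ R : ℝ, 0 < ε →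
      0 < δ → 2 * δ < R → 10 * R < 1 - ε →
      ∀ f : EuclideanSpace ℝ (Fin n) → ℝ, ContDiff ℝ 1 f →
      ∫⁻ x in cylinderPiece z p.1 (if p.2.1 then -1 else 1) δ (axialRegion z ε δ R p.2.2),
          ENNReal.ofReal (f x ^ 2) ∂μH[(n : ℝ) - 1] ≤
        K * ENNReal.ofReal (16 * δ / R ^ 2 + 64 * δ + 8 * R) *
          ∫⁻ x in {x | ε < ‖x‖ ∧ ‖x‖ < 1 ∧ δ ^ 2 < ∑ k ∈ Finset.univ.erase z, x k ^ 2},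
            ENNReal.ofReal (f x ^ 2 + ‖gradient f x‖ ^ 2) := by
    rintro ⟨⟨i, hiz⟩, s, b⟩
    obtain ⟨j, hj⟩ : ∃ j, j ∉ ({z, i} : Finset (Fin n)) := by
      by_contra! h
      have h1 := Finset.card_le_card (fun j _ => h j : Finset.univ ⊆ ({z, i} : Finset (Fin n)))
      have h2 := Finset.card_le_two (a := z) (b := i)
      rw [Finset.card_univ, Fintype.card_fin] at h1
      omega
    simp only [Finset.mem_insert, Finset.mem_singleton, not_or] at hj
    obtain ⟨K, hK⟩ := exists_lintegral_sq_cylinderPiece_le hiz hj.1 hj.2 (hsign s) (hsign b)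
    refine ⟨K, fun ε δ R hε hδ hδR hR f hf => ?_⟩
    refine (hK R δ hδ hδR _ (axialRegion z ε δ (R + 2 * R) b)
      (axialRegion z ε δ (R + 2 * R + 2 * R) b) (measurableSet_axialRegion z ε δ R b)
      (measurableSet_axialRegion z ε δ _ b) (measurableSet_axialRegion z ε δ _ b)
      (fun x hx hxi t ht => add_smul_mem_axialRegion hiz hε hδ hδR (by linarith) hR (hsign s) b
        ht hx hxi)
      (fun x hx hxj t ht => add_smul_mem_axialRegion hj.1 hε hδ hδR (by linarith) hR
        (one_pow 2) b ht hx hxj)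
      (axialRegion_mono z ε δ (by linarith) b) f hf).trans ?_
    refine mul_le_mul' le_rfl (lintegral_mono_set ?_)
    rintro x ⟨hx1, hx2⟩
    obtain ⟨h1, h2⟩ := axialRegion_subset_annulus z (by linarith) b hx1
    exact ⟨h1, h2, hx2⟩
  choose K hK using hpiece
  refine ⟨∑ p, K p, fun ε δ R hε hδ hδR hR f hf => ?_⟩
  have hcover : {x : EuclideanSpace ℝ (Fin n) | ε < ‖x‖ ∧ ‖x‖ < 1 ∧
      ∑ k ∈ Finset.univ.erase z, x k ^ 2 = δ ^ 2 ∧ δ ≤ x z} ⊆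
      ⋃ p : {i : Fin n // i ≠ z} × Bool × Bool,
        cylinderPiece z p.1 (if p.2.1 then -1 else 1) δ (axialRegion z ε δ R p.2.2) := by
    rintro x ⟨h1, h2, h3, h4⟩
    have hne : (Finset.univ.erase z).Nonempty := by
      rw [Finset.nonempty_iff_ne_empty]
      rintro h
      rw [h, Finset.sum_empty] at h3
      exact (pow_pos hδ 2).ne h3
    obtain ⟨i, hi, hmax⟩ := Finset.exists_max_image _ (fun k => |x k|) hne
    have hxi : 0 < |x i| := by
      by_contra! h
      have : ∑ k ∈ Finset.univ.erase z, x k ^ 2 = 0 := Finset.sum_eq_zero fun k hk => by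
        have := abs_eq_zero.1 (((hmax k hk).trans h).antisymm (abs_nonneg _))
        simp [this]
      exact (pow_pos hδ 2).ne (this.symm.trans h3)
    obtain ⟨s, hs⟩ : ∃ s : Bool, (if s then -1 else 1) * x i = |x i| := by
      rcases le_total 0 (x i) with h | h
      · exact ⟨false, by simp [abs_of_nonneg h]⟩
      · exact ⟨true, by simp [abs_of_nonpos h]⟩
    obtain ⟨b, hb⟩ : ∃ b, x ∈ axialRegion z ε δ R b := by
      by_cases h : (1 + ε) / 2 - R ≤ x z
      · exact ⟨true, h, h2⟩
      · refine ⟨false, h4, h1, ?_⟩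
        push Not at h
        refine lt_of_pow_lt_pow_left₀ 2 (by linarith) ?_
        rw [EuclideanSpace.norm_sq_eq, ← Finset.add_sum_erase _ _ (Finset.mem_univ z)]
        simp only [Real.norm_eq_abs, sq_abs]
        rw [h3]
        nlinarith
    refine Set.mem_iUnion.2 ⟨(⟨i, Finset.ne_of_mem_erase hi⟩, s, b), hb, h3, ?_, ?_⟩
    · simpa only [hs] using hxi
    · intro k hk
      simpa only [hs] using hmax k (by simp [hk])
  refine (lintegral_mono_set hcover).trans ((lintegral_iUnion_le _ _).trans ?_)
  rw [tsum_fintype, ENNReal.ofNNReal_finsetSum, Finset.sum_mul, Finset.sum_mul]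
  exact Finset.sum_le_sum fun p _ => hK p ε δ R hε hδ hδR hR f hf

/-- Squared distance to a point of the `z`-axis. -/
lemma dist_sq_smul_single {n : ℕ} (z : Fin n) (x : EuclideanSpace ℝ (Fin n)) (t : ℝ) :
    dist x (t • EuclideanSpace.single z (1 : ℝ)) ^ 2 =
      (x z - t) ^ 2 + ∑ k ∈ Finset.univ.erase z, x k ^ 2 := by
  rw [EuclideanSpace.dist_sq_eq, ← Finset.add_sum_erase _ _ (Finset.mem_univ z)]
  congr 1
  · simp [Real.dist_eq]
  · refine Finset.sum_congr rfl fun k hk => ?_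
    simp [Finset.ne_of_mem_erase hk]

lemma sum_sq_le_infDist_sq {n : ℕ} (z : Fin n) {γ : Set (EuclideanSpace ℝ (Fin n))}
    (hne : γ.Nonempty) (hγ : ∀ y ∈ γ, ∃ t : ℝ, y = t • EuclideanSpace.single z (1 : ℝ))
    (x : EuclideanSpace ℝ (Fin n)) :
    ∑ k ∈ Finset.univ.erase z, x k ^ 2 ≤ Metric.infDist x γ ^ 2 := by
  rw [← Real.sqrt_le_left Metric.infDist_nonneg, Metric.le_infDist hne]
  intro y hy
  obtain ⟨t, rfl⟩ := hγ y hy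
  rw [Real.sqrt_le_left dist_nonneg, dist_sq_smul_single]
  linarith [sq_nonneg (x z - t)]

/-- Inside the annulus, a thin tube around a segment of the `z`-axis is contained in a cylinder. -/
lemma tube_subset_cylinder {n : ℕ} (z : Fin n) {ε δ : ℝ} (hε : 0 < ε) (hε1 : ε < 1) (hδ : 0 < δ)
    (hδε : 2 * δ < ε) {γ : Set (EuclideanSpace ℝ (Fin n))}
    (hγ : γ = {x | ∃ t : ℝ, ε / 2 ≤ t ∧ t ≤ 1 ∧ x = t • EuclideanSpace.single z (1 : ℝ)}) :
    {x : EuclideanSpace ℝ (Fin n) | ε < ‖x‖ ∧ ‖x‖ < 1 ∧ Metric.infDist x γ = δ} ⊆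
      {x | ε < ‖x‖ ∧ ‖x‖ < 1 ∧ ∑ k ∈ Finset.univ.erase z, x k ^ 2 = δ ^ 2 ∧ δ ≤ x z} := by
  have hne : γ.Nonempty := by
    rw [hγ]
    exact ⟨_, 1, by linarith, le_rfl, rfl⟩
  rintro x ⟨h1, h2, h3⟩
  have hle : ∑ k ∈ Finset.univ.erase z, x k ^ 2 ≤ δ ^ 2 := by
    rw [← h3]
    refine sum_sq_le_infDist_sq z hne (fun y hy => ?_) x
    rw [hγ] at hy
    obtain ⟨t, -, -, rfl⟩ := hy
    exact ⟨t, rfl⟩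
  have hpos : 0 < x z := by
    obtain ⟨y, hy, hxy⟩ := (Metric.infDist_lt_iff hne).1 (by linarith : Metric.infDist x γ < ε / 2)
    rw [hγ] at hy
    obtain ⟨t, ht, -, rfl⟩ := hy
    have hd := pow_lt_pow_left₀ hxy dist_nonneg two_ne_zero
    rw [dist_sq_smul_single] at hd
    have hN : 0 ≤ ∑ k ∈ Finset.univ.erase z, x k ^ 2 := Finset.sum_nonneg fun _ _ => sq_nonneg _
    by_contra! h
    nlinarith
  have hnorm : ‖x‖ ^ 2 = x z ^ 2 + ∑ k ∈ Finset.univ.erase z, x k ^ 2 := by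
    rw [EuclideanSpace.norm_sq_eq, ← Finset.add_sum_erase _ _ (Finset.mem_univ z)]
    simp only [Real.norm_eq_abs, sq_abs]
  have hz : ε / 2 ≤ x z := by
    have := pow_lt_pow_left₀ h1 hε.le two_ne_zero
    by_contra! h
    nlinarith
  have hz1 : x z ≤ 1 := ((le_abs_self _).trans (PiLp.norm_apply_le x z)).trans h2.le
  have hge : δ ^ 2 ≤ ∑ k ∈ Finset.univ.erase z, x k ^ 2 := by
    have hmem : x z • EuclideanSpace.single z (1 : ℝ) ∈ γ := hγ ▸ ⟨x z, hz, hz1, rfl⟩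
    have := pow_le_pow_left₀ hδ.le (h3 ▸ Metric.infDist_le_dist_of_mem hmem) 2
    rwa [dist_sq_smul_single, sub_self, zero_pow two_ne_zero, zero_add] at this
  exact ⟨h1, h2, hle.antisymm hge, by linarith⟩

/-- The energy density of a `C¹` function has the same Bochner and Lebesgue integral on bounded
measurable sets. -/
lemma ofReal_setIntegral_energy {n : ℕ} {f : EuclideanSpace ℝ (Fin n) → ℝ} (hf : ContDiff ℝ 1 f)
    {S : Set (EuclideanSpace ℝ (Fin n))} (hS : S ⊆ Metric.closedBall 0 1) :
    ENNReal.ofReal (∫ x in S, (f x ^ 2 + ‖gradient f x‖ ^ 2)) =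
      ∫⁻ x in S, ENNReal.ofReal (f x ^ 2 + ‖gradient f x‖ ^ 2) := by
  have hgc : Continuous (gradient f) :=
    (InnerProductSpace.toDual ℝ _).symm.continuous.comp (hf.continuous_fderiv one_ne_zero)
  have hc : Continuous fun x => f x ^ 2 + ‖gradient f x‖ ^ 2 :=
    (hf.continuous.pow 2).add (hgc.norm.pow 2)
  exact ofReal_integral_eq_lintegral_ofReal
    ((hc.continuousOn.integrableOn_compact (isCompact_closedBall 0 1)).mono_set hS)
    (Eventually.of_forall fun x => by positivity)

/-- No-concentration lemma: for a family `u_δ` of smooth functions on `ℝⁿ` that is uniformly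
bounded in `W^{1,2}` on the domains `Ω_δ = {ε < ‖x‖ < 1, dist(x,γ) > δ}`, the `L²` mass on
the tube boundaries `T_δ = {ε < ‖x‖ < 1, dist(x,γ) = δ}` tends to `0` as `δ → 0⁺`. Here
`γ = {t e₁ : ε/2 ≤ t ≤ 1}`. -/
theorem stmt14 {n : ℕ} (hn : 3 ≤ n) (ε : ℝ) (hε : 0 < ε) (hε1 : ε < 1)
    (γ : Set (EuclideanSpace ℝ (Fin n)))
    (hγ : γ = {x | ∃ t : ℝ, ε / 2 ≤ t ∧ t ≤ 1 ∧
      x = t • EuclideanSpace.single (⟨0, by omega⟩ : Fin n) (1 : ℝ)})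
    (δ₀ C : ℝ) (hδ₀ : 0 < δ₀) (hC : 0 < C)
    (u : ℝ → EuclideanSpace ℝ (Fin n) → ℝ)
    (hsm : ∀ δ ∈ Set.Ioo (0 : ℝ) δ₀, ContDiff ℝ (⊤ : ℕ∞) (u δ))
    (hbd : ∀ δ ∈ Set.Ioo (0 : ℝ) δ₀,
      (∫ x in {x : EuclideanSpace ℝ (Fin n) |
          ε < ‖x‖ ∧ ‖x‖ < 1 ∧ δ < Metric.infDist x γ},
        ((u δ x) ^ 2 + ‖gradient (u δ) x‖ ^ 2)) ≤ C) :
    Tendsto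
      (fun δ : ℝ =>
        ∫ x in {x : EuclideanSpace ℝ (Fin n) |
            ε < ‖x‖ ∧ ‖x‖ < 1 ∧ Metric.infDist x γ = δ},
          (u δ x) ^ 2 ∂(μH[(n : ℝ) - 1]))
      (nhdsWithin 0 (Set.Ioi 0)) (nhds 0) := by
  set z : Fin n := ⟨0, by omega⟩
  obtain ⟨K, hK⟩ := exists_lintegral_sq_tube_le hn z
  set R : ℝ → ℝ := fun δ => √(√δ) with hR
  set c : ℝ → ℝ := fun δ => 16 * √δ + 64 * δ + 8 * R δ with hc
  have hne : γ.Nonempty := by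
    rw [hγ]
    exact ⟨_, 1, by linarith, le_rfl, rfl⟩
  have hRlim : Tendsto R (nhds 0) (nhds 0) := by
    have : Continuous R := by fun_prop
    simpa [hR] using this.tendsto 0
  have hclim : Tendsto c (nhds 0) (nhds 0) := by
    have : Continuous c := by fun_prop
    simpa [hc, hR] using this.tendsto 0
  have hbound : ∀ᶠ δ in nhdsWithin (0 : ℝ) (Set.Ioi 0),
      ∫⁻ x in {x : EuclideanSpace ℝ (Fin n) | ε < ‖x‖ ∧ ‖x‖ < 1 ∧ Metric.infDist x γ = δ},
        ENNReal.ofReal (u δ x ^ 2) ∂(μH[(n : ℝ) - 1]) ≤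
      ENNReal.ofReal (K * c δ * C) := by
    have h1 : ∀ᶠ δ : ℝ in nhds 0, 10 * R δ < 1 - ε := by
      have := hRlim.const_mul 10
      rw [mul_zero] at this
      exact this.eventually_lt_const (by linarith)
    have h2 : ∀ᶠ δ : ℝ in nhds 0, δ < δ₀ := eventually_lt_nhds hδ₀
    have h3 : ∀ᶠ δ : ℝ in nhds 0, δ < ε / 2 := eventually_lt_nhds (by linarith)
    have h4 : ∀ᶠ δ : ℝ in nhds 0, δ < 1 / 4 := eventually_lt_nhds (by norm_num)
    filter_upwards [nhdsWithin_le_nhds h1, nhdsWithin_le_nhds h2, nhdsWithin_le_nhds h3,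
      nhdsWithin_le_nhds h4, self_mem_nhdsWithin] with δ h1 h2 h3 h4 hδ
    replace hδ : 0 < δ := hδ
    have hs : √δ ^ 2 = δ := Real.sq_sqrt hδ.le
    have hs0 : 0 < √δ := Real.sqrt_pos.2 hδ
    have hR2 : R δ ^ 2 = √δ := Real.sq_sqrt hs0.le
    have hR0 : 0 < R δ := Real.sqrt_pos.2 hs0
    have hs1 : √δ < 1 / 2 := by nlinarith
    have hR1 : R δ < 1 := by nlinarith
    have hδR : 2 * δ < R δ := by nlinarith
    have hcoef : 16 * δ / R δ ^ 2 + 64 * δ + 8 * R δ = c δ := by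
      rw [hR2, mul_div_assoc, Real.div_sqrt]
    have hf : ContDiff ℝ 1 (u δ) := (hsm δ ⟨hδ, h2⟩).of_le (by exact_mod_cast le_top)
    have hsub : {x : EuclideanSpace ℝ (Fin n) | ε < ‖x‖ ∧ ‖x‖ < 1 ∧
        δ ^ 2 < ∑ k ∈ Finset.univ.erase z, x k ^ 2} ⊆
        {x | ε < ‖x‖ ∧ ‖x‖ < 1 ∧ δ < Metric.infDist x γ} := by
      rintro x ⟨hx1, hx2, hx3⟩
      refine ⟨hx1, hx2, lt_of_pow_lt_pow_left₀ 2 Metric.infDist_nonneg (hx3.trans_le ?_)⟩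
      refine sum_sq_le_infDist_sq z hne (fun y hy => ?_) x
      rw [hγ] at hy
      obtain ⟨t, -, -, rfl⟩ := hy
      exact ⟨t, rfl⟩
    have hball : {x : EuclideanSpace ℝ (Fin n) | ε < ‖x‖ ∧ ‖x‖ < 1 ∧
        δ < Metric.infDist x γ} ⊆ Metric.closedBall 0 1 :=
      fun x hx => mem_closedBall_zero_iff.2 hx.2.1.le
    have henergy := (ofReal_setIntegral_energy hf hball).symm.trans_le
      (ENNReal.ofReal_le_ofReal (hbd δ ⟨hδ, h2⟩))
    calc _ ≤ _ := lintegral_mono_set (tube_subset_cylinder z hε hε1 hδ (by linarith) hγ)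
      _ ≤ _ := hK ε δ (R δ) hε hδ hδR h1 (u δ) hf
      _ ≤ K * ENNReal.ofReal (c δ) * ENNReal.ofReal C := by
        rw [hcoef]
        exact mul_le_mul' le_rfl ((lintegral_mono_set hsub).trans henergy)
      _ = ENNReal.ofReal (K * c δ * C) := by
        rw [ENNReal.ofReal_mul' hC.le, ENNReal.ofReal_mul K.coe_nonneg, ENNReal.ofReal_coe_nnreal]
  have hlim : Tendsto (fun δ => K * c δ * C) (nhdsWithin 0 (Set.Ioi 0)) (nhds 0) := by
    have := ((hclim.const_mul (K : ℝ)).mul_const C).mono_left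
      (nhdsWithin_le_nhds (s := Set.Ioi (0 : ℝ)))
    simpa using this
  refine squeeze_zero' (Eventually.of_forall fun δ => integral_nonneg fun x => sq_nonneg _) ?_ hlim
  filter_upwards [hbound, self_mem_nhdsWithin] with δ h hδ
  replace hδ : 0 < δ := hδ
  refine (Real.le_norm_self _).trans ((norm_integral_le_lintegral_norm _).trans ?_)
  simp only [norm_pow, Real.norm_eq_abs, sq_abs]
  exact ENNReal.toReal_le_of_le_ofReal (by positivity) h
end
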